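/- For every integer n ≥ 3, the (n−1)-th homotopy group π_{n−1}(Ñ₀, x₀) at the basepoint x₀ = 0 ∈ Ñ₀ is isomorphic (as a group) to the free abelian group on the set ℤⁿ, i.e., to the direct sum ⊕_{ℤⁿ} ℤ of copies of ℤ indexed by ℤⁿ. -/

import Mathlib

open scoped Topology

/-! ### Labelled cubes and their cochains -/

/-- A labelling of the vertices of the `d`-dimensional cube. -/
abbrev LCube (V : Type*) (d : ℕ) := (Fin d → Bool) → V

namespace LCube

variable {V W : Type*} {A : Type*} [AddCommGroup A] {d : ℕ}

/-- The face `t i = b` of a labelled cube. -/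
def face (i : Fin (d + 1)) (b : Bool) (c : LCube V (d + 1)) : LCube V d :=
  fun t => c (i.insertNth b t)

/-- The cubical coboundary. -/
def cob (U : LCube V d → A) (c : LCube V (d + 1)) : A :=
  ∑ i : Fin (d + 1), (-1 : ℤ) ^ (i : ℕ) • (U (face i true c) - U (face i false c))

theorem insertNth_insertNth_swap (i : Fin (d + 2)) (j : Fin (d + 1)) (b b' : Bool)
    (t : Fin d → Bool) :
    (i.succAbove j).insertNth (α := fun _ => Bool) b'
      ((j.predAbove i).insertNth (α := fun _ => Bool) b t) =
      i.insertNth (α := fun _ => Bool) b (j.insertNth (α := fun _ => Bool) b' t) := by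
  symm
  rw [Fin.insertNth_eq_iff]
  refine ⟨?_, ?_⟩
  · have h := Fin.insertNth_apply_succAbove (α := fun _ => Bool) (i.succAbove j) b'
      ((j.predAbove i).insertNth (α := fun _ => Bool) b t) (j.predAbove i)
    rw [Fin.succAbove_succAbove_predAbove] at h
    simp [h]
  · symm
    rw [Fin.eq_insertNth_iff]
    refine ⟨by simp [Fin.removeNth], ?_⟩
    funext k
    simp only [Fin.removeNth]
    rw [← Fin.succAbove_succAbove_succAbove_predAbove]
    simp

theorem face_face (i : Fin (d + 2)) (j : Fin (d + 1)) (b b' : Bool) (c : LCube V (d + 2)) :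
    face (j.predAbove i) b (face (i.succAbove j) b' c) = face j b' (face i b c) := by
  funext t
  simp only [face, insertNth_insertNth_swap]

theorem cob_cob (U : LCube V d → A) (c : LCube V (d + 2)) : cob (cob U) c = 0 := by
  simp only [cob, ← Finset.sum_sub_distrib, ← smul_sub, Finset.smul_sum, smul_smul]
  rw [← Finset.sum_product']
  refine Finset.sum_involution (fun x _ => (x.1.succAbove x.2, x.2.predAbove x.1)) ?_ ?_ ?_ ?_
  · rintro ⟨i, j⟩ -
    dsimp only
    simp only [face_face, ← pow_add, Fin.neg_one_pow_succAbove_add_predAbove, neg_smul]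
    rw [add_neg_eq_zero]
    congr 1
    abel
  · rintro ⟨i, j⟩ - - h
    exact Fin.succAbove_ne i j (congrArg Prod.fst h)
  · simp
  · rintro ⟨i, j⟩ -
    ext1
    · simp [Fin.succAbove_succAbove_predAbove]
    · dsimp only
      have h1 := Fin.succAbove_succAbove_predAbove i j
      have h2 := Fin.succAbove_succAbove_predAbove (i.succAbove j) (j.predAbove i)
      have h3 : (i.succAbove j).succAbove (j.predAbove i) = i := h1
      rw [h3] at h2
      exact Fin.succAbove_right_injective h2

/-- The cube with constant label `v` on the face `t 0 = false` and `c` on the opposite face. -/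
def cone (v : V) (c : LCube V d) : LCube V (d + 1) :=
  fun t => if t 0 then c (Fin.tail t) else v

theorem face_zero_true_cone (v : V) (c : LCube V d) : face 0 true (cone v c) = c := by
  funext t
  simp [face, cone]

theorem face_zero_false_cone (v : V) (c : LCube V d) : face 0 false (cone v c) = fun _ => v := by
  funext t
  simp [face, cone]

theorem face_succ_cone (v : V) (c : LCube V (d + 1)) (i : Fin (d + 1)) (b : Bool) :
    face i.succ b (cone v c) = cone v (face i b c) := by
  funext t
  have h0 : (i.succ.insertNth (α := fun _ => Bool) b t) 0 = t 0 := by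
    have := Fin.insertNth_apply_succAbove (α := fun _ => Bool) i.succ b t 0
    rwa [Fin.succ_succAbove_zero] at this
  have h1 : Fin.tail (i.succ.insertNth (α := fun _ => Bool) b t) =
      i.insertNth (α := fun _ => Bool) b (Fin.tail t) := by
    symm
    rw [Fin.insertNth_eq_iff]
    refine ⟨by simp [Fin.tail], ?_⟩
    funext k
    have := Fin.insertNth_apply_succAbove (α := fun _ => Bool) i.succ b t k.succ
    rw [Fin.succ_succAbove_succ] at this
    simpa [Fin.removeNth, Fin.tail] using this.symm
  simp only [face, cone, h0, h1]

/-- The cube whose label at `t` is `a k`, where `k` is the number of leading `true`s of `t`. -/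
def leadC : (d : ℕ) → (Fin (d + 1) → V) → LCube V d
  | 0, a => fun _ => a 0
  | d + 1, a => cone (a 0) (leadC d (Fin.tail a))

theorem leadC_mem_range : ∀ (d : ℕ) (a : Fin (d + 1) → V) (t : Fin d → Bool),
    leadC d a t ∈ Set.range a
  | 0, a, t => ⟨0, rfl⟩
  | d + 1, a, t => by
    simp only [leadC, cone]
    split_ifs
    · obtain ⟨j, hj⟩ := leadC_mem_range d (Fin.tail a) (Fin.tail t)
      exact ⟨j.succ, hj⟩
    · exact ⟨0, rfl⟩

theorem map_leadC (f : V → W) : ∀ (d : ℕ) (a : Fin (d + 1) → V),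
    f ∘ leadC d a = leadC d (f ∘ a)
  | 0, a => rfl
  | d + 1, a => by
    have := map_leadC f d (Fin.tail a)
    funext t
    have h2 := congrFun this (Fin.tail t)
    simp only [Function.comp_apply, leadC, cone] at h2 ⊢
    split_ifs
    · exact h2
    · rfl

theorem face_true_leadC : ∀ (d : ℕ) (a : Fin (d + 2) → V) (i : Fin (d + 1)),
    face i true (leadC (d + 1) a) = leadC d (a ∘ i.castSucc.succAbove)
  | 0, a, i => by
    obtain rfl : i = 0 := Fin.ext (by omega)
    exact (face_zero_true_cone _ _).trans rfl
  | d + 1, a, i => by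
    refine Fin.cases ?_ (fun i => ?_) i
    · rw [leadC, face_zero_true_cone]
      rfl
    · rw [leadC, face_succ_cone, face_true_leadC d]
      rw [leadC]
      congr 2
      funext k
      simp only [Fin.tail, Function.comp_apply, ← Fin.succ_castSucc, Fin.succ_succAbove_succ]

theorem face_false_leadC_mem : ∀ (d : ℕ) (a : Fin (d + 2) → V) (i : Fin (d + 1))
    (t : Fin d → Bool), ∃ j ≤ i.castSucc, face i false (leadC (d + 1) a) t = a j
  | 0, a, i, t => by
    obtain rfl : i = 0 := Fin.ext (by omega)
    rw [leadC, face_zero_false_cone]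
    exact ⟨0, le_rfl, rfl⟩
  | d + 1, a, i, t => by
    refine Fin.cases ?_ (fun i => ?_) i
    · rw [leadC, face_zero_false_cone]
      exact ⟨0, le_rfl, rfl⟩
    · rw [leadC, face_succ_cone]
      simp only [cone]
      split_ifs
      · obtain ⟨j, hj, h⟩ := face_false_leadC_mem d (Fin.tail a) i (Fin.tail t)
        exact ⟨j.succ, by simpa [Fin.le_def] using hj, h⟩
      · exact ⟨0, Fin.zero_le _, rfl⟩

theorem face_last_false_leadC : ∀ (d : ℕ) (a : Fin (d + 2) → V),
    face (Fin.last d) false (leadC (d + 1) a) = leadC d (a ∘ Fin.castSucc)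
  | 0, a => by
    rw [leadC]
    exact face_zero_false_cone _ _
  | d + 1, a => by
    rw [leadC, ← Fin.succ_last, face_succ_cone, face_last_false_leadC d]
    rw [leadC]
    congr 1

/-! ### Chains of vertices -/

theorem ncard_chain_le (D : Set (Fin d → Bool)) (hD : IsChain (· ≤ ·) D) : D.ncard ≤ d + 1 := by
  have hinj : Set.InjOn (fun t : Fin d → Bool => (Finset.univ.filter (fun i => t i = true)).card)
      D := by
    have key : ∀ s ∈ D, ∀ t ∈ D, s ≤ t →
        (Finset.univ.filter (fun i => s i = true)).card =
          (Finset.univ.filter (fun i => t i = true)).card → s = t := by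
      intro s _ t _ hst hcard
      have hsub : Finset.univ.filter (fun i => s i = true) ⊆
          Finset.univ.filter (fun i => t i = true) := by
        intro i
        have := hst i
        simp only [Finset.mem_filter, Finset.mem_univ, true_and]
        intro h
        rw [h] at this
        exact top_le_iff.mp this
      have heq := Finset.eq_of_subset_of_card_le hsub hcard.ge
      funext i
      have := Finset.ext_iff.mp heq i
      simp only [Finset.mem_filter, Finset.mem_univ, true_and] at this
      exact Bool.eq_iff_iff.mpr this
    intro s hs t ht h
    rcases hD.total hs ht with hst | hst
    · exact key s hs t ht hst h
    · exact (key t ht s hs hst h.symm).symm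
  rw [← hinj.ncard_image]
  calc _ ≤ (Set.Iio (d + 1)).ncard := by
        refine Set.ncard_le_ncard ?_ (Set.finite_Iio _)
        rintro _ ⟨t, -, rfl⟩
        simp only [Set.mem_Iio]
        exact Nat.lt_succ_of_le ((Finset.card_le_univ _).trans (by simp))
    _ = d + 1 := by
        rw [← Finset.coe_Iio, Set.ncard_coe_finset, Nat.card_Iio]

theorem IsChain.image_mono {d e : ℕ} {D : Set (Fin d → Bool)} (hD : IsChain (· ≤ ·) D)
    {f : (Fin d → Bool) → (Fin e → Bool)} (hf : Monotone f) : IsChain (· ≤ ·) (f '' D) := by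
  rintro _ ⟨a, ha, rfl⟩ _ ⟨b, hb, rfl⟩ _
  exact (hD.total ha hb).imp (fun h => hf h) (fun h => hf h)

theorem ncard_image_chain_le {D : Set (Fin d → Bool)} (hD : IsChain (· ≤ ·) D) (c : LCube V d) :
    (c '' D).ncard ≤ d + 1 :=
  (Set.ncard_image_le (Set.toFinite _)).trans (ncard_chain_le D hD)

/-- Every chain of vertices has at most `d` distinct labels. -/
def Few (c : LCube V d) : Prop :=
  ∀ D : Set (Fin d → Bool), IsChain (· ≤ ·) D → (c '' D).ncard ≤ d

theorem monotone_tail : Monotone (fun t : Fin (d + 1) → Bool => (Fin.tail t : Fin d → Bool)) :=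
  fun _ _ h i => h i.succ

theorem image_cone_subset (v : V) (c : LCube V d) (D : Set (Fin (d + 1) → Bool)) :
    cone v c '' D ⊆ insert v (c '' ((fun t => Fin.tail t) '' D)) := by
  rintro _ ⟨t, ht, rfl⟩
  simp only [cone]
  split_ifs
  · exact Or.inr ⟨_, ⟨t, ht, rfl⟩, rfl⟩
  · exact Or.inl rfl

theorem Few.cone {c : LCube V d} (hc : Few c) (v : V) : Few (cone v c) := by
  intro D hD
  refine (Set.ncard_le_ncard (image_cone_subset v c D) (Set.toFinite _)).trans ?_
  refine (Set.ncard_insert_le _ _).trans ?_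
  exact Nat.add_le_add_right (hc _ (IsChain.image_mono hD monotone_tail)) 1

theorem few_const (v : V) : Few (fun _ : Fin (d + 1) → Bool => v) := by
  intro D _
  calc _ ≤ ({v} : Set V).ncard := by
        refine Set.ncard_le_ncard ?_ (Set.finite_singleton _)
        rintro _ ⟨t, -, rfl⟩
        rfl
    _ ≤ d + 1 := by simp

theorem few_cone_bot (b : LCube V (d + 1)) : Few (LCube.cone (b ⊥) b) := by
  intro D hD
  have h1 : IsChain (· ≤ ·) (insert (⊥ : Fin (d + 1) → Bool) ((fun t => Fin.tail t) '' D)) :=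
    (IsChain.image_mono hD monotone_tail).insert (fun b _ _ => Or.inl bot_le)
  refine le_trans (Set.ncard_le_ncard ?_ (Set.toFinite _)) (ncard_image_chain_le h1 b)
  rw [Set.image_insert_eq]
  exact image_cone_subset _ _ _

/-- Cubes obtained from an `r`-dimensional cube by iterated coning. -/
inductive ConeOver (r : ℕ) : {d : ℕ} → LCube V d → Prop
  | base (b : LCube V r) : ConeOver r b
  | cone {d : ℕ} (v : V) (c : LCube V d) : ConeOver r c → ConeOver r (LCube.cone v c)

theorem ConeOver.exists_filling {r : ℕ} {c : LCube V d} (hc : ConeOver (r + 1) c) :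
    ∃ (C : LCube V (d + 1)) (k : Fin (d + 1)), face k true C = c ∧ Few C ∧
      ∀ i b, (i ≠ k ∨ b = false) → (Few (face i b C) ∨ ConeOver r (face i b C)) := by
  induction hc with
  | base b =>
    refine ⟨LCube.cone (b ⊥) b, 0, face_zero_true_cone _ _, few_cone_bot b, ?_⟩
    intro i e
    refine Fin.cases ?_ (fun i => ?_) i
    · intro h
      obtain rfl : e = false := by simpa using h
      rw [face_zero_false_cone]
      exact Or.inl (few_const _)
    · intro _
      rw [face_succ_cone]
      exact Or.inr (.cone _ _ (.base _))
  | @cone d v c _ ih =>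
    obtain ⟨C, k, h1, h2, h3⟩ := ih
    refine ⟨LCube.cone v C, k.succ, by rw [face_succ_cone, h1], h2.cone v, ?_⟩
    intro i e
    refine Fin.cases ?_ (fun i => ?_) i
    · intro _
      cases e with
      | true =>
        rw [face_zero_true_cone]
        exact Or.inl h2
      | false =>
        rw [face_zero_false_cone]
        exact Or.inl (few_const _)
    · intro h
      rw [face_succ_cone]
      rcases h3 i e (by simpa using h) with h | h
      · exact Or.inl (h.cone v)
      · exact Or.inr (.cone _ _ h)

theorem ConeOver.eq_leadC {c : LCube V d} (hc : ConeOver 0 c) : ∃ a, c = leadC d a := by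
  induction hc with
  | base b =>
    refine ⟨fun _ => b ⊥, ?_⟩
    funext t
    rw [Subsingleton.elim t ⊥]
    rfl
  | cone v c _ ih =>
    obtain ⟨a, rfl⟩ := ih
    exact ⟨Fin.cons v a, by rw [leadC]; rfl⟩

theorem cob_eq_zero_isolate {U : LCube V d → A} {C : LCube V (d + 1)} (h : cob U C = 0)
    (k : Fin (d + 1)) (hz : ∀ i b, (i ≠ k ∨ b = false) → U (face i b C) = 0) :
    U (face k true C) = 0 := by
  rw [cob, Finset.sum_eq_single k] at h
  · rw [hz k false (Or.inr rfl), sub_zero] at h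
    rcases neg_one_pow_eq_or ℤ (k : ℕ) with h' | h' <;> simpa [h'] using h
  · intro i _ hi
    rw [hz i true (Or.inl hi), hz i false (Or.inl hi), sub_zero, smul_zero]
  · simp

/-- A cocycle vanishing on degenerate cubes is determined by its values on `leadC`. -/
theorem eq_zero_of_leadC {U : LCube V d → A} (hcob : ∀ C, cob U C = 0)
    (hfew : ∀ c, Few c → U c = 0) (hlead : ∀ a, U (leadC d a) = 0) (c : LCube V d) : U c = 0 := by
  have key : ∀ r : ℕ, ∀ c : LCube V d, ConeOver r c → U c = 0 := by
    intro r
    induction r with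
    | zero =>
      intro c hc
      obtain ⟨a, rfl⟩ := hc.eq_leadC
      exact hlead a
    | succ r ih =>
      intro c hc
      obtain ⟨C, k, h1, -, h3⟩ := hc.exists_filling
      rw [← h1]
      refine cob_eq_zero_isolate (hcob C) k fun i b hib => ?_
      exact (h3 i b hib).elim (hfew _) (ih _)
  exact key d c (.base c)

theorem few_of_face_false_leadC (a : Fin (d + 2) → V) (i : Fin (d + 1)) (hi : i ≠ Fin.last d) :
    Few (face i false (leadC (d + 1) a)) := by
  intro D _
  calc _ ≤ (a '' Set.Iic i.castSucc).ncard := by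
        refine Set.ncard_le_ncard ?_ (Set.toFinite _)
        rintro _ ⟨t, -, rfl⟩
        obtain ⟨j, hj, h⟩ := face_false_leadC_mem d a i t
        exact ⟨j, hj, h.symm⟩
    _ ≤ (Set.Iic i.castSucc).ncard := Set.ncard_image_le (Set.toFinite _)
    _ ≤ d := by
        rw [← Finset.coe_Iic, Set.ncard_coe_finset, Fin.card_Iic]
        have := Fin.val_lt_last hi
        simpa using this

theorem sum_leadC_eq_zero {U : LCube V d → A} (hcob : ∀ C, cob U C = 0)
    (hfew : ∀ c, Few c → U c = 0) (b : Fin (d + 2) → V) :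
    ∑ i : Fin (d + 2), (-1 : ℤ) ^ (i : ℕ) • U (leadC d (b ∘ i.succAbove)) = 0 := by
  have h := hcob (leadC (d + 1) b)
  rw [cob, Finset.sum_congr rfl (g := fun i : Fin (d + 1) =>
    (-1 : ℤ) ^ (i : ℕ) • U (leadC d (b ∘ i.castSucc.succAbove)) -
    (-1 : ℤ) ^ (i : ℕ) • U (face i false (leadC (d + 1) b)))
    (fun i _ => by rw [smul_sub, face_true_leadC]), Finset.sum_sub_distrib,
    Finset.sum_eq_single (Fin.last d) (s := Finset.univ)
      (f := fun i : Fin (d + 1) => (-1 : ℤ) ^ (i : ℕ) • U (face i false (leadC (d + 1) b)))] at h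
  · rw [Fin.sum_univ_castSucc]
    rw [face_last_false_leadC] at h
    simp only [Fin.val_castSucc, Fin.val_last, Fin.succAbove_last, pow_succ, mul_neg, mul_one,
      neg_smul] at h ⊢
    rwa [← sub_eq_add_neg]
  · intro i _ hi
    rw [hfew _ (few_of_face_false_leadC b i hi), smul_zero]
  · simp

/-- A cocycle vanishing on degenerate cubes, on cubes missing some colour, and on one
fully coloured `leadC` cube, vanishes. -/
theorem eq_zero_of_colour {U : LCube V d → A} (hcob : ∀ C, cob U C = 0)
    (hfew : ∀ c, Few c → U c = 0) (top : V → Fin (d + 1))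
    (hmiss : ∀ c j, (∀ t, top (c t) ≠ j) → U c = 0)
    (u : Fin (d + 1) → V) (hu : ∀ j, top (u j) = j) (h0 : U (leadC d u) = 0) (c : LCube V d) :
    U c = 0 := by
  have hinj : ∀ (a : Fin (d + 1) → V) (x y : Fin (d + 1)), x ≠ y → top (a x) = top (a y) →
      U (leadC d a) = 0 := by
    intro a x y hxy h
    have : ¬ Function.Surjective (top ∘ a) := fun hs =>
      hxy ((Finite.injective_iff_surjective.mpr hs) h)
    simp only [Function.Surjective, not_forall, not_exists] at this
    obtain ⟨j, hj⟩ := this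
    refine hmiss _ j fun t ht => ?_
    obtain ⟨i, hi⟩ := leadC_mem_range d a t
    exact hj i (by rw [← ht, ← hi]; rfl)
  have hswap : ∀ (b : Fin (d + 2) → V) (x y : Fin (d + 2)), x ≠ y → top (b x) = top (b y) →
      U (leadC d (b ∘ y.succAbove)) = 0 → U (leadC d (b ∘ x.succAbove)) = 0 := by
    intro b x y hxy h hy
    have hs := sum_leadC_eq_zero hcob hfew b
    rw [Fintype.sum_eq_single x] at hs
    · rcases neg_one_pow_eq_or ℤ (x : ℕ) with h' | h' <;> simpa [h'] using hs
    · intro i hi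
      by_cases hiy : i = y
      · rw [hiy, hy, smul_zero]
      · obtain ⟨x', hx'⟩ := Fin.exists_succAbove_eq (Ne.symm hi)
        obtain ⟨y', hy'⟩ := Fin.exists_succAbove_eq (Ne.symm hiy)
        rw [hinj _ x' y' _ (by simp [hx', hy', h]), smul_zero]
        rintro rfl
        exact hxy (hx'.symm.trans hy')
  have hR : ∀ k : ℕ, k ≤ d + 1 → ∀ a : Fin (d + 1) → V,
      (∀ i : Fin (d + 1), d + 1 - k > (i : ℕ) → a i = u i) → U (leadC d a) = 0 := by
    intro k
    induction k with
    | zero =>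
      intro _ a ha
      obtain rfl : a = u := funext fun i => ha i (by omega)
      exact h0
    | succ k ih =>
      intro hk a ha
      by_cases hsurj : Function.Surjective (top ∘ a)
      · set K : Fin (d + 1) := ⟨d + 1 - (k + 1), by omega⟩ with hK
        obtain ⟨x, hx⟩ := hsurj K
        have hxK : K ≤ x := by
          by_contra hlt
          push Not at hlt
          have := ha x hlt
          rw [Function.comp_apply, this, hu] at hx
          exact hlt.ne hx
        have hy : K.castSucc.succAbove x = x.succ := Fin.succAbove_of_le_castSucc _ _ hxK
        have e1 : (K.castSucc.insertNth (α := fun _ => V) (u K) a) ∘ K.castSucc.succAbove = a := by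
          funext i
          simp
        rw [← e1]
        refine hswap _ _ (K.castSucc.succAbove x) (Fin.succAbove_ne _ _).symm ?_ ?_
        · simp only [Fin.insertNth_apply_same, Fin.insertNth_apply_succAbove, hu]
          exact hx.symm
        · refine ih (by omega) _ fun i hi => ?_
          have hiK : i ≤ K := by
            rw [Fin.le_def]
            simp only [hK]
            omega
          rw [Function.comp_apply, hy, Fin.succAbove_of_castSucc_lt]
          · rcases hiK.lt_or_eq with hlt | rfl
            · rw [← Fin.succAbove_of_castSucc_lt K.castSucc i (by simpa using hlt),
                Fin.insertNth_apply_succAbove]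
              exact ha i hlt
            · simp
          · simp only [Fin.lt_def, Fin.val_castSucc, Fin.val_succ]
            have : (i : ℕ) ≤ K := hiK
            have : (K : ℕ) ≤ x := hxK
            omega
      · simp only [Function.Surjective, not_forall, not_exists] at hsurj
        obtain ⟨j, hj⟩ := hsurj
        refine hmiss _ j fun t ht => ?_
        obtain ⟨i, hi⟩ := leadC_mem_range d a t
        exact hj i (by rw [← ht, ← hi]; rfl)
  refine eq_zero_of_leadC hcob hfew (fun a => hR (d + 1) le_rfl a fun i hi => ?_) c
  omega

end LCube

/-! ### Tiles of labelled lattices -/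

namespace LCube

variable {V : Type*} {A : Type*} [AddCommGroup A] {m : ℕ}

/-- The integer vector with entries `0`, `1` given by a vertex of the cube. -/
def bz (ε : Fin m → Bool) : Fin m → ℤ := fun i => if ε i then 1 else 0

theorem bz_nonneg (ε : Fin m → Bool) (i : Fin m) : 0 ≤ bz ε i := by
  unfold bz
  split_ifs <;> simp

theorem bz_le_one (ε : Fin m → Bool) (i : Fin m) : bz ε i ≤ 1 := by
  unfold bz
  split_ifs <;> simp

/-- The labelled unit cube with lowest corner `z`. -/
def tile (l : (Fin m → ℤ) → V) (z : Fin m → ℤ) : LCube V m := fun ε => l (z + bz ε)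

/-- The labelled prism over the unit cube with lowest corner `z`. -/
def prism (l₀ l₁ : (Fin m → ℤ) → V) (z : Fin m → ℤ) : LCube V (m + 1) :=
  fun ε => if ε 0 then l₁ (z + bz (Fin.tail ε)) else l₀ (z + bz (Fin.tail ε))

theorem finite_support_of_tile {B : Set (Fin m → ℤ)} (hB : B.Finite) {f : (Fin m → ℤ) → A}
    (h : ∀ z, (∀ ε : Fin m → Bool, z + bz ε ∉ B) → f z = 0) : f.support.Finite := by
  refine (Set.finite_iUnion fun ε : Fin m → Bool =>
    hB.preimage ((add_left_injective (bz ε)).injOn)).subset ?_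
  intro z hz
  by_contra hcon
  simp only [Set.mem_iUnion, Set.mem_preimage, not_exists] at hcon
  exact hz (h z hcon)

theorem face_zero_prism (l₀ l₁ : (Fin m → ℤ) → V) (z : Fin m → ℤ) (b : Bool) :
    face 0 b (prism l₀ l₁ z) = tile (if b then l₁ else l₀) z := by
  funext t
  cases b <;> simp [face, prism, tile]

theorem face_succ_true_prism {m : ℕ} (l₀ l₁ : (Fin (m + 1) → ℤ) → V) (z : Fin (m + 1) → ℤ)
    (i : Fin (m + 1)) :
    face i.succ true (prism l₀ l₁ z) = face i.succ false (prism l₀ l₁ (z + Pi.single i 1)) := by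
  funext t
  have h0 : ∀ b, (i.succ.insertNth (α := fun _ => Bool) b t) 0 = t 0 := by
    intro b
    have := Fin.insertNth_apply_succAbove (α := fun _ => Bool) i.succ b t 0
    rwa [Fin.succ_succAbove_zero] at this
  have h1 : z + bz (Fin.tail (i.succ.insertNth (α := fun _ => Bool) true t)) =
      z + Pi.single i 1 + bz (Fin.tail (i.succ.insertNth (α := fun _ => Bool) false t)) := by
    funext k
    by_cases hk : k = i
    · subst hk
      simp [bz, Fin.tail]
    · obtain ⟨k, rfl⟩ := Fin.exists_succAbove_eq hk
      have e : ∀ b, (i.succ.insertNth (α := fun _ => Bool) b t) (i.succAbove k).succ =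
          t k.succ := by
        intro b
        have := Fin.insertNth_apply_succAbove (α := fun _ => Bool) i.succ b t k.succ
        rwa [Fin.succ_succAbove_succ] at this
      simp [bz, Fin.tail, e]
  simp only [face, prism, h0, h1]

/-- The discrete Stokes formula on a lattice times an interval. -/
theorem finsum_tile_sub (U : LCube V m → A) (v₀ : V) (hU : U (fun _ => v₀) = 0)
    (l₀ l₁ : (Fin m → ℤ) → V) (hfin : {w | ¬ (l₀ w = v₀ ∧ l₁ w = v₀)}.Finite) :
    (∑ᶠ z, U (tile l₁ z)) - ∑ᶠ z, U (tile l₀ z) = ∑ᶠ z, cob U (prism l₀ l₁ z) := by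
  have hs : ∀ b : Bool, (fun z => U (tile (if b then l₁ else l₀) z)).support.Finite := by
    intro b
    refine finite_support_of_tile hfin fun z hz => ?_
    rw [← hU]
    congr 1
    funext ε
    have := hz ε
    simp only [Set.mem_ofPred_eq, not_not] at this
    cases b
    · exact this.1
    · exact this.2
  have hside : ∀ (i : Fin m) (b : Bool),
      (fun z => U (face i.succ b (prism l₀ l₁ z))).support.Finite := by
    intro i b
    refine finite_support_of_tile hfin fun z hz => ?_
    rw [← hU]
    congr 1
    funext ε
    have := hz (Fin.tail (i.succ.insertNth (α := fun _ => Bool) b ε))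
    simp only [Set.mem_ofPred_eq, not_not] at this
    simp [face, prism, this.1, this.2]
  have hcancel : ∀ i : Fin m, ∑ᶠ z, U (face i.succ true (prism l₀ l₁ z)) =
      ∑ᶠ z, U (face i.succ false (prism l₀ l₁ z)) := by
    intro i
    obtain ⟨m, rfl⟩ : ∃ k, m = k + 1 := ⟨m - 1, by have := i.pos; omega⟩
    simp only [face_succ_true_prism]
    exact finsum_comp_equiv (Equiv.addRight (Pi.single i (1 : ℤ)))
      (f := fun z => U (face i.succ false (prism l₀ l₁ z)))
  have e : ∀ z, cob U (prism l₀ l₁ z) = (U (tile l₁ z) - U (tile l₀ z)) +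
      ∑ i : Fin m, (-1 : ℤ) ^ (i.succ : ℕ) • (U (face i.succ true (prism l₀ l₁ z)) -
        U (face i.succ false (prism l₀ l₁ z))) := by
    intro z
    rw [cob, Fin.sum_univ_succ, face_zero_prism, face_zero_prism]
    simp
  have h3 : ∀ i : Fin m, (fun z => (-1 : ℤ) ^ (i.succ : ℕ) •
      (U (face i.succ true (prism l₀ l₁ z)) -
        U (face i.succ false (prism l₀ l₁ z)))).support.Finite := by
    intro i
    refine ((hside i true).union (hside i false)).subset ?_
    intro z hz
    by_contra hcon
    simp only [Set.mem_union, Function.mem_support, not_or, not_not] at hcon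
    exact hz (by simp [hcon.1, hcon.2])
  have ht := hs true
  have hf := hs false
  simp only [if_true, Bool.false_eq_true, if_false] at ht hf
  simp only [e]
  rw [finsum_add_distrib, finsum_sub_distrib ht hf, finsum_sum_comm _ _ (fun i _ => h3 i),
    Finset.sum_eq_zero, add_zero]
  · intro i _
    rw [← smul_finsum' _ ((((hside i true).union (hside i false)).subset
      (Function.support_sub _ _))), finsum_sub_distrib (hside i true) (hside i false), hcancel,
      sub_self, smul_zero]
  · exact (ht.union hf).subset (Function.support_sub _ _)
  · have : (fun z => ∑ i : Fin m, (-1 : ℤ) ^ (i.succ : ℕ) •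
        (U (face i.succ true (prism l₀ l₁ z)) - U (face i.succ false (prism l₀ l₁ z)))).support ⊆
        ⋃ i : Fin m, (fun z => (-1 : ℤ) ^ (i.succ : ℕ) •
      (U (face i.succ true (prism l₀ l₁ z)) - U (face i.succ false (prism l₀ l₁ z)))).support := by
      intro z hz
      by_contra hcon
      simp only [Set.mem_iUnion, Function.mem_support, not_exists, not_not] at hcon
      exact hz (Finset.sum_eq_zero fun i _ => hcon i)
    exact (Set.finite_iUnion h3).subset this

end LCube

/-! ### A generic point of the unit cube -/

open LCube

/-- The real vector with given integer coordinates. -/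
def toR {ι : Type*} (v : ι → ℤ) : ι → ℝ := fun i => (v i : ℝ)

/-- A point of the open unit cube that lies on no rational hyperplane and whose coordinates
decrease rapidly. -/
structure GenericPt {n : ℕ} (p : Fin n → ℝ) : Prop where
  indep : ∀ (q : Fin n → ℚ) (q₀ : ℚ), ∑ i, (q i : ℝ) * p i + (q₀ : ℝ) = 0 → q = 0
  pos : ∀ i, 0 < p i
  flag : ∀ j, ∑ l ∈ Finset.univ.filter (fun l => j < l), p l < p j
  sum_lt : ∑ l, p l < 1

theorem sum_pow_le {τ : ℝ} (h0 : 0 < τ) (h1 : τ ≤ 1 / 2) {a N : ℕ} (h : a ≤ N) :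
    ∑ k ∈ Finset.Ico a N, τ ^ (k + 1) ≤ τ ^ a - τ ^ N := by
  induction N, h using Nat.le_induction with
  | base => simp
  | succ N hN ih =>
    rw [Finset.sum_Ico_succ_top hN, pow_succ]
    have : 0 < τ ^ N := pow_pos h0 N
    nlinarith

theorem exists_genericPt (n : ℕ) : ∃ p : Fin n → ℝ, GenericPt p := by
  obtain ⟨τ, hτ, h0, h1⟩ : ∃ τ : ℝ, Transcendental ℚ τ ∧ 0 < τ ∧ τ < 1 / 2 := by
    have hc : {x : ℝ | IsAlgebraic ℚ x}.Countable := Algebraic.countable ℚ ℝ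
    obtain ⟨τ, h, h'⟩ := (hc.dense_compl ℝ).exists_mem_open (isOpen_Ioo (a := (0 : ℝ)) (b := 1 / 2))
      ⟨1 / 4, by norm_num, by norm_num⟩
    exact ⟨τ, h, h'.1, h'.2⟩
  refine ⟨fun i => τ ^ ((i : ℕ) + 1), ⟨?_, fun i => pow_pos h0 _, ?_, ?_⟩⟩
  · intro q q₀ h
    set P : Polynomial ℚ := ∑ i : Fin n, Polynomial.C (q i) * Polynomial.X ^ ((i : ℕ) + 1) +
      Polynomial.C q₀ with hP
    have hz : P = 0 := by
      by_contra hne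
      refine hτ ⟨P, hne, ?_⟩
      simp only [hP, map_add, map_sum, map_mul, Polynomial.aeval_C, map_pow, Polynomial.aeval_X]
      exact h
    funext i
    have := congrArg (fun Q => Polynomial.coeff Q ((i : ℕ) + 1)) hz
    simp only [hP, Polynomial.coeff_add, Polynomial.finsetSum_coeff, Polynomial.coeff_C_mul,
      Polynomial.coeff_X_pow, Polynomial.coeff_C_succ, add_left_inj, Polynomial.coeff_zero,
      add_zero] at this
    rw [Finset.sum_eq_single i] at this
    · simpa using this
    · intro b _ hb
      simp only [mul_ite, mul_one, mul_zero, ite_eq_right_iff]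
      intro h
      exact absurd (Fin.ext h.symm) hb
    · simp
  · intro j
    have hle := sum_pow_le h0 h1.le (a := (j : ℕ) + 1) (N := n) j.isLt
    have : ∑ l ∈ Finset.univ.filter (fun l => j < l), τ ^ ((l : ℕ) + 1) =
        ∑ k ∈ Finset.Ico ((j : ℕ) + 1) n, τ ^ (k + 1) := by
      refine Finset.sum_bij (fun l _ => (l : ℕ)) ?_ ?_ ?_ ?_
      · intro l hl
        simp only [Finset.mem_filter, Finset.mem_univ, true_and, Fin.lt_def] at hl
        simp only [Finset.mem_Ico]
        omega
      · intro a _ b _ h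
        exact Fin.ext h
      · intro b hb
        simp only [Finset.mem_Ico] at hb
        exact ⟨⟨b, hb.2⟩, by
          simp only [Finset.mem_filter, Finset.mem_univ, true_and, Fin.lt_def]
          omega, rfl⟩
      · intro _ _
        rfl
    rw [this]
    have : 0 < τ ^ n := pow_pos h0 n
    linarith
  · have hle := sum_pow_le h0 h1.le (a := 0) (N := n) (Nat.zero_le _)
    rw [Fin.sum_univ_eq_sum_range (fun k => τ ^ (k + 1)), Finset.range_eq_Ico]
    have : 0 < τ ^ n := pow_pos h0 n
    simp only [pow_zero] at hle
    linarith

/-- The convex hull of `S` contains no integer translate of `p`. -/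
def Avoids {n : ℕ} (p : Fin n → ℝ) (S : Set (Fin n → ℤ)) : Prop :=
  ∀ z : Fin n → ℤ, p + toR z ∉ convexHull ℝ (toR '' S)

namespace GenericPt

variable {n : ℕ} {p : Fin n → ℝ}

theorem lt_one (hp : GenericPt p) (i : Fin n) : p i < 1 :=
  (Finset.single_le_sum (fun j _ => (hp.pos j).le) (Finset.mem_univ i)).trans_lt hp.sum_lt

theorem strictAnti (hp : GenericPt p) : StrictAnti p := by
  intro i j h
  refine lt_of_le_of_lt ?_ (hp.flag i)
  exact Finset.single_le_sum (f := p) (fun j _ => (hp.pos j).le) (by simpa using h)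

theorem avoids_mono {S T : Set (Fin n → ℤ)} (h : S ⊆ T) (hT : Avoids p T) : Avoids p S :=
  fun z hz => hT z (convexHull_mono (Set.image_mono h) hz)

theorem avoids_of_ncard_le (hp : GenericPt p) {S : Set (Fin n → ℤ)} (hfin : S.Finite)
    (hS : S.ncard ≤ n) : Avoids p S := by
  intro z hz
  have hne : S.Nonempty := by
    have := convexHull_nonempty_iff.mp ⟨_, hz⟩
    simpa using this
  obtain ⟨s₀, hs₀⟩ := hne
  have := hfin.fintype
  let L : ((Fin n → ℚ) × ℚ) →ₗ[ℚ] (S → ℚ) :=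
    { toFun := fun q s => ∑ i, q.1 i * (s.1 i : ℚ) + q.2
      map_add' := by
        intro a b
        funext s
        simp only [Prod.fst_add, Prod.snd_add, Pi.add_apply, add_mul, Finset.sum_add_distrib]
        ring
      map_smul' := by
        intro r a
        funext s
        simp only [Prod.smul_fst, Prod.smul_snd, Pi.smul_apply, smul_eq_mul, mul_assoc,
          Finset.mul_sum, RingHom.id_apply, mul_add] }
  have hker : L.ker ≠ ⊥ := by
    apply LinearMap.ker_ne_bot_of_finrank_lt
    rw [← Nat.card_coe_set_eq, Nat.card_eq_fintype_card] at hS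
    simp only [Module.finrank_fintype_fun_eq_card, Module.finrank_prod, Fintype.card_fin,
      Module.finrank_self]
    exact Nat.lt_succ_of_le hS
  obtain ⟨⟨q, q₀⟩, hq, hq0⟩ := (Submodule.ne_bot_iff _).mp hker
  have hL : ∀ s ∈ S, ∑ i, q i * (s i : ℚ) + q₀ = 0 := by
    intro s hs
    exact congrFun (LinearMap.mem_ker.mp hq) ⟨s, hs⟩
  have hconv : convexHull ℝ (toR '' S) ⊆ {x : Fin n → ℝ | ∑ i, (q i : ℝ) * x i = -(q₀ : ℝ)} := by
    apply convexHull_min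
    · rintro _ ⟨s, hs, rfl⟩
      have := hL s hs
      have h2 : ((∑ i, q i * (s i : ℚ) + q₀ : ℚ) : ℝ) = 0 := by rw [this]; simp
      push_cast at h2
      simp only [Set.mem_ofPred_eq, toR]
      linarith
    · refine convex_hyperplane (f := fun x : Fin n → ℝ => ∑ i, (q i : ℝ) * x i) ⟨?_, ?_⟩ _
      · intro x y
        simp [mul_add, Finset.sum_add_distrib]
      · intro r x
        simp only [Pi.smul_apply, smul_eq_mul, Finset.mul_sum]
        exact Finset.sum_congr rfl fun i _ => by ring
  have hpz := hconv hz
  simp only [Set.mem_ofPred_eq, Pi.add_apply, toR, mul_add, Finset.sum_add_distrib] at hpz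
  have hq' := hp.indep q (∑ i, q i * (z i : ℚ) + q₀) (by push_cast; linarith)
  subst hq'
  have := hL s₀ hs₀
  simp only [Pi.zero_apply, zero_mul, Finset.sum_const_zero, zero_add] at this
  exact hq0 (by rw [this]; rfl)

/-- The number of the last `true` coordinate, plus one. -/
noncomputable def _root_.LCube.top (ε : Fin n → Bool) : Fin (n + 1) :=
  Finset.univ.sup (fun i => if ε i then i.succ else 0)

theorem exists_of_top_ne_zero {ε : Fin n → Bool} (h : LCube.top ε ≠ 0) : ∃ i, ε i = true := by
  by_contra hcon
  push Not at hcon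
  refine h ?_
  unfold LCube.top
  exact (Finset.sup_eq_bot_iff _ _).mpr fun i _ => by
    simp only [hcon i, Bool.false_eq_true, if_false]
    rfl

theorem exists_of_top_ne_succ {ε : Fin n → Bool} {i : Fin n} (h : LCube.top ε ≠ i.succ)
    (hi : ε i = true) : ∃ l, i < l ∧ ε l = true := by
  have h1 : i.succ ≤ LCube.top ε := by
    unfold LCube.top
    refine le_trans ?_ (Finset.le_sup (Finset.mem_univ i))
    simp [hi]
  have h2 := lt_of_le_of_ne h1 h.symm
  unfold LCube.top at h2
  rw [Finset.lt_sup_iff] at h2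
  obtain ⟨l, -, hl⟩ := h2
  split_ifs at hl with h3
  · exact ⟨l, by simpa using hl, h3⟩
  · simp at hl

/-- The vertex whose first `j` coordinates are `true`. -/
def _root_.LCube.stair (j : Fin (n + 1)) : Fin n → Bool := fun i => decide (i.castSucc < j)

theorem top_stair (j : Fin (n + 1)) : LCube.top (LCube.stair j) = j := by
  unfold LCube.top
  apply le_antisymm
  · apply Finset.sup_le
    intro i _
    simp only [LCube.stair, decide_eq_true_eq]
    split_ifs with h
    · exact Fin.castSucc_lt_iff_succ_le.mp h
    · exact Fin.zero_le _
  · refine Fin.cases (Fin.zero_le _) (fun i => ?_) j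
    refine le_trans ?_ (Finset.le_sup (Finset.mem_univ i))
    simp [LCube.stair]

theorem avoids_of_missing (hp : GenericPt p) (z₀ : Fin n → ℤ) {T : Set (Fin n → Bool)}
    {j : Fin (n + 1)} (hj : ∀ ε ∈ T, LCube.top ε ≠ j) :
    Avoids p ((fun ε => z₀ + bz ε) '' T) := by
  intro z hz
  have hbox : convexHull ℝ (toR '' ((fun ε => z₀ + bz ε) '' T)) ⊆
      Set.Icc (toR z₀) (toR z₀ + 1) := by
    apply convexHull_min _ (convex_Icc _ _)
    rintro _ ⟨_, ⟨ε, -, rfl⟩, rfl⟩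
    constructor <;> intro i <;> simp only [toR, Pi.add_apply, Int.cast_add, Pi.one_apply]
    · have : (0 : ℝ) ≤ (bz ε i : ℝ) := by exact_mod_cast bz_nonneg ε i
      linarith
    · have : (bz ε i : ℝ) ≤ 1 := by exact_mod_cast bz_le_one ε i
      linarith
  have hzz : z = z₀ := by
    funext i
    have h1 := (hbox hz).1 i
    have h2 := (hbox hz).2 i
    simp only [Pi.add_apply, toR, Pi.one_apply] at h1 h2
    have h3 := hp.pos i
    have h4 := hp.lt_one i
    have h5 : (z₀ i : ℝ) < z i + 1 := by linarith
    have h6 : (z i : ℝ) < z₀ i + 1 := by linarith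
    have h5' : z₀ i < z i + 1 := by exact_mod_cast h5
    have h6' : z i < z₀ i + 1 := by exact_mod_cast h6
    omega
  subst hzz
  revert hj
  refine Fin.cases (fun hj => ?_) (fun k hj => ?_) j
  · have hconv : convexHull ℝ (toR '' ((fun ε => z + bz ε) '' T)) ⊆
        {x : Fin n → ℝ | ∑ i, (z i : ℝ) + 1 ≤ ∑ i, x i} := by
      apply convexHull_min
      · rintro _ ⟨_, ⟨ε, hε, rfl⟩, rfl⟩
        obtain ⟨i, hi⟩ := exists_of_top_ne_zero (hj ε hε)
        simp only [Set.mem_ofPred_eq, toR, Pi.add_apply, Int.cast_add, Finset.sum_add_distrib]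
        have : (1 : ℝ) = (bz ε i : ℝ) := by simp [bz, hi]
        rw [this]
        gcongr
        exact Finset.single_le_sum (f := fun i => (bz ε i : ℝ))
          (fun j _ => by exact_mod_cast bz_nonneg ε j) (Finset.mem_univ i)
      · refine convex_halfSpace_ge (f := fun x : Fin n → ℝ => ∑ i, x i) ⟨?_, ?_⟩ _
        · intro x y
          simp [Finset.sum_add_distrib]
        · intro r x
          simp [Finset.mul_sum]
    have := hconv hz
    simp only [Set.mem_ofPred_eq, toR, Pi.add_apply, Finset.sum_add_distrib] at this
    have := hp.sum_lt
    linarith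
  · have hconv : convexHull ℝ (toR '' ((fun ε => z + bz ε) '' T)) ⊆
        {x : Fin n → ℝ | ∑ l ∈ Finset.univ.filter (fun l => k < l), (z l : ℝ) - z k ≤
          ∑ l ∈ Finset.univ.filter (fun l => k < l), x l - x k} := by
      apply convexHull_min
      · rintro _ ⟨_, ⟨ε, hε, rfl⟩, rfl⟩
        simp only [Set.mem_ofPred_eq, toR, Pi.add_apply, Int.cast_add, Finset.sum_add_distrib]
        suffices (bz ε k : ℝ) ≤ ∑ l ∈ Finset.univ.filter (fun l => k < l), (bz ε l : ℝ) by linarith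
        have hnn : ∀ l ∈ Finset.univ.filter (fun l => k < l), (0 : ℝ) ≤ (bz ε l : ℝ) :=
          fun l _ => by exact_mod_cast bz_nonneg ε l
        by_cases hk : ε k = true
        · obtain ⟨l, hl, hl'⟩ := exists_of_top_ne_succ (hj ε hε) hk
          have : (bz ε k : ℝ) = (bz ε l : ℝ) := by simp [bz, hk, hl']
          rw [this]
          exact Finset.single_le_sum hnn (by simpa using hl)
        · have : (bz ε k : ℝ) = 0 := by simp [bz, hk]
          rw [this]
          exact Finset.sum_nonneg hnn
      · refine convex_halfSpace_ge (f := fun x : Fin n → ℝ =>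
          ∑ l ∈ Finset.univ.filter (fun l => k < l), x l - x k) ⟨?_, ?_⟩ _
        · intro x y
          simp only [Pi.add_apply, Finset.sum_add_distrib]
          ring
        · intro r x
          simp [Finset.mul_sum, mul_sub]
    have := hconv hz
    simp only [Set.mem_ofPred_eq, toR, Pi.add_apply, Finset.sum_add_distrib] at this
    have := hp.flag k
    linarith

end GenericPt

/-! ### Kuhn interpolation of lattice labellings -/

open LCube MeasureTheory

section Kuhn

variable {d n : ℕ}

/-- The piecewise affine extension of a labelling of the lattice `ℤᵈ` which is affine on the
simplices of the Kuhn triangulation. -/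
noncomputable def kuhn (l : (Fin d → ℤ) → (Fin n → ℤ)) (y : Fin d → ℝ) : Fin n → ℝ :=
  ∫ θ in Set.Ioo (0 : ℝ) 1, toR (l fun i => ⌈y i - θ⌉)

/-- The vertex of the unit cube selected by the threshold `θ`. -/
noncomputable def thr (y : Fin d → ℝ) (θ : ℝ) : Fin d → Bool := fun i =>
  decide (θ < Int.fract (y i))

/-- The chain of vertices carrying a point. -/
def carrier (y : Fin d → ℝ) : Set (Fin d → Bool) := thr y '' Set.Ioo 0 1

/-- The lower corner of the unit cube containing a point. -/
noncomputable def flr (y : Fin d → ℝ) : Fin d → ℤ := fun i => ⌊y i⌋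

theorem ceil_sub_eq {y θ : ℝ} (hθ : θ ∈ Set.Ioo (0 : ℝ) 1) :
    ⌈y - θ⌉ = ⌊y⌋ + (if decide (θ < Int.fract y) = true then 1 else 0) := by
  have h := Int.self_sub_floor y
  have h0 := Int.fract_nonneg y
  have h1 := Int.fract_lt_one y
  obtain ⟨hθ0, hθ1⟩ := hθ
  rw [Int.ceil_eq_iff]
  simp only [decide_eq_true_eq]
  split_ifs with h2
  · push_cast
    constructor <;> linarith
  · push_cast
    constructor <;> linarith

theorem ceil_sub_eq_flr {y : Fin d → ℝ} {θ : ℝ} (hθ : θ ∈ Set.Ioo (0 : ℝ) 1) :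
    (fun i => ⌈y i - θ⌉) = flr y + bz (thr y θ) := by
  funext i
  exact ceil_sub_eq hθ

theorem isChain_carrier (y : Fin d → ℝ) : IsChain (· ≤ ·) (carrier y) := by
  have key : ∀ a b : ℝ, a ≤ b → thr y b ≤ thr y a := by
    intro a b hab i
    simp only [thr]
    rw [Bool.le_iff_imp]
    simp only [decide_eq_true_eq]
    exact fun h => hab.trans_lt h
  rintro _ ⟨a, -, rfl⟩ _ ⟨b, -, rfl⟩ _
  rcases le_total a b with h | h
  · exact Or.inr (key a b h)
  · exact Or.inl (key b a h)

instance isProbabilityMeasure_Ioo :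
    IsProbabilityMeasure (volume.restrict (Set.Ioo (0 : ℝ) 1)) :=
  ⟨by simp⟩

theorem measurable_kuhn_integrand (l : (Fin d → ℤ) → (Fin n → ℤ)) (y : Fin d → ℝ) :
    Measurable fun θ : ℝ => toR (l fun i => ⌈y i - θ⌉) := by
  have h1 : Measurable fun θ : ℝ => fun i => ⌈y i - θ⌉ :=
    measurable_pi_lambda _ fun i => Int.measurable_ceil.comp (measurable_const.sub measurable_id)
  have h2 : Measurable fun w : Fin d → ℤ => toR (l w) := measurable_of_countable _
  exact h2.comp h1

theorem exists_bound_box (l : (Fin d → ℤ) → (Fin n → ℤ)) (a b : Fin d → ℤ) :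
    ∃ C : ℝ, ∀ w ∈ Set.Icc a b, ‖toR (l w)‖ ≤ C := by
  have hf : ((fun w => ‖toR (l w)‖) '' Set.Icc a b).Finite := (Set.finite_Icc a b).image _
  obtain ⟨C, hC⟩ := hf.bddAbove
  exact ⟨C, fun w hw => hC ⟨w, hw, rfl⟩⟩

theorem integrable_kuhn (l : (Fin d → ℤ) → (Fin n → ℤ)) (y : Fin d → ℝ) :
    Integrable (fun θ : ℝ => toR (l fun i => ⌈y i - θ⌉)) (volume.restrict (Set.Ioo (0 : ℝ) 1)) := by
  obtain ⟨C, hC⟩ := exists_bound_box l (flr y) (flr y + 1)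
  refine Integrable.of_bound (measurable_kuhn_integrand l y).aestronglyMeasurable C ?_
  rw [ae_restrict_iff' measurableSet_Ioo]
  refine Filter.Eventually.of_forall fun θ hθ => hC _ ?_
  rw [ceil_sub_eq_flr hθ]
  constructor
  · intro i
    have := bz_nonneg (thr y θ) i
    simp only [Pi.add_apply]
    omega
  · intro i
    have := bz_le_one (thr y θ) i
    simp only [Pi.add_apply, Pi.one_apply]
    omega

theorem kuhn_congr {e : ℕ} {l : (Fin d → ℤ) → (Fin n → ℤ)} {l' : (Fin e → ℤ) → (Fin n → ℤ)}
    {y : Fin d → ℝ} {y' : Fin e → ℝ}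
    (h : ∀ θ ∈ Set.Ioo (0 : ℝ) 1, l (flr y + bz (thr y θ)) = l' (flr y' + bz (thr y' θ))) :
    kuhn l y = kuhn l' y' := by
  refine setIntegral_congr_fun measurableSet_Ioo fun θ hθ => ?_
  simp only [ceil_sub_eq_flr hθ, h θ hθ]

theorem kuhn_congr_label {l l' : (Fin d → ℤ) → (Fin n → ℤ)} {y : Fin d → ℝ}
    (h : ∀ ε ∈ carrier y, l (flr y + bz ε) = l' (flr y + bz ε)) : kuhn l y = kuhn l' y :=
  kuhn_congr fun θ hθ => h _ ⟨θ, hθ, rfl⟩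

theorem kuhn_const (v : Fin n → ℤ) (y : Fin d → ℝ) : kuhn (fun _ => v) y = toR v := by
  simp [kuhn]

theorem kuhn_eq_const {l : (Fin d → ℤ) → (Fin n → ℤ)} {y : Fin d → ℝ} {v : Fin n → ℤ}
    (h : ∀ ε ∈ carrier y, l (flr y + bz ε) = v) : kuhn l y = toR v := by
  rw [← kuhn_const v y]
  exact kuhn_congr_label h

theorem kuhn_mem (l : (Fin d → ℤ) → (Fin n → ℤ)) (y : Fin d → ℝ) :
    kuhn l y ∈ convexHull ℝ (toR '' ((fun ε => l (flr y + bz ε)) '' carrier y)) := by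
  refine Convex.integral_mem (convex_convexHull ℝ _)
    (Set.Finite.isClosed_convexHull _ (Set.toFinite _)) ?_ (integrable_kuhn l y)
  rw [ae_restrict_iff' measurableSet_Ioo]
  refine Filter.Eventually.of_forall fun θ hθ => subset_convexHull ℝ _ ?_
  rw [ceil_sub_eq_flr hθ]
  exact ⟨_, ⟨_, ⟨θ, hθ, rfl⟩, rfl⟩, rfl⟩

theorem continuous_kuhn (l : (Fin d → ℤ) → (Fin n → ℤ)) : Continuous (kuhn l) := by
  rw [continuous_iff_continuousAt]
  intro y₀
  obtain ⟨C, hC⟩ := exists_bound_box l (flr y₀ - 3) (flr y₀ + 3)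
  refine continuousAt_of_dominated (bound := fun _ => C)
    (Filter.Eventually.of_forall fun y => (measurable_kuhn_integrand l y).aestronglyMeasurable)
    ?_ (integrable_const _) ?_
  · filter_upwards [Metric.ball_mem_nhds y₀ one_pos] with y hy
    rw [ae_restrict_iff' measurableSet_Ioo]
    refine Filter.Eventually.of_forall fun θ hθ => hC _ ?_
    have hyi : ∀ i, |y i - y₀ i| < 1 := fun i =>
      lt_of_le_of_lt (by rw [← Real.dist_eq]; exact dist_le_pi_dist y y₀ i) hy
    constructor
    · intro i
      have h1 := abs_lt.mp (hyi i)
      have h2 := Int.floor_le (y₀ i)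
      have h3 := Int.lt_floor_add_one (y₀ i)
      have h4 := hθ.1
      have h5 := hθ.2
      have h6 := Int.le_ceil (y i - θ)
      simp only [Pi.sub_apply, flr, Pi.ofNat_apply]
      have : ((⌊y₀ i⌋ - 3 : ℤ) : ℝ) < ⌈y i - θ⌉ := by
        push_cast
        linarith
      exact_mod_cast this.le
    · intro i
      have h1 := abs_lt.mp (hyi i)
      have h2 := Int.floor_le (y₀ i)
      have h3 := Int.lt_floor_add_one (y₀ i)
      have h4 := hθ.1
      have h5 := hθ.2
      have h6 := Int.ceil_lt_add_one (y i - θ)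
      simp only [Pi.add_apply, flr, Pi.ofNat_apply]
      have : (⌈y i - θ⌉ : ℝ) < (⌊y₀ i⌋ + 3 : ℤ) := by
        push_cast
        linarith
      exact_mod_cast this.le
  · have hcount : (⋃ (i : Fin d) (k : ℤ), {y₀ i - (k : ℝ)}).Countable :=
      Set.countable_iUnion fun i => Set.countable_iUnion fun k => Set.countable_singleton _
    have hae := (hcount.ae_notMem (volume.restrict (Set.Ioo (0 : ℝ) 1)))
    filter_upwards [hae] with θ hθ
    simp only [Set.mem_iUnion, Set.mem_singleton_iff, not_exists] at hθ
    have hev : ∀ᶠ y in nhds y₀, (fun i => ⌈y i - θ⌉) = fun i => ⌈y₀ i - θ⌉ := by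
      have : ∀ i, ∀ᶠ y : Fin d → ℝ in nhds y₀, ⌈y i - θ⌉ = ⌈y₀ i - θ⌉ := by
        intro i
        have hcont : ContinuousAt (fun y : Fin d → ℝ => y i - θ) y₀ :=
          ((continuous_apply i).sub continuous_const).continuousAt
        have h1 := Int.le_ceil (y₀ i - θ)
        have h2 := Int.ceil_lt_add_one (y₀ i - θ)
        have h3 : y₀ i - θ ≠ ⌈y₀ i - θ⌉ := fun h => hθ i ⌈y₀ i - θ⌉ (by linarith)
        have h4 := lt_of_le_of_ne h1 h3
        filter_upwards [hcont.eventually (Ioo_mem_nhds (a := (⌈y₀ i - θ⌉ : ℝ) - 1)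
          (by linarith) h4)] with y hy
        rw [Int.ceil_eq_iff]
        exact ⟨hy.1, hy.2.le⟩
      filter_upwards [Filter.eventually_all.mpr this] with y hy
      exact funext hy
    refine (continuousAt_const (y := toR (l fun i => ⌈y₀ i - θ⌉))).congr ?_
    filter_upwards [hev] with y hy
    rw [hy]

theorem kuhn_add_int (l : (Fin d → ℤ) → (Fin n → ℤ)) (y : Fin d → ℝ) (z : Fin d → ℤ) :
    kuhn l (y + toR z) = kuhn (fun w => l (w + z)) y := by
  unfold kuhn
  congr 1
  funext θ
  congr 2
  funext i
  simp only [Pi.add_apply, toR]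
  rw [← Int.ceil_add_intCast]
  congr 1
  ring

theorem kuhn_cons (L : (Fin (d + 1) → ℤ) → (Fin n → ℤ)) (s : ℤ) (y : Fin d → ℝ) :
    kuhn L (Fin.cons (s : ℝ) y) = kuhn (fun w => L (Fin.cons s w)) y := by
  refine setIntegral_congr_fun measurableSet_Ioo fun θ hθ => ?_
  dsimp only
  congr 2
  funext i
  refine Fin.cases ?_ (fun i => ?_) i
  · simp only [Fin.cons_zero]
    rw [ceil_sub_eq hθ]
    simp [hθ.1.le]
  · simp

/-- The piecewise affine extension of a function on the integers. -/
noncomputable def pwl (q : ℤ → ℤ) (y : ℝ) : ℝ := q ⌊y⌋ + (q (⌊y⌋ + 1) - q ⌊y⌋) * Int.fract y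

theorem kuhn_comp (l : (Fin d → ℤ) → (Fin n → ℤ)) (q : ℤ → ℤ)
    (hq : ∀ k, q (k + 1) = q k ∨ q (k + 1) = q k + 1) (y : Fin d → ℝ) :
    kuhn (fun w => l (fun i => q (w i))) y = kuhn l (fun i => pwl q (y i)) := by
  refine setIntegral_congr_fun measurableSet_Ioo fun θ hθ => ?_
  dsimp only
  congr 2
  funext i
  rw [ceil_sub_eq hθ]
  rcases hq ⌊y i⌋ with h | h
  · have e : pwl q (y i) = q ⌊y i⌋ := by simp [pwl, h]
    rw [e, ceil_sub_eq hθ]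
    have : ¬ θ < 0 := not_lt.mpr hθ.1.le
    simp only [Int.floor_intCast, Int.fract_intCast, this, decide_false, Bool.false_eq_true,
      if_false, add_zero]
    split_ifs
    · exact h
    · simp
  · have e : pwl q (y i) = q ⌊y i⌋ + Int.fract (y i) := by simp [pwl, h]
    rw [e, ceil_sub_eq hθ]
    have e2 : ⌊(q ⌊y i⌋ : ℝ) + Int.fract (y i)⌋ = q ⌊y i⌋ := by simp
    have e3 : Int.fract ((q ⌊y i⌋ : ℝ) + Int.fract (y i)) = Int.fract (y i) := by simp
    rw [e2, e3]
    split_ifs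
    · exact h
    · simp

/-- The labels of every carrier of a labelling of `ℤᵐ` avoid the translates of a generic point
of `ℝᵐ⁺¹`. -/
theorem GenericPt.kuhn_avoids {m : ℕ} {p : Fin (m + 1) → ℝ} (hp : GenericPt p)
    (l : (Fin m → ℤ) → (Fin (m + 1) → ℤ)) (y : Fin m → ℝ) (z : Fin (m + 1) → ℤ) :
    kuhn l y ≠ p + toR z := by
  intro h
  have := kuhn_mem l y
  rw [h] at this
  refine hp.avoids_of_ncard_le (Set.toFinite _) ?_ z this
  exact ncard_image_chain_le (isChain_carrier y) _

end Kuhn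

/-! ### Homotopy classes of loops given by maps on Euclidean space -/

section Cls

open Topology.Homotopy

variable {k n : ℕ} {S : Set (Fin n → ℝ)}

/-- The homotopy group in degree `k + 2` of a subset of `ℝⁿ` containing the origin,
written additively. -/
abbrev PiGrp (k : ℕ) {n : ℕ} {S : Set (Fin n → ℝ)} (h₀ : (0 : Fin n → ℝ) ∈ S) : Type :=
  Additive (HomotopyGroup (Fin (k + 2)) S (⟨0, h₀⟩ : S))

/-- The boundary of the unit cube in `ℝᵐ`. -/
def OnBdry {m : ℕ} (t : Fin m → ℝ) : Prop := ∃ i, t i = 0 ∨ t i = 1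

/-- A continuous map on `ℝᵐ` restricting to a loop on the unit cube. -/
structure IsLoop {m : ℕ} (S : Set (Fin n → ℝ)) (φ : (Fin m → ℝ) → (Fin n → ℝ)) : Prop where
  cont : Continuous φ
  mem : ∀ t ∈ Set.Icc (0 : Fin m → ℝ) 1, φ t ∈ S
  bdry : ∀ t ∈ Set.Icc (0 : Fin m → ℝ) 1, OnBdry t → φ t = 0

/-- The coordinates of a point of the cube. -/
def cubeVal {m : ℕ} (t : Fin m → unitInterval) : Fin m → ℝ := fun i => (t i : ℝ)

theorem cubeVal_mem {m : ℕ} (t : Fin m → unitInterval) : cubeVal t ∈ Set.Icc (0 : Fin m → ℝ) 1 :=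
  ⟨fun i => (t i).2.1, fun i => (t i).2.2⟩

theorem continuous_cubeVal {m : ℕ} : Continuous (cubeVal (m := m)) := by
  unfold cubeVal
  fun_prop

theorem onBdry_cubeVal {m : ℕ} {t : Fin m → unitInterval} (ht : t ∈ Cube.boundary (Fin m)) :
    OnBdry (cubeVal t) := by
  obtain ⟨i, hi⟩ := ht
  refine ⟨i, hi.imp (fun h => ?_) (fun h => ?_)⟩ <;> simp [cubeVal, h]

/-- The loop on the unit cube given by a map on `ℝᵐ`. -/
def IsLoop.toGen {m : ℕ} (h₀ : (0 : Fin n → ℝ) ∈ S) {φ : (Fin m → ℝ) → (Fin n → ℝ)}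
    (h : IsLoop S φ) : GenLoop (Fin m) S (⟨0, h₀⟩ : S) :=
  ⟨⟨fun t => ⟨φ (cubeVal t), h.mem _ (cubeVal_mem t)⟩,
    (h.cont.comp continuous_cubeVal).subtype_mk _⟩,
    fun t ht => Subtype.ext (h.bdry _ (cubeVal_mem t) (onBdry_cubeVal ht))⟩

/-- The homotopy class of a loop. -/
def genCls {h₀ : (0 : Fin n → ℝ) ∈ S} (f : GenLoop (Fin (k + 2)) S (⟨0, h₀⟩ : S)) : PiGrp k h₀ :=
  Additive.ofMul (α := HomotopyGroup (Fin (k + 2)) S (⟨0, h₀⟩ : S)) (Quotient.mk _ f)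

theorem genCls_transAt {h₀ : (0 : Fin n → ℝ) ∈ S} (i : Fin (k + 2))
    (f g : GenLoop (Fin (k + 2)) S (⟨0, h₀⟩ : S)) :
    genCls (GenLoop.transAt i f g) = genCls f + genCls g := by
  refine Eq.trans ?_ (add_comm (genCls g) (genCls f))
  exact congrArg Additive.ofMul (HomotopyGroup.mul_spec (i := i) (p := g) (q := f)).symm

theorem exists_genCls_eq {h₀ : (0 : Fin n → ℝ) ∈ S} (x : PiGrp k h₀) : ∃ f, genCls f = x := by
  obtain ⟨f, hf⟩ := Quotient.exists_rep (Additive.toMul x)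
  exact ⟨f, congrArg Additive.ofMul hf⟩

theorem genCls_eq_iff {h₀ : (0 : Fin n → ℝ) ∈ S}
    {f g : GenLoop (Fin (k + 2)) S (⟨0, h₀⟩ : S)} :
    genCls f = genCls g ↔ GenLoop.Homotopic f g :=
  ⟨fun h => Quotient.exact (congrArg Additive.toMul h),
    fun h => congrArg Additive.ofMul (Quotient.sound h)⟩

open Classical in
/-- The homotopy class of a map on `ℝᵐ`, or zero if the map is not a loop. -/
noncomputable def cls (h₀ : (0 : Fin n → ℝ) ∈ S) (φ : (Fin (k + 2) → ℝ) → (Fin n → ℝ)) :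
    PiGrp k h₀ :=
  if h : IsLoop S φ then genCls (h.toGen h₀) else 0

theorem cls_of_isLoop (h₀ : (0 : Fin n → ℝ) ∈ S) {φ : (Fin (k + 2) → ℝ) → (Fin n → ℝ)}
    (h : IsLoop S φ) : cls h₀ φ = genCls (h.toGen h₀) :=
  dif_pos h

theorem exists_cls_eq (h₀ : (0 : Fin n → ℝ) ∈ S) (x : PiGrp k h₀) :
    ∃ φ, IsLoop S φ ∧ cls h₀ φ = x := by
  obtain ⟨f, rfl⟩ := exists_genCls_eq x
  have hc : Continuous fun t : Fin (k + 2) → ℝ =>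
      ((f fun i => Set.projIcc 0 1 zero_le_one (t i) : S) : Fin n → ℝ) :=
    continuous_subtype_val.comp ((map_continuous f).comp
      (continuous_pi fun i => continuous_projIcc.comp (continuous_apply i)))
  have h : IsLoop S fun t : Fin (k + 2) → ℝ =>
      ((f fun i => Set.projIcc 0 1 zero_le_one (t i) : S) : Fin n → ℝ) := by
    refine ⟨hc, fun t _ => Subtype.coe_prop _, ?_⟩
    rintro t - ⟨i, hi⟩
    rw [GenLoop.boundary f]
    refine ⟨i, hi.imp (fun h => ?_) (fun h => ?_)⟩
    · change Set.projIcc 0 1 zero_le_one (t i) = 0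
      rw [h]
      exact Set.projIcc_left _
    · change Set.projIcc 0 1 zero_le_one (t i) = 1
      rw [h]
      exact Set.projIcc_right _
  refine ⟨_, h, ?_⟩
  rw [cls_of_isLoop h₀ h]
  have : h.toGen h₀ = f := by
    ext t : 1
    refine Subtype.ext ?_
    change ((f fun i => Set.projIcc 0 1 zero_le_one (cubeVal t i) : S) : Fin n → ℝ) = _
    congr 2
    funext i
    exact Set.projIcc_val zero_le_one (t i)
  rw [this]

theorem cls_homotopy (h₀ : (0 : Fin n → ℝ) ∈ S) {φ ψ : (Fin (k + 2) → ℝ) → (Fin n → ℝ)}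
    (H : ℝ → (Fin (k + 2) → ℝ) → (Fin n → ℝ)) (hH : Continuous (Function.uncurry H))
    (hmem : ∀ s ∈ Set.Icc (0 : ℝ) 1, ∀ t ∈ Set.Icc (0 : Fin (k + 2) → ℝ) 1, H s t ∈ S)
    (hb : ∀ s ∈ Set.Icc (0 : ℝ) 1, ∀ t ∈ Set.Icc (0 : Fin (k + 2) → ℝ) 1, OnBdry t → H s t = 0)
    (hφ : Continuous φ) (hψ : Continuous ψ)
    (h0 : ∀ t ∈ Set.Icc (0 : Fin (k + 2) → ℝ) 1, H 0 t = φ t)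
    (h1 : ∀ t ∈ Set.Icc (0 : Fin (k + 2) → ℝ) 1, H 1 t = ψ t) : cls h₀ φ = cls h₀ ψ := by
  have hz : (0 : ℝ) ∈ Set.Icc (0 : ℝ) 1 := by simp
  have ho : (1 : ℝ) ∈ Set.Icc (0 : ℝ) 1 := by simp
  have hφ' : IsLoop S φ := ⟨hφ, fun t ht => h0 t ht ▸ hmem 0 hz t ht,
    fun t ht h => h0 t ht ▸ hb 0 hz t ht h⟩
  have hψ' : IsLoop S ψ := ⟨hψ, fun t ht => h1 t ht ▸ hmem 1 ho t ht,
    fun t ht h => h1 t ht ▸ hb 1 ho t ht h⟩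
  rw [cls_of_isLoop h₀ hφ', cls_of_isLoop h₀ hψ']
  refine genCls_eq_iff.mpr ⟨⟨⟨⟨fun x => ⟨H (x.1 : ℝ) (cubeVal x.2), hmem _ x.1.2 _ (cubeVal_mem _)⟩,
    ?_⟩, ?_, ?_⟩, ?_⟩⟩
  · refine Continuous.subtype_mk ?_ _
    exact hH.comp ((continuous_subtype_val.comp continuous_fst).prodMk
      (continuous_cubeVal.comp continuous_snd))
  · intro t
    exact Subtype.ext (h0 _ (cubeVal_mem t))
  · intro t
    exact Subtype.ext (h1 _ (cubeVal_mem t))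
  · intro s t ht
    refine Subtype.ext ?_
    change H s (cubeVal t) = φ (cubeVal t)
    rw [hb _ s.2 _ (cubeVal_mem t) (onBdry_cubeVal ht),
      hφ'.bdry _ (cubeVal_mem t) (onBdry_cubeVal ht)]

theorem cls_segment (h₀ : (0 : Fin n → ℝ) ∈ S) {φ ψ : (Fin (k + 2) → ℝ) → (Fin n → ℝ)}
    (hφ : Continuous φ) (hψ : Continuous ψ)
    (hbφ : ∀ t ∈ Set.Icc (0 : Fin (k + 2) → ℝ) 1, OnBdry t → φ t = 0)
    (hbψ : ∀ t ∈ Set.Icc (0 : Fin (k + 2) → ℝ) 1, OnBdry t → ψ t = 0)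
    (hmem : ∀ t ∈ Set.Icc (0 : Fin (k + 2) → ℝ) 1, segment ℝ (φ t) (ψ t) ⊆ S) :
    cls h₀ φ = cls h₀ ψ := by
  refine cls_homotopy h₀ (fun s t => (1 - s) • φ t + s • ψ t) ?_ ?_ ?_ hφ hψ
    (fun t _ => by simp) (fun t _ => by simp)
  · have h1 : Continuous fun x : ℝ × (Fin (k + 2) → ℝ) => φ x.2 := hφ.comp continuous_snd
    have h2 : Continuous fun x : ℝ × (Fin (k + 2) → ℝ) => ψ x.2 := hψ.comp continuous_snd
    exact ((continuous_const.sub continuous_fst).smul h1).add (continuous_fst.smul h2)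
  · intro s hs t ht
    exact hmem t ht ⟨1 - s, s, by linarith [hs.2], hs.1, by ring, rfl⟩
  · intro s _ t ht h
    simp [hbφ t ht h, hbψ t ht h]

theorem cls_congr (h₀ : (0 : Fin n → ℝ) ∈ S) {φ ψ : (Fin (k + 2) → ℝ) → (Fin n → ℝ)}
    (hφ : IsLoop S φ) (hψ : Continuous ψ)
    (h : ∀ t ∈ Set.Icc (0 : Fin (k + 2) → ℝ) 1, φ t = ψ t) : cls h₀ φ = cls h₀ ψ := by
  refine cls_segment h₀ hφ.cont hψ hφ.bdry (fun t ht hb => h t ht ▸ hφ.bdry t ht hb) ?_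
  intro t ht
  rw [← h t ht, segment_same]
  simpa using hφ.mem t ht

theorem isLoop_zero {m : ℕ} (h₀ : (0 : Fin n → ℝ) ∈ S) :
    IsLoop S (fun _ : Fin m → ℝ => (0 : Fin n → ℝ)) :=
  ⟨continuous_const, fun _ _ => h₀, fun _ _ _ => rfl⟩

theorem cls_zero (h₀ : (0 : Fin n → ℝ) ∈ S) :
    cls h₀ (fun _ : Fin (k + 2) → ℝ => (0 : Fin n → ℝ)) = 0 := by
  rw [cls_of_isLoop h₀ (isLoop_zero h₀)]
  rfl

theorem cls_eq_zero (h₀ : (0 : Fin n → ℝ) ∈ S) {φ : (Fin (k + 2) → ℝ) → (Fin n → ℝ)}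
    (h : ∀ t ∈ Set.Icc (0 : Fin (k + 2) → ℝ) 1, φ t = 0) : cls h₀ φ = 0 := by
  by_cases hφ : IsLoop S φ
  · rw [← cls_zero h₀]
    exact cls_congr h₀ hφ continuous_const h
  · exact dif_neg hφ

/-- The reparametrization of the unit interval sending `1 / 2` to `c`. -/
noncomputable def halfTo (c u : ℝ) : ℝ := c * min (2 * u) 1 + (1 - c) * max (2 * u - 1) 0

theorem continuous_halfTo (c : ℝ) : Continuous (halfTo c) := by
  unfold halfTo
  fun_prop

theorem halfTo_mem {c u : ℝ} (hc : c ∈ Set.Icc (0 : ℝ) 1) (hu : u ∈ Set.Icc (0 : ℝ) 1) :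
    halfTo c u ∈ Set.Icc (0 : ℝ) 1 := by
  have h1 : 0 ≤ min (2 * u) 1 := le_min (by linarith [hu.1]) zero_le_one
  have h2 : min (2 * u) 1 ≤ 1 := min_le_right _ _
  have h3 : 0 ≤ max (2 * u - 1) 0 := le_max_right _ _
  have h4 : max (2 * u - 1) 0 ≤ 1 := max_le (by linarith [hu.2]) zero_le_one
  have h5 := hc.1
  have h6 := hc.2
  unfold halfTo
  constructor
  · have := mul_nonneg h5 h1
    have := mul_nonneg (sub_nonneg.mpr h6) h3
    linarith
  · nlinarith

theorem halfTo_zero (c : ℝ) : halfTo c 0 = 0 := by simp [halfTo]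

theorem halfTo_one (c : ℝ) : halfTo c 1 = 1 := by
  unfold halfTo
  rw [min_eq_right (by norm_num), max_eq_left (by norm_num)]
  ring

theorem update_mem_Icc {m : ℕ} {t : Fin m → ℝ} (ht : t ∈ Set.Icc (0 : Fin m → ℝ) 1) (i : Fin m)
    {u : ℝ} (hu : u ∈ Set.Icc (0 : ℝ) 1) : Function.update t i u ∈ Set.Icc (0 : Fin m → ℝ) 1 := by
  constructor
  · intro j
    by_cases h : j = i
    · subst h
      simpa using hu.1
    · simpa [h] using ht.1 j
  · intro j
    by_cases h : j = i
    · subst h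
      simpa using hu.2
    · simpa [h] using ht.2 j

theorem cls_reparam (h₀ : (0 : Fin n → ℝ) ∈ S) {φ : (Fin (k + 2) → ℝ) → (Fin n → ℝ)}
    (hφ : IsLoop S φ) (β : Fin (k + 2) → ℝ → ℝ) (hβ : ∀ i, Continuous (β i))
    (hβm : ∀ i, ∀ u ∈ Set.Icc (0 : ℝ) 1, β i u ∈ Set.Icc (0 : ℝ) 1)
    (hβ0 : ∀ i, β i 0 = 0) (hβ1 : ∀ i, β i 1 = 1) :
    cls h₀ φ = cls h₀ (fun t => φ fun i => β i (t i)) := by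
  have hm : ∀ s ∈ Set.Icc (0 : ℝ) 1, ∀ t ∈ Set.Icc (0 : Fin (k + 2) → ℝ) 1,
      (fun i => (1 - s) * t i + s * β i (t i)) ∈ Set.Icc (0 : Fin (k + 2) → ℝ) 1 := by
    intro s hs t ht
    refine ⟨fun i => ?_, fun i => ?_⟩ <;> simp only [Pi.zero_apply, Pi.one_apply]
    · have h1 := (hβm i (t i) ⟨ht.1 i, ht.2 i⟩).1
      have h2 : 0 ≤ t i := ht.1 i
      have := mul_nonneg hs.1 h1
      have := mul_nonneg (sub_nonneg.mpr hs.2) h2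
      linarith
    · have h1 := (hβm i (t i) ⟨ht.1 i, ht.2 i⟩).2
      have h2 : t i ≤ 1 := ht.2 i
      nlinarith [hs.1, hs.2]
  refine cls_homotopy h₀ (fun s t => φ fun i => (1 - s) * t i + s * β i (t i)) ?_ ?_ ?_ hφ.cont
    (hφ.cont.comp (continuous_pi fun i => (hβ i).comp (continuous_apply i))) ?_ ?_
  · refine hφ.cont.comp (continuous_pi fun i => ?_)
    have h2 : Continuous fun x : ℝ × (Fin (k + 2) → ℝ) => x.2 i :=
      (continuous_apply i).comp continuous_snd
    exact ((continuous_const.sub continuous_fst).mul h2).add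
      (continuous_fst.mul ((hβ i).comp h2))
  · exact fun s hs t ht => hφ.mem _ (hm s hs t ht)
  · intro s hs t ht hb
    refine hφ.bdry _ (hm s hs t ht) ?_
    obtain ⟨i, hi⟩ := hb
    refine ⟨i, hi.imp (fun h => ?_) (fun h => ?_)⟩
    · simp [h, hβ0]
    · simp [h, hβ1]
  · intro t _
    simp
  · intro t _
    simp

theorem cls_concat (h₀ : (0 : Fin n → ℝ) ∈ S) {φ φ₁ φ₂ : (Fin (k + 2) → ℝ) → (Fin n → ℝ)}
    (i : Fin (k + 2)) (h1 : IsLoop S φ₁) (h2 : IsLoop S φ₂) (h : Continuous φ)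
    (e1 : ∀ t ∈ Set.Icc (0 : Fin (k + 2) → ℝ) 1, t i ≤ 1 / 2 →
      φ t = φ₁ (Function.update t i (2 * t i)))
    (e2 : ∀ t ∈ Set.Icc (0 : Fin (k + 2) → ℝ) 1, 1 / 2 < t i →
      φ t = φ₂ (Function.update t i (2 * t i - 1))) :
    cls h₀ φ = cls h₀ φ₁ + cls h₀ φ₂ := by
  have hup : ∀ (t : Fin (k + 2) → unitInterval) (u : unitInterval),
      cubeVal (Function.update t i u) = Function.update (cubeVal t) i (u : ℝ) := by
    intro t u
    funext j
    by_cases hj : j = i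
    · subst hj
      simp [cubeVal]
    · simp [cubeVal, hj]
  have key : ∀ t : Fin (k + 2) → unitInterval, φ (cubeVal t) =
      (GenLoop.transAt i (h1.toGen h₀) (h2.toGen h₀) t : S) := by
    intro t
    have ht := (t i).2
    have hval : cubeVal t i = (t i : ℝ) := rfl
    change _ = ((if (t i : ℝ) ≤ 1 / 2
      then h1.toGen h₀ (Function.update t i <| Set.projIcc 0 1 zero_le_one (2 * t i))
      else h2.toGen h₀ (Function.update t i <| Set.projIcc 0 1 zero_le_one (2 * t i - 1)) : S) :
        Fin n → ℝ)
    split_ifs with hle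
    · rw [e1 _ (cubeVal_mem t) hle]
      change _ = φ₁ (cubeVal _)
      rw [hup, Set.projIcc_of_mem zero_le_one ⟨by linarith [ht.1], by linarith⟩, hval]
    · push Not at hle
      rw [e2 _ (cubeVal_mem t) hle]
      change _ = φ₂ (cubeVal _)
      rw [hup, Set.projIcc_of_mem zero_le_one ⟨by linarith, by linarith [ht.2]⟩, hval]
  have hφ : IsLoop S φ := by
    refine ⟨h, fun t ht => ?_, fun t ht hb => ?_⟩
    · have := key fun j => ⟨t j, ht.1 j, ht.2 j⟩
      have e : cubeVal (fun j => (⟨t j, ht.1 j, ht.2 j⟩ : unitInterval)) = t := rfl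
      rw [e] at this
      rw [this]
      exact Subtype.coe_prop _
    · have := key fun j => ⟨t j, ht.1 j, ht.2 j⟩
      have e : cubeVal (fun j => (⟨t j, ht.1 j, ht.2 j⟩ : unitInterval)) = t := rfl
      rw [e, GenLoop.boundary] at this
      · exact this
      · obtain ⟨j, hj⟩ := hb
        exact ⟨j, hj.imp (fun h => Subtype.ext h) (fun h => Subtype.ext h)⟩
  rw [cls_of_isLoop h₀ hφ, cls_of_isLoop h₀ h1, cls_of_isLoop h₀ h2, ← genCls_transAt i]
  congr 1
  ext t : 1
  exact Subtype.ext (key t)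

/-- A loop vanishing on a hyperplane `t i = c` is the sum of its two parts. -/
theorem cls_split (h₀ : (0 : Fin n → ℝ) ∈ S) {φ : (Fin (k + 2) → ℝ) → (Fin n → ℝ)}
    (hφ : IsLoop S φ) (i : Fin (k + 2)) {c : ℝ} (hc : c ∈ Set.Icc (0 : ℝ) 1)
    (hz : ∀ t ∈ Set.Icc (0 : Fin (k + 2) → ℝ) 1, t i = c → φ t = 0) :
    cls h₀ φ = cls h₀ (fun t => φ (Function.update t i (c * t i))) +
      cls h₀ (fun t => φ (Function.update t i (c + (1 - c) * t i))) := by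
  have hb : ∀ (a b : ℝ), (a = 0 ∨ a = c) → (a + b = c ∨ a + b = 1) → 0 ≤ b →
      IsLoop S (fun t : Fin (k + 2) → ℝ => φ (Function.update t i (a + b * t i))) := by
    intro a b ha hab hb0
    have hm : ∀ t ∈ Set.Icc (0 : Fin (k + 2) → ℝ) 1,
        Function.update t i (a + b * t i) ∈ Set.Icc (0 : Fin (k + 2) → ℝ) 1 := by
      intro t ht
      refine update_mem_Icc ht i ?_
      have h1 : 0 ≤ t i := ht.1 i
      have h2 : t i ≤ 1 := ht.2 i
      have h3 : 0 ≤ a := by rcases ha with rfl | rfl; exacts [le_rfl, hc.1]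
      have h4 : a + b ≤ 1 := by rcases hab with h | h <;> rw [h]; exact hc.2
      constructor
      · positivity
      · nlinarith
    refine ⟨hφ.cont.comp ?_, fun t ht => hφ.mem _ (hm t ht), ?_⟩
    · exact continuous_id.update i
        (continuous_const.add (continuous_const.mul (continuous_apply i)))
    · rintro t ht ⟨j, hj⟩
      by_cases hji : j = i
      · subst hji
        rcases hj with h | h
        · rcases ha with rfl | rfl
          · exact hφ.bdry _ (hm t ht) ⟨j, Or.inl (by simp [h])⟩
          · exact hz _ (hm t ht) (by simp [h])
        · rcases hab with h' | h'
          · exact hz _ (hm t ht) (by simp [h, h'])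
          · exact hφ.bdry _ (hm t ht) ⟨j, Or.inr (by simp [h, h'])⟩
      · exact hφ.bdry _ (hm t ht) ⟨j, by simpa [hji] using hj⟩
  have h1 := hb 0 c (Or.inl rfl) (Or.inl (zero_add c)) hc.1
  have h2 := hb c (1 - c) (Or.inr rfl) (Or.inr (by ring)) (by linarith [hc.2])
  simp only [zero_add] at h1
  classical
  rw [cls_reparam h₀ hφ (fun j => if j = i then halfTo c else id)]
  · refine cls_concat h₀ i h1 h2 ?_ ?_ ?_
    · refine hφ.cont.comp (continuous_pi fun j => ?_)
      split_ifs
      · exact (continuous_halfTo c).comp (continuous_apply j)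
      · exact continuous_apply j
    · intro t _ hle
      congr 1
      funext j
      by_cases hj : j = i
      · subst hj
        simp only [if_true, Function.update_self, halfTo]
        rw [min_eq_left (by linarith), max_eq_right (by linarith)]
        ring
      · simp [hj]
    · intro t _ hle
      congr 1
      funext j
      by_cases hj : j = i
      · subst hj
        simp only [if_true, Function.update_self, halfTo]
        rw [min_eq_right (by linarith), max_eq_left (by linarith)]
        ring
      · simp [hj]
  · intro j
    split_ifs
    · exact continuous_halfTo c
    · exact continuous_id
  · intro j u hu
    split_ifs
    · exact halfTo_mem hc hu
    · exact hu
  · intro j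
    split_ifs
    · exact halfTo_zero c
    · rfl
  · intro j
    split_ifs
    · exact halfTo_one c
    · rfl

end Cls

/-! ### Decomposition of a loop into unit boxes -/

section Boxes

variable {k n : ℕ} {S : Set (Fin n → ℝ)}

/-- The lattice points of a half-open box. -/
def latBox {m : ℕ} (a : Fin m → ℤ) (e : Fin m → ℕ) : Set (Fin m → ℤ) :=
  {z | ∀ i, a i ≤ z i ∧ z i < a i + e i}

theorem finite_latBox {m : ℕ} (a : Fin m → ℤ) (e : Fin m → ℕ) : (latBox a e).Finite := by
  refine (Set.finite_Icc a (a + fun i => (e i : ℤ))).subset fun z hz => ⟨fun i => (hz i).1, ?_⟩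
  exact fun i => (hz i).2.le

theorem cls_latBox (h₀ : (0 : Fin n → ℝ) ∈ S) {g : (Fin (k + 2) → ℝ) → (Fin n → ℝ)}
    (hg : Continuous g) (hS : ∀ y, g y ∈ S)
    (hz : ∀ (y : Fin (k + 2) → ℝ) (i : Fin (k + 2)) (s : ℤ), y i = (s : ℝ) → g y = 0)
    (N : ℕ) : ∀ (a : Fin (k + 2) → ℤ) (e : Fin (k + 2) → ℕ), (∀ i, 1 ≤ e i) → ∑ i, e i ≤ N →
      cls h₀ (fun t => g fun i => a i + e i * t i) =
        ∑ᶠ z ∈ latBox a e, cls h₀ (fun t => g fun i => (z i : ℝ) + t i) := by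
  induction N with
  | zero =>
    intro a e h1 h2
    have := Finset.single_le_sum (f := e) (fun i _ => Nat.zero_le _) (Finset.mem_univ 0)
    have := h1 0
    omega
  | succ N ih =>
    intro a e h1 h2
    by_cases hall : ∀ i, e i = 1
    · have : latBox a e = {a} := by
        ext z
        simp only [latBox, hall, Set.mem_ofPred_eq, Set.mem_singleton_iff]
        constructor
        · intro h
          funext i
          have := h i
          push_cast at this
          omega
        · rintro rfl i
          simp
      rw [this, finsum_mem_singleton]
      simp [hall]
    · push Not at hall
      obtain ⟨i, hi⟩ := hall
      obtain ⟨c, hc⟩ : ∃ c, e i = c + 2 := ⟨e i - 2, by have := h1 i; omega⟩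
      have hloop : IsLoop S (fun t : Fin (k + 2) → ℝ => g fun i => a i + e i * t i) := by
        refine ⟨hg.comp (continuous_pi fun i => continuous_const.add
          (continuous_const.mul (continuous_apply i))), fun t _ => hS _, ?_⟩
        rintro t - ⟨j, hj | hj⟩
        · exact hz _ j (a j) (by simp [hj])
        · exact hz _ j (a j + e j) (by simp [hj])
      have hsum : ∑ j, e j = e i + ∑ j ∈ Finset.univ.erase i, e j :=
        (Finset.add_sum_erase _ _ (Finset.mem_univ i)).symm
      have hsum' : ∀ b, ∑ j, Function.update e i b j = b + ∑ j ∈ Finset.univ.erase i, e j := by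
        intro b
        rw [← Finset.add_sum_erase _ _ (Finset.mem_univ i), Function.update_self]
        congr 1
        refine Finset.sum_congr rfl fun j hj => ?_
        rw [Function.update_of_ne (Finset.ne_of_mem_erase hj)]
      have hpos : (0 : ℝ) < c + 2 := by positivity
      rw [cls_split h₀ hloop i (c := 1 / (c + 2 : ℝ)) ⟨by positivity, by
        rw [div_le_one hpos]; linarith [(Nat.cast_nonneg c : (0 : ℝ) ≤ c)]⟩]
      · have hd : Disjoint (latBox a (Function.update e i 1))
            (latBox (a + Pi.single i 1) (Function.update e i (c + 1))) := by
          rw [Set.disjoint_left]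
          intro z hz1 hz2
          have := hz1 i
          have := hz2 i
          simp only [Function.update_self, Pi.add_apply, Pi.single_eq_same] at *
          push_cast at *
          omega
        have hun : latBox a e = latBox a (Function.update e i 1) ∪
            latBox (a + Pi.single i 1) (Function.update e i (c + 1)) := by
          ext z
          simp only [latBox, Set.mem_union, Set.mem_ofPred_eq]
          constructor
          · intro h
            by_cases hzi : z i < a i + 1
            · left
              intro j
              by_cases hj : j = i
              · subst hj
                simp only [Function.update_self]
                exact ⟨(h j).1, by push_cast; omega⟩
              · simpa [hj] using h j
            · right
              intro j
              by_cases hj : j = i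
              · subst hj
                have := h j
                simp only [Function.update_self, Pi.add_apply, Pi.single_eq_same]
                rw [hc] at this
                push_cast at this ⊢
                omega
              · simpa [hj] using h j
          · rintro (h | h) j
            · by_cases hj : j = i
              · subst hj
                have := h j
                simp only [Function.update_self] at this
                rw [hc]
                push_cast at this ⊢
                omega
              · simpa [hj] using h j
            · by_cases hj : j = i
              · subst hj
                have := h j
                simp only [Function.update_self, Pi.add_apply, Pi.single_eq_same] at this
                rw [hc]
                push_cast at this ⊢
                omega
              · simpa [hj] using h j
        rw [hun, finsum_mem_union hd (finite_latBox _ _) (finite_latBox _ _),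
          ← ih a (Function.update e i 1), ← ih (a + Pi.single i 1) (Function.update e i (c + 1))]
        · congr 3
          · funext t
            congr 1
            funext j
            by_cases hj : j = i
            · subst hj
              simp only [Function.update_self, hc]
              push_cast
              field_simp
            · simp [hj]
          · funext t
            congr 1
            funext j
            by_cases hj : j = i
            · subst hj
              simp only [Function.update_self, hc, Pi.add_apply, Pi.single_eq_same]
              push_cast
              field_simp
              ring
            · simp [hj]
        · intro j
          by_cases hj : j = i
          · subst hj
            simp
          · simpa [hj] using h1 j
        · rw [hsum']
          omega
        · intro j
          by_cases hj : j = i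
          · subst hj
            simp
          · simpa [hj] using h1 j
        · rw [hsum']
          omega
      · intro t _ ht
        refine hz _ i (a i + 1) ?_
        simp only [ht, hc]
        push_cast
        field_simp

theorem cls_eq_finsum_boxes (h₀ : (0 : Fin n → ℝ) ∈ S) {g : (Fin (k + 2) → ℝ) → (Fin n → ℝ)}
    (hg : Continuous g) (hS : ∀ y, g y ∈ S)
    (hz : ∀ (y : Fin (k + 2) → ℝ) (i : Fin (k + 2)) (s : ℤ), y i = (s : ℝ) → g y = 0)
    {N : ℕ} (hN : 1 ≤ N)
    (hout : ∀ (y : Fin (k + 2) → ℝ) (i : Fin (k + 2)), (y i ≤ 0 ∨ (N : ℝ) ≤ y i) → g y = 0) :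
    cls h₀ (fun t => g ((N : ℝ) • t)) = ∑ᶠ z, cls h₀ (fun t => g (toR z + t)) := by
  have h := cls_latBox h₀ hg hS hz _ 0 (fun _ => N) (fun _ => hN) le_rfl
  simp only [Pi.zero_apply, Int.cast_zero, zero_add] at h
  refine h.trans (finsum_congr fun z => ?_)
  by_cases hcon : z ∈ latBox 0 fun _ : Fin (k + 2) => N
  · simp only [hcon, finsum_true]
    rfl
  simp only [hcon, finsum_false]
  refine (cls_eq_zero h₀ fun t ht => ?_).symm
  simp only [latBox, Set.mem_ofPred_eq, not_forall] at hcon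
  obtain ⟨i, hi⟩ := hcon
  refine hout _ i ?_
  simp only [Pi.zero_apply, zero_add, not_and, not_lt] at hi
  have h1 : 0 ≤ t i := ht.1 i
  have h2 : t i ≤ 1 := ht.2 i
  have h4 : (toR z + t) i = z i + t i := rfl
  by_cases h3 : 0 ≤ z i
  · right
    have : (N : ℝ) ≤ z i := by exact_mod_cast hi h3
    linarith
  · left
    have : z i ≤ -1 := by omega
    have : (z i : ℝ) ≤ -1 := by exact_mod_cast this
    linarith

end Boxes

/-! ### Loops given by labellings of the lattice -/

section Labellings

open LCube MeasureTheory

theorem integral_ite_lt {a : ℝ} (ha : a ∈ Set.Icc (0 : ℝ) 1) :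
    ∫ θ in Set.Ioo (0 : ℝ) 1, (if θ < a then (1 : ℝ) else 0) = a := by
  have h : (fun θ : ℝ => if θ < a then (1 : ℝ) else 0) = (Set.Iio a).indicator fun _ => 1 := by
    funext θ
    simp [Set.indicator, Set.mem_Iio]
  rw [h, setIntegral_indicator measurableSet_Iio]
  have h2 : Set.Ioo (0 : ℝ) 1 ∩ Set.Iio a = Set.Ioo 0 a := by
    ext x
    simp only [Set.mem_inter_iff, Set.mem_Ioo, Set.mem_Iio]
    constructor
    · exact fun h => ⟨h.1.1, h.2⟩
    · exact fun h => ⟨⟨h.1, h.2.trans_le ha.2⟩, h.2⟩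
  rw [h2]
  simp [ha.1]

theorem kuhn_apply {d n : ℕ} (l : (Fin d → ℤ) → (Fin n → ℤ)) (y : Fin d → ℝ) (j : Fin n) :
    kuhn l y j = ∫ θ in Set.Ioo (0 : ℝ) 1, ((l fun i => ⌈y i - θ⌉) j : ℝ) :=
  ((ContinuousLinearMap.proj (R := ℝ) (φ := fun _ : Fin n => ℝ) j).integral_comp_comm
    (integrable_kuhn l y)).symm

theorem pwl_eq_kuhn (q : ℤ → ℤ) (y : ℝ) :
    pwl q y = kuhn (fun (w : Fin 1 → ℤ) (_ : Fin 1) => q (w 0)) (fun _ => y) 0 := by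
  rw [kuhn_apply]
  have h : ∀ θ ∈ Set.Ioo (0 : ℝ) 1, ((q ⌈y - θ⌉ : ℤ) : ℝ) =
      q ⌊y⌋ + (q (⌊y⌋ + 1) - q ⌊y⌋) * (if θ < Int.fract y then (1 : ℝ) else 0) := by
    intro θ hθ
    rw [ceil_sub_eq hθ]
    by_cases h : θ < Int.fract y <;> simp [h]
  rw [setIntegral_congr_fun measurableSet_Ioo h, integral_add (integrable_const _),
    integral_const_mul, integral_ite_lt ⟨Int.fract_nonneg y, (Int.fract_lt_one y).le⟩]
  · simp [pwl]
  · refine Integrable.const_mul ?_ _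
    refine Integrable.of_bound (Measurable.aestronglyMeasurable ?_) 1
      (Filter.Eventually.of_forall fun θ => ?_)
    · exact Measurable.ite measurableSet_Iio measurable_const measurable_const
    · split_ifs <;> simp

theorem continuous_pwl (q : ℤ → ℤ) : Continuous (pwl q) := by
  have : pwl q = fun y => kuhn (fun (w : Fin 1 → ℤ) (_ : Fin 1) => q (w 0)) (fun _ => y) 0 :=
    funext (pwl_eq_kuhn q)
  rw [this]
  have h : Continuous fun (y : ℝ) (_ : Fin 1) => y := continuous_pi fun _ => continuous_id
  have h2 := (continuous_kuhn (fun (w : Fin 1 → ℤ) (_ : Fin 1) => q (w 0))).comp h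
  exact (continuous_apply 0).comp h2

theorem carrier_vertex_le {d : ℕ} {y : Fin d → ℝ} {ε : Fin d → Bool} (hε : ε ∈ carrier y)
    {i : Fin d} {b : ℤ} (h : y i ≤ b) : (flr y + bz ε) i ≤ b := by
  obtain ⟨θ, hθ, rfl⟩ := hε
  rw [← ceil_sub_eq_flr hθ, Int.ceil_le]
  linarith [hθ.1]

theorem le_carrier_vertex {d : ℕ} {y : Fin d → ℝ} {ε : Fin d → Bool} (hε : ε ∈ carrier y)
    {i : Fin d} {b : ℤ} (h : (b : ℝ) ≤ y i) : b ≤ (flr y + bz ε) i := by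
  obtain ⟨θ, hθ, rfl⟩ := hε
  rw [← ceil_sub_eq_flr hθ, Int.le_ceil_iff]
  linarith [hθ.2]

/-- The labelling vanishes outside of the open box of side `N`. -/
def ZeroOut {d n : ℕ} (N : ℕ) (l : (Fin d → ℤ) → (Fin n → ℤ)) : Prop :=
  ∀ w i, (w i ≤ 0 ∨ (N : ℤ) ≤ w i) → l w = 0

theorem toR_zero {n : ℕ} : toR (0 : Fin n → ℤ) = 0 := by
  funext i
  simp [toR]

theorem ZeroOut.kuhn_eq_zero {d n N : ℕ} {l : (Fin d → ℤ) → (Fin n → ℤ)} (hl : ZeroOut N l)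
    {y : Fin d → ℝ} {i : Fin d} (h : y i ≤ 0 ∨ (N : ℝ) ≤ y i) : kuhn l y = 0 := by
  rw [← toR_zero]
  refine kuhn_eq_const fun ε hε => hl _ i (h.imp (fun h => ?_) fun h => ?_)
  · exact carrier_vertex_le hε (by exact_mod_cast h)
  · exact le_carrier_vertex hε (by exact_mod_cast h)

/-- The complement of the translates of a point by the integer lattice. -/
def Punct {n : ℕ} (p : Fin n → ℝ) : Set (Fin n → ℝ) := {x | ∀ z : Fin n → ℤ, x ≠ p + toR z}

theorem Avoids.subset {n : ℕ} {p : Fin n → ℝ} {T : Set (Fin n → ℤ)} (h : Avoids p T) :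
    convexHull ℝ (toR '' T) ⊆ Punct p := by
  intro x hx z hz
  exact h z (hz ▸ hx)

theorem GenericPt.zero_mem {m : ℕ} {p : Fin (m + 1) → ℝ} (hp : GenericPt p) :
    (0 : Fin (m + 1) → ℝ) ∈ Punct p := by
  have h := hp.avoids_of_ncard_le (S := {0}) (Set.finite_singleton _) (by simp)
  exact h.subset (subset_convexHull ℝ _ ⟨0, rfl, toR_zero⟩)

variable {k : ℕ} {p : Fin (k + 3) → ℝ}

/-- The class of the loop given by a labelling vanishing outside of the box of side `N`. -/
noncomputable def kcls (hp : GenericPt p) (N : ℕ)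
    (l : (Fin (k + 2) → ℤ) → (Fin (k + 3) → ℤ)) : PiGrp k hp.zero_mem :=
  cls hp.zero_mem fun t => kuhn l ((N : ℝ) • t)

theorem ZeroOut.kuhn_bdry {d n N : ℕ} {l : (Fin d → ℤ) → (Fin n → ℤ)} (hl : ZeroOut N l)
    {t : Fin d → ℝ} (h : OnBdry t) : kuhn l ((N : ℝ) • t) = 0 := by
  obtain ⟨i, hi⟩ := h
  refine hl.kuhn_eq_zero (i := i) (hi.imp (fun h => ?_) fun h => ?_) <;> simp [h]

theorem continuous_kuhn_smul {d n : ℕ} (l : (Fin d → ℤ) → (Fin n → ℤ)) (N : ℝ) :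
    Continuous fun t : Fin d → ℝ => kuhn l (N • t) :=
  (continuous_kuhn l).comp (continuous_const_smul N)

theorem ZeroOut.isLoop {N : ℕ} {l : (Fin (k + 2) → ℤ) → (Fin (k + 3) → ℤ)} (hl : ZeroOut N l)
    (hp : GenericPt p) : IsLoop (Punct p) fun t : Fin (k + 2) → ℝ => kuhn l ((N : ℝ) • t) :=
  ⟨continuous_kuhn_smul _ _, fun _ _ => hp.kuhn_avoids _ _, fun _ _ h => hl.kuhn_bdry h⟩

theorem segment_kuhn_subset {d n : ℕ} {l l' : (Fin d → ℤ) → (Fin n → ℤ)} {y : Fin d → ℝ}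
    {T : Set (Fin n → ℤ)} (h : ∀ ε ∈ carrier y, l (flr y + bz ε) ∈ T ∧ l' (flr y + bz ε) ∈ T) :
    segment ℝ (kuhn l y) (kuhn l' y) ⊆ convexHull ℝ (toR '' T) := by
  refine (convex_convexHull ℝ _).segment_subset ?_ ?_
  · refine convexHull_mono (Set.image_mono ?_) (kuhn_mem l y)
    rintro _ ⟨ε, hε, rfl⟩
    exact (h ε hε).1
  · refine convexHull_mono (Set.image_mono ?_) (kuhn_mem l' y)
    rintro _ ⟨ε, hε, rfl⟩
    exact (h ε hε).2

theorem kcls_congr (hp : GenericPt p) {N : ℕ} {l l' : (Fin (k + 2) → ℤ) → (Fin (k + 3) → ℤ)}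
    (hl : ZeroOut N l) (hl' : ZeroOut N l')
    (h : ∀ y : Fin (k + 2) → ℝ, ∃ T, Avoids p T ∧
      ∀ ε ∈ carrier y, l (flr y + bz ε) ∈ T ∧ l' (flr y + bz ε) ∈ T) :
    kcls hp N l = kcls hp N l' := by
  refine cls_segment _ (continuous_kuhn_smul _ _) (continuous_kuhn_smul _ _)
    (fun t _ => hl.kuhn_bdry) (fun t _ => hl'.kuhn_bdry) fun t _ => ?_
  obtain ⟨T, hT, h⟩ := h ((N : ℝ) • t)
  exact (segment_kuhn_subset h).trans hT.subset

theorem zeroOut_zero {d n N : ℕ} : ZeroOut N fun _ : Fin d → ℤ => (0 : Fin n → ℤ) :=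
  fun _ _ _ => rfl

theorem kcls_zero (hp : GenericPt p) (N : ℕ) : kcls (k := k) hp N (fun _ => 0) = 0 :=
  cls_eq_zero _ fun t _ => by rw [kuhn_const, toR_zero]

/-- The labelling of the box of side `3` extending a labelled unit cube by zero. -/
def ext {d n : ℕ} (a : LCube (Fin n → ℤ) d) (w : Fin d → ℤ) : Fin n → ℤ :=
  if ∀ i, w i = 1 ∨ w i = 2 then a (fun i => decide (2 ≤ w i)) else 0

theorem zeroOut_ext {d n : ℕ} (a : LCube (Fin n → ℤ) d) : ZeroOut 3 (ext a) := by
  intro w i h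
  refine if_neg fun hw => ?_
  have := hw i
  push_cast at h
  omega

/-- The class of the loop given by a labelled unit cube. -/
noncomputable def cubeCls (hp : GenericPt p) (a : LCube (Fin (k + 3) → ℤ) (k + 2)) :
    PiGrp k hp.zero_mem :=
  kcls hp 3 (ext a)

theorem monotone_decide_le {d : ℕ} (z : Fin d → ℤ) (b : ℤ) :
    Monotone fun (ε : Fin d → Bool) i => decide (b ≤ (z + bz ε) i) := by
  intro ε ε' h i
  dsimp only
  rw [Bool.le_iff_imp]
  simp only [decide_eq_true_eq, Pi.add_apply]
  intro h1
  have h2 : bz ε i ≤ bz ε' i := by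
    have := h i
    unfold bz
    rw [Bool.le_iff_imp] at this
    split_ifs with h3 h4 <;> first | omega | (exact absurd (this h3) h4)
  omega

theorem cubeCls_eq_zero (hp : GenericPt p) {a : LCube (Fin (k + 3) → ℤ) (k + 2)}
    (h : ∀ D : Set (Fin (k + 2) → Bool), IsChain (· ≤ ·) D → Avoids p (insert 0 (a '' D))) :
    cubeCls hp a = 0 := by
  rw [← kcls_zero hp 3]
  refine kcls_congr hp (zeroOut_ext a) zeroOut_zero fun y => ⟨_, h _
    (LCube.IsChain.image_mono (isChain_carrier y) (monotone_decide_le (flr y) 2)),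
    fun ε hε => ⟨?_, Or.inl rfl⟩⟩
  unfold ext
  split_ifs
  · exact Or.inr ⟨_, ⟨ε, hε, rfl⟩, rfl⟩
  · exact Or.inl rfl

theorem LCube.ncard_chain_add_le {d : ℕ} {D : Set (Fin d → Bool)} (hD : IsChain (· ≤ ·) D)
    (L : Finset (Fin d)) (hL : ∀ i ∈ L, ∀ ε ∈ D, ∀ ε' ∈ D, ε i = ε' i) :
    D.ncard + L.card ≤ d + 1 := by
  have hinj : Set.InjOn (fun t : Fin d → Bool => (Lᶜ.filter (fun i => t i = true)).card) D := by
    have key : ∀ s ∈ D, ∀ t ∈ D, s ≤ t → (Lᶜ.filter (fun i => s i = true)).card =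
          (Lᶜ.filter (fun i => t i = true)).card → s = t := by
      intro s hs t ht hst hcard
      have hsub : Lᶜ.filter (fun i => s i = true) ⊆ Lᶜ.filter (fun i => t i = true) := by
        intro i
        have := hst i
        rw [Bool.le_iff_imp] at this
        simp only [Finset.mem_filter]
        exact fun h => ⟨h.1, this h.2⟩
      have heq := Finset.eq_of_subset_of_card_le hsub hcard.ge
      funext i
      by_cases hi : i ∈ L
      · exact hL i hi s hs t ht
      · have := Finset.ext_iff.mp heq i
        simp only [Finset.mem_filter, Finset.mem_compl, hi, not_false_eq_true, true_and] at this
        exact Bool.eq_iff_iff.mpr this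
    intro s hs t ht hst
    rcases hD.total hs ht with h | h
    · exact key s hs t ht h hst
    · exact (key t ht s hs h hst.symm).symm
  have hc : Lᶜ.card + L.card = d := by
    rw [Finset.card_compl, Fintype.card_fin]
    have := L.card_le_univ
    rw [Fintype.card_fin] at this
    omega
  have : D.ncard ≤ Lᶜ.card + 1 := by
    rw [← hinj.ncard_image]
    calc _ ≤ (Set.Iio (Lᶜ.card + 1)).ncard := by
          refine Set.ncard_le_ncard ?_ (Set.finite_Iio _)
          rintro _ ⟨t, -, rfl⟩
          exact Nat.lt_succ_of_le (Finset.card_filter_le _ _)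
      _ = _ := by rw [← Finset.coe_Iio, Set.ncard_coe_finset, Nat.card_Iio]
  omega

/-- The vertex with the coordinates in `L` set to `false`. -/
def LCube.erase {d : ℕ} (L : Finset (Fin d)) (ε : Fin d → Bool) : Fin d → Bool :=
  fun i => if i ∈ L then false else ε i

theorem LCube.monotone_erase {d : ℕ} (L : Finset (Fin d)) : Monotone (LCube.erase L) := by
  intro ε ε' h i
  unfold LCube.erase
  split_ifs
  · exact le_rfl
  · exact h i

theorem LCube.ncard_image_add_le {d : ℕ} {V : Type*} {D : Set (Fin d → Bool)}
    (hD : IsChain (· ≤ ·) D) (L : Finset (Fin d)) {c : LCube V d}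
    (hc : ∀ ε ∈ D, ∀ ε' ∈ D, (∀ i ∉ L, ε i = ε' i) → c ε = c ε') :
    (c '' D).ncard + L.card ≤ d + 1 := by
  have h1 := LCube.ncard_chain_add_le (LCube.IsChain.image_mono hD (LCube.monotone_erase L)) L (by
    rintro i hi _ ⟨ε, -, rfl⟩ _ ⟨ε', -, rfl⟩
    simp [LCube.erase, hi])
  refine le_trans (Nat.add_le_add_right ?_ _) h1
  classical
  by_cases hne : D.Nonempty
  · obtain ⟨ε₀, hε₀⟩ := hne
    have hex : ∀ η : Fin d → Bool, ∃ ε ∈ D, η ∈ LCube.erase L '' D → LCube.erase L ε = η := by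
      intro η
      by_cases h : η ∈ LCube.erase L '' D
      · obtain ⟨ε, hε, rfl⟩ := h
        exact ⟨ε, hε, fun _ => rfl⟩
      · exact ⟨ε₀, hε₀, fun h' => absurd h' h⟩
    choose f hf1 hf2 using hex
    have : c '' D ⊆ (fun η => c (f η)) '' (LCube.erase L '' D) := by
      rintro _ ⟨ε, hε, rfl⟩
      refine ⟨_, ⟨ε, hε, rfl⟩, hc _ (hf1 _) _ hε fun i hi => ?_⟩
      have := congrFun (hf2 _ ⟨ε, hε, rfl⟩) i
      simpa [LCube.erase, hi] using this
    exact (Set.ncard_le_ncard this (Set.toFinite _)).trans (Set.ncard_image_le (Set.toFinite _))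
  · rw [Set.not_nonempty_iff_eq_empty.mp hne]
    simp

theorem GenericPt.avoids_insert_zero (hp : GenericPt p) {T : Set (Fin (k + 3) → ℤ)}
    (hT : T.Finite) (h : T.ncard ≤ k + 2) : Avoids p (insert 0 T) :=
  hp.avoids_of_ncard_le (hT.insert _) ((Set.ncard_insert_le _ _).trans (by omega))

theorem cubeCls_eq_zero_of_ncard (hp : GenericPt p) {a : LCube (Fin (k + 3) → ℤ) (k + 2)}
    (h : ∀ D : Set (Fin (k + 2) → Bool), IsChain (· ≤ ·) D → (a '' D).ncard ≤ k + 2) :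
    cubeCls hp a = 0 :=
  cubeCls_eq_zero hp fun D hD => hp.avoids_insert_zero (Set.toFinite _) (h D hD)

theorem cubeCls_eq_zero_of_indep (hp : GenericPt p) {a : LCube (Fin (k + 3) → ℤ) (k + 2)}
    (i : Fin (k + 2)) (h : ∀ ε ε', (∀ j, j ≠ i → ε j = ε' j) → a ε = a ε') :
    cubeCls hp a = 0 := by
  refine cubeCls_eq_zero_of_ncard hp fun D hD => ?_
  have := LCube.ncard_image_add_le hD {i} (c := a) (fun ε _ ε' _ hh => h ε ε' fun j hj =>
    hh j (by simpa using hj))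
  simpa using this

theorem cubeCls_eq_zero_of_face (hp : GenericPt p) {a : LCube (Fin (k + 3) → ℤ) (k + 2)}
    (i : Fin (k + 2)) (b : Bool) (h : ∀ ε, ε i = b → a ε = 0) : cubeCls hp a = 0 := by
  refine cubeCls_eq_zero hp fun D hD => ?_
  have hD' : IsChain (· ≤ ·) (D ∩ {ε | ε i ≠ b}) := hD.mono Set.inter_subset_left
  have hn : (a '' (D ∩ {ε | ε i ≠ b})).ncard ≤ k + 2 := by
    have := LCube.ncard_chain_add_le hD' {i} (by
      intro j hj ε hε ε' hε'
      obtain rfl := Finset.mem_singleton.mp hj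
      have h1 := hε.2
      have h2 := hε'.2
      simp only [Set.mem_ofPred_eq] at h1 h2
      revert h1 h2
      cases ε j <;> cases ε' j <;> cases b <;> simp)
    rw [Finset.card_singleton] at this
    exact (Set.ncard_image_le (Set.toFinite _)).trans (by omega)
  refine GenericPt.avoids_mono ?_ (hp.avoids_insert_zero (Set.toFinite _) hn)
  rintro _ (rfl | ⟨ε, hε, rfl⟩)
  · exact Or.inl rfl
  · by_cases hb : ε i = b
    · exact Or.inl (h ε hb)
    · exact Or.inr ⟨ε, ⟨hε, hb⟩, rfl⟩

end Labellings

/-! ### Decomposition of the loop of a labelling into labelled cubes -/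

section Subdivision

open LCube

/-- Division by three, rounded to the nearest integer. -/
def third (a : ℤ) : ℤ := (a + 1) / 3

theorem third_step (a : ℤ) : third (a + 1) = third a ∨ third (a + 1) = third a + 1 := by
  unfold third
  omega

variable {k : ℕ} {p : Fin (k + 3) → ℝ}

theorem kcls_third (hp : GenericPt p) {N : ℕ} (hN : 1 ≤ N)
    {l : (Fin (k + 2) → ℤ) → (Fin (k + 3) → ℤ)} (hl : ZeroOut N l) :
    kcls hp (3 * N) (fun w => l fun i => third (w i)) = kcls hp N l := by
  have hN0 : (0 : ℝ) < N := by exact_mod_cast hN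
  have hq : ∀ u : ℝ, pwl third u ∈ Set.Icc ((third ⌊u⌋ : ℤ) : ℝ) ((third (⌊u⌋ + 1) : ℤ) : ℝ) := by
    intro u
    have h0 := Int.fract_nonneg u
    have h1 := (Int.fract_lt_one u).le
    rcases third_step ⌊u⌋ with h | h <;> simp only [pwl, h, Set.mem_Icc] <;> push_cast <;>
      constructor <;> nlinarith
  have hpwl : ∀ a : ℤ, pwl third (a : ℝ) = third a := by
    intro a
    simp [pwl]
  rw [kcls, kcls, cls_reparam _ (hl.isLoop hp)
    (fun _ u => pwl third (((3 * N : ℕ) : ℝ) * u) / N)]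
  · congr 1
    funext t
    rw [kuhn_comp l third third_step]
    congr 1
    funext i
    simp only [Pi.smul_apply, smul_eq_mul]
    field_simp
  · intro _
    exact ((continuous_pwl _).comp (continuous_const_mul _)).div_const _
  · intro _ u hu
    have h := hq (((3 * N : ℕ) : ℝ) * u)
    have h0 : 0 ≤ ⌊((3 * N : ℕ) : ℝ) * u⌋ := Int.floor_nonneg.mpr (by have := hu.1; positivity)
    refine ⟨div_nonneg ?_ hN0.le, ?_⟩
    · refine le_trans ?_ h.1
      have : 0 ≤ third ⌊((3 * N : ℕ) : ℝ) * u⌋ := by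
        unfold third
        omega
      exact_mod_cast this
    · rw [div_le_one hN0]
      rcases hu.2.lt_or_eq with h2 | rfl
      · refine h.2.trans ?_
        have h3 : ⌊((3 * N : ℕ) : ℝ) * u⌋ < (3 * N : ℕ) := by
          rw [Int.floor_lt]
          push_cast
          nlinarith
        have : third (⌊((3 * N : ℕ) : ℝ) * u⌋ + 1) ≤ N := by
          unfold third
          generalize ⌊((3 * N : ℕ) : ℝ) * u⌋ = a at h3
          push_cast at h3
          omega
        exact_mod_cast this
      · have e : ((3 * N : ℕ) : ℝ) * 1 = ((3 * N : ℤ) : ℝ) := by push_cast; ring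
        rw [e, hpwl]
        have : third (3 * N : ℤ) ≤ N := by
          unfold third
          omega
        exact_mod_cast this
  · intro _
    have := hpwl 0
    rw [Int.cast_zero] at this
    rw [mul_zero, this]
    simp [third]
  · intro _
    have e : ((3 * N : ℕ) : ℝ) * 1 = ((3 * N : ℤ) : ℝ) := by push_cast; ring
    have e2 : third (3 * N : ℤ) = N := by
      unfold third
      omega
    rw [e, hpwl, e2]
    push_cast
    field_simp

theorem ZeroOut.third {d n N : ℕ} {l : (Fin d → ℤ) → (Fin n → ℤ)} (hl : ZeroOut N l) :
    ZeroOut (3 * N) (fun w => l fun i => third (w i)) := by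
  intro w i h
  refine hl _ i ?_
  unfold _root_.third
  push_cast at h
  omega

/-- The labelling on the threefold subdivision with the walls of the boxes labelled by zero. -/
def walled {d n : ℕ} (l : (Fin d → ℤ) → (Fin n → ℤ)) (w : Fin d → ℤ) : Fin n → ℤ :=
  if ∃ i, (3 : ℤ) ∣ w i then 0 else l fun i => third (w i)

theorem ZeroOut.walled {d n N : ℕ} {l : (Fin d → ℤ) → (Fin n → ℤ)} (hl : ZeroOut N l) :
    ZeroOut (3 * N) (walled l) := by
  intro w i h
  unfold _root_.walled
  split_ifs
  · rfl
  · exact hl.third w i h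

theorem kcls_walled (hp : GenericPt p) {N : ℕ}
    {l : (Fin (k + 2) → ℤ) → (Fin (k + 3) → ℤ)} (hl : ZeroOut N l) :
    kcls hp (3 * N) (fun w => l fun i => third (w i)) = kcls hp (3 * N) (walled l) := by
  refine kcls_congr hp hl.third hl.walled fun y => ?_
  set c : LCube (Fin (k + 3) → ℤ) (k + 2) := fun ε => l fun i => third ((flr y + bz ε) i) with hc
  by_cases hcore : ∀ i, flr y i % 3 = 1
  · refine ⟨c '' carrier y, ?_, fun ε hε => ?_⟩
    · exact hp.avoids_of_ncard_le (Set.toFinite _) (ncard_image_chain_le (isChain_carrier y) _)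
    · have : ¬ ∃ i, (3 : ℤ) ∣ (flr y + bz ε) i := by
        rintro ⟨i, hi⟩
        have h1 := hcore i
        have h2 := bz_nonneg ε i
        have h3 := bz_le_one ε i
        rw [Pi.add_apply] at hi
        omega
      simp only [walled, this, if_false]
      exact ⟨⟨ε, hε, rfl⟩, ⟨ε, hε, rfl⟩⟩
  · push Not at hcore
    obtain ⟨i, hi⟩ := hcore
    refine ⟨insert 0 (c '' carrier y), ?_, fun ε hε => ⟨Or.inr ⟨ε, hε, rfl⟩, ?_⟩⟩
    · refine hp.avoids_insert_zero (Set.toFinite _) ?_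
      have := LCube.ncard_image_add_le (isChain_carrier y) {i} (c := c) (by
        intro ε _ ε' _ h
        rw [hc]
        dsimp only
        congr 1
        funext j
        by_cases hj : j = i
        · subst hj
          have h2 := bz_nonneg ε j
          have h3 := bz_le_one ε j
          have h2' := bz_nonneg ε' j
          have h3' := bz_le_one ε' j
          simp only [Pi.add_apply, third]
          omega
        · have := h j (by simpa using hj)
          simp [bz, this])
      simpa using this
    · unfold walled
      split_ifs
      · exact Or.inl rfl
      · exact Or.inr ⟨ε, hε, rfl⟩

/-- The loop of a labelling is the sum of the loops of its unit cubes. -/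
theorem kcls_eq_finsum (hp : GenericPt p) {N : ℕ} (hN : 1 ≤ N)
    {l : (Fin (k + 2) → ℤ) → (Fin (k + 3) → ℤ)} (hl : ZeroOut N l) :
    kcls hp N l = ∑ᶠ z, cubeCls hp (tile l z) := by
  rw [← kcls_third hp hN hl, kcls_walled hp hl]
  have h := cls_eq_finsum_boxes hp.zero_mem (g := fun y => kuhn (walled l) ((3 : ℝ) • y))
    (continuous_kuhn_smul _ _) (fun y => hp.kuhn_avoids _ _) ?_ hN ?_
  · have e : kcls hp (3 * N) (walled l) =
        cls hp.zero_mem (fun t => kuhn (walled l) ((3 : ℝ) • (N : ℝ) • t)) := by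
      unfold kcls
      congr 1
      funext t
      rw [smul_smul]
      push_cast
      rfl
    rw [e, h]
    refine finsum_congr fun z => ?_
    have e2 : ∀ t : Fin (k + 2) → ℝ, kuhn (walled l) ((3 : ℝ) • (toR z + t)) =
        kuhn (fun w => walled l (w + fun i => 3 * z i)) ((3 : ℝ) • t) := by
      intro t
      rw [← kuhn_add_int, smul_add, add_comm ((3 : ℝ) • toR z)]
      congr 2
      funext i
      simp [toR]
    simp only [e2]
    unfold cubeCls kcls
    have e3 : ∀ t ∈ Set.Icc (0 : Fin (k + 2) → ℝ) 1,
        kuhn (ext (tile l z)) ((3 : ℝ) • t) =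
          kuhn (fun w => walled l (w + fun i => 3 * z i)) ((3 : ℝ) • t) := by
      intro t ht
      refine kuhn_congr_label fun ε hε => ?_
      have hb : ∀ i, 0 ≤ (flr ((3 : ℝ) • t) + bz ε) i ∧ (flr ((3 : ℝ) • t) + bz ε) i ≤ 3 := by
        intro i
        have h1 : 0 ≤ t i := ht.1 i
        have h2 : t i ≤ 1 := ht.2 i
        refine ⟨le_carrier_vertex hε ?_, carrier_vertex_le hε ?_⟩
        · simp only [Pi.smul_apply, smul_eq_mul, Int.cast_zero]
          linarith
        · simp only [Pi.smul_apply, smul_eq_mul]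
          push_cast
          linarith
      generalize flr ((3 : ℝ) • t) + bz ε = w at hb
      by_cases hw : ∀ i, w i = 1 ∨ w i = 2
      · have hn : ¬ ∃ i, (3 : ℤ) ∣ (w + fun i => 3 * z i) i := by
          rintro ⟨i, hi⟩
          have := hw i
          simp only [Pi.add_apply] at hi
          omega
        simp only [ext, walled, hw, hn, if_true, if_false, implies_true, tile]
        congr 1
        funext i
        simp only [Pi.add_apply, bz, third, decide_eq_true_eq]
        have := hw i
        split_ifs <;> omega
      · have hn : ∃ i, (3 : ℤ) ∣ (w + fun i => 3 * z i) i := by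
          push Not at hw
          obtain ⟨i, hi⟩ := hw
          have := hb i
          refine ⟨i, ?_⟩
          simp only [Pi.add_apply]
          omega
        simp only [ext, walled, hw, hn, if_true, if_false]
    symm
    refine cls_congr _ ?_ ?_ ?_
    · have := (zeroOut_ext (tile l z)).isLoop hp
      exact_mod_cast this
    · exact continuous_kuhn_smul _ _
    · intro t ht
      exact_mod_cast e3 t ht
  · intro y i s hs
    rw [← toR_zero]
    refine kuhn_eq_const fun ε hε => if_pos ⟨i, ?_⟩
    have e : ((3 : ℝ) • y) i = ((3 * s : ℤ) : ℝ) := by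
      simp [hs]
    have h1 := carrier_vertex_le hε e.le
    have h2 := le_carrier_vertex hε e.ge
    exact ⟨s, le_antisymm h1 h2⟩
  · intro y i h
    refine hl.walled.kuhn_eq_zero (i := i) (h.imp (fun h => ?_) fun h => ?_)
    · simp only [Pi.smul_apply, smul_eq_mul]
      linarith
    · simp only [Pi.smul_apply, smul_eq_mul]
      push_cast
      linarith

end Subdivision

/-! ### The homotopy relation between the faces of a labelled cube -/

section Hat

open LCube

/-- The new coordinate used to interpolate between two opposite faces. -/
def hatKey {d : ℕ} (s : ℤ) (w : Fin d → ℤ) : Bool :=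
  decide ((∃ i, 4 ≤ w i) ∨ (1 ≤ s ∧ ∀ i, 2 ≤ w i))

/-- The vertex of the `(d + 1)`-cube assigned to a lattice point of the box of side `5`. -/
def hatVertex {d : ℕ} (s : ℤ) (w : Fin d → ℤ) : Fin (d + 1) → Bool :=
  Fin.cons (hatKey s w) fun i => decide (3 ≤ w i)

/-- The labelling of the box of side `5` given by a labelled `(d + 1)`-cube. -/
def hatLabel {d n : ℕ} (c : LCube (Fin n → ℤ) (d + 1)) (s : ℤ) (w : Fin d → ℤ) : Fin n → ℤ :=
  if ∀ i, 1 ≤ w i ∧ w i ≤ 4 then c (hatVertex s w) else 0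

theorem zeroOut_hatLabel {d n : ℕ} (c : LCube (Fin n → ℤ) (d + 1)) (s : ℤ) :
    ZeroOut 5 (hatLabel c s) := by
  intro w i h
  refine if_neg fun hw => ?_
  have := hw i
  push_cast at h
  omega

theorem hatVertex_mono {d : ℕ} {s s' : ℤ} {w w' : Fin d → ℤ} (hs : s ≤ s') (hw : ∀ i, w i ≤ w' i) :
    hatVertex s w ≤ hatVertex s' w' := by
  intro i
  refine Fin.cases ?_ (fun i => ?_) i
  · simp only [hatVertex, Fin.cons_zero, hatKey]
    rw [Bool.le_iff_imp]
    simp only [decide_eq_true_eq]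
    rintro (⟨i, hi⟩ | ⟨h1, h2⟩)
    · exact Or.inl ⟨i, hi.trans (hw i)⟩
    · exact Or.inr ⟨h1.trans hs, fun i => (h2 i).trans (hw i)⟩
  · simp only [hatVertex, Fin.cons_succ]
    rw [Bool.le_iff_imp]
    simp only [decide_eq_true_eq]
    exact fun h => h.trans (hw i)

theorem bz_mono {d : ℕ} {ε ε' : Fin d → Bool} (h : ε ≤ ε') (i : Fin d) : bz ε i ≤ bz ε' i := by
  have := h i
  unfold bz
  rw [Bool.le_iff_imp] at this
  split_ifs with h3 h4 <;> first | omega | (exact absurd (this h3) h4)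

variable {k : ℕ} {p : Fin (k + 3) → ℝ}

/-- The labelling of the prism over the box of side `5`. -/
def hatPrism {d n : ℕ} (c : LCube (Fin n → ℤ) (d + 1)) (w : Fin (d + 1) → ℤ) : Fin n → ℤ :=
  hatLabel c (w 0) (Fin.tail w)

theorem hatPrism_mem (hp : GenericPt p) {c : LCube (Fin (k + 3) → ℤ) (k + 3)}
    (hc : ∀ D : Set (Fin (k + 3) → Bool), IsChain (· ≤ ·) D → Avoids p (c '' D))
    (y : Fin (k + 3) → ℝ) : kuhn (hatPrism c) y ∈ Punct p := by
  set F : (Fin (k + 3) → Bool) → (Fin (k + 3) → Bool) := fun ε =>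
    hatVertex ((flr y + bz ε) 0) (Fin.tail (flr y + bz ε)) with hF
  have hFm : Monotone F := fun ε ε' h => hatVertex_mono (add_le_add_right (bz_mono h 0) _)
    fun i => add_le_add_right (bz_mono h i.succ) _
  suffices ∃ T, Avoids p T ∧ ∀ ε ∈ carrier y, hatPrism c (flr y + bz ε) ∈ T by
    obtain ⟨T, hT, h⟩ := this
    refine hT.subset (convexHull_mono (Set.image_mono ?_) (kuhn_mem _ y))
    rintro _ ⟨ε, hε, rfl⟩
    exact h ε hε
  by_cases hcore : ∀ i : Fin (k + 2), 1 ≤ flr y i.succ ∧ flr y i.succ ≤ 3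
  · refine ⟨_, hc _ (LCube.IsChain.image_mono (isChain_carrier y) hFm), fun ε hε => ?_⟩
    rw [hatPrism, hatLabel, if_pos]
    · exact ⟨_, ⟨ε, hε, rfl⟩, rfl⟩
    · intro i
      have := hcore i
      have := bz_nonneg ε i.succ
      have := bz_le_one ε i.succ
      simp only [Fin.tail, Pi.add_apply]
      omega
  · push Not at hcore
    obtain ⟨i, hi⟩ := hcore
    set D : Set (Fin (k + 3) → Bool) := carrier y ∩
      {ε | ∀ i : Fin (k + 2), 1 ≤ (flr y + bz ε) i.succ ∧ (flr y + bz ε) i.succ ≤ 4} with hD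
    have hconst : ∀ ε ∈ D, (flr y + bz ε) i.succ = if flr y i.succ ≤ 0 then 1 else 4 := by
      rintro ε ⟨-, hε⟩
      have h1 := hε i
      have := bz_nonneg ε i.succ
      have := bz_le_one ε i.succ
      simp only [Pi.add_apply] at h1 ⊢
      by_cases h : 1 ≤ flr y i.succ
      · have := hi h
        split_ifs <;> omega
      · split_ifs <;> omega
    refine ⟨insert 0 ((c ∘ F) '' D), hp.avoids_insert_zero (Set.toFinite _) ?_, fun ε hε => ?_⟩
    · have := LCube.ncard_image_add_le ((isChain_carrier y).mono Set.inter_subset_left)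
        {0, i.succ} (D := D) (c := c ∘ F) (by
        intro ε hε ε' hε' h
        have ht : Fin.tail (flr y + bz ε) = Fin.tail (flr y + bz ε') := by
          funext j
          simp only [Fin.tail]
          by_cases hj : j = i
          · subst hj
            rw [hconst ε hε, hconst ε' hε']
          · have := h j.succ (by simp [Fin.succ_ne_zero, hj])
            simp [bz, this]
        have hs : ∀ s s', hatKey s (Fin.tail (flr y + bz ε)) =
            hatKey s' (Fin.tail (flr y + bz ε)) := by
          intro s s'
          have hci := hconst ε hε
          have hci' : Fin.tail (flr y + bz ε) i = _ := hci
          unfold hatKey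
          split_ifs at hci' with h
          · have : ¬ ∀ i, 2 ≤ Fin.tail (flr y + bz ε) i := by
              intro hcon
              have := hcon i
              omega
            simp [this]
          · have : ∃ i, 4 ≤ Fin.tail (flr y + bz ε) i := ⟨i, hci'.ge⟩
            simp [this]
        simp only [Function.comp_apply, hF, hatVertex, ← ht]
        rw [hs])
      rw [Finset.card_pair (Fin.succ_ne_zero i).symm] at this
      omega
    · rw [hatPrism, hatLabel]
      split_ifs with h
      · exact Or.inr ⟨ε, ⟨hε, h⟩, rfl⟩
      · exact Or.inl rfl

theorem kcls_hatLabel (hp : GenericPt p) {c : LCube (Fin (k + 3) → ℤ) (k + 3)}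
    (hc : ∀ D : Set (Fin (k + 3) → Bool), IsChain (· ≤ ·) D → Avoids p (c '' D)) :
    kcls hp 5 (hatLabel c 0) = kcls hp 5 (hatLabel c 1) := by
  have hcast : ∀ (s : ℤ) (t : Fin (k + 2) → ℝ),
      kuhn (hatPrism c) (Fin.cons (s : ℝ) (((5 : ℕ) : ℝ) • t)) =
        kuhn (hatLabel c s) (((5 : ℕ) : ℝ) • t) := by
    intro s t
    rw [kuhn_cons]
    rfl
  refine cls_homotopy _ (fun s t => kuhn (hatPrism c) (Fin.cons s (((5 : ℕ) : ℝ) • t))) ?_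
    (fun _ _ _ _ => hatPrism_mem hp hc _) ?_ (continuous_kuhn_smul _ _) (continuous_kuhn_smul _ _)
    (fun t _ => by simpa using hcast 0 t) (fun t _ => by simpa using hcast 1 t)
  · refine (continuous_kuhn _).comp (continuous_pi fun i => ?_)
    refine Fin.cases ?_ (fun i => ?_) i
    · exact continuous_fst
    · exact continuous_const.mul ((continuous_apply i).comp continuous_snd)
  · rintro s - t - ⟨i, hi⟩
    rw [← toR_zero]
    refine kuhn_eq_const fun ε hε => zeroOut_hatLabel c _ _ i (hi.imp (fun h => ?_) fun h => ?_)
    · exact carrier_vertex_le (i := i.succ) hε (by simp [h])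
    · exact le_carrier_vertex (i := i.succ) hε (by simp [h])

theorem tile_hatLabel {d n : ℕ} (c : LCube (Fin n → ℤ) (d + 1)) (s : ℤ) {z : Fin d → ℤ}
    (hz : ∀ i, 1 ≤ z i ∧ z i ≤ 3) (ε : Fin d → Bool) :
    tile (hatLabel c s) z ε = c (hatVertex s (z + bz ε)) := by
  refine if_pos fun i => ?_
  have := hz i
  have := bz_nonneg ε i
  have := bz_le_one ε i
  simp only [Pi.add_apply]
  omega

theorem cubeCls_tile_hatLabel_of_out (hp : GenericPt p) (c : LCube (Fin (k + 3) → ℤ) (k + 3))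
    (s : ℤ) {z : Fin (k + 2) → ℤ} {i : Fin (k + 2)} (hi : ¬ (1 ≤ z i ∧ z i ≤ 3)) :
    cubeCls hp (tile (hatLabel c s) z) = 0 := by
  refine cubeCls_eq_zero_of_face hp i (decide (1 ≤ z i)) fun ε hε => ?_
  refine zeroOut_hatLabel c s _ i ?_
  simp only [Pi.add_apply, bz, hε, decide_eq_true_eq]
  push_cast
  split_ifs <;> omega

theorem cubeCls_tile_hatLabel_of_two (hp : GenericPt p) (c : LCube (Fin (k + 3) → ℤ) (k + 3))
    (s : ℤ) {z : Fin (k + 2) → ℤ} (hz : ∀ i, 1 ≤ z i ∧ z i ≤ 3) {i j : Fin (k + 2)} (hij : i ≠ j)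
    (hi : z i ≠ 2) (hj : z j ≠ 2) : cubeCls hp (tile (hatLabel c s) z) = 0 := by
  refine cubeCls_eq_zero_of_ncard hp fun D hD => ?_
  have hm : Monotone fun ε : Fin (k + 2) → Bool => hatVertex s (z + bz ε) :=
    fun ε ε' h => hatVertex_mono le_rfl fun i => add_le_add_right (bz_mono h i) _
  have hL := LCube.ncard_chain_add_le (LCube.IsChain.image_mono hD hm) {i.succ, j.succ} (by
    have key : ∀ l, z l ≠ 2 → ∀ ε ε' : Fin (k + 2) → Bool,
        hatVertex s (z + bz ε) l.succ = hatVertex s (z + bz ε') l.succ := by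
      intro l hl ε ε'
      have := hz l
      have := bz_nonneg ε l
      have := bz_le_one ε l
      have := bz_nonneg ε' l
      have := bz_le_one ε' l
      simp only [hatVertex, Fin.cons_succ, Pi.add_apply]
      rw [decide_eq_decide]
      omega
    rintro l hl _ ⟨ε, -, rfl⟩ _ ⟨ε', -, rfl⟩
    rcases Finset.mem_insert.mp hl with rfl | hl
    · exact key i hi _ _
    · rw [Finset.mem_singleton.mp hl]
      exact key j hj _ _)
  rw [Finset.card_pair (fun h => hij (Fin.succ_injective _ h))] at hL
  have e : tile (hatLabel c s) z '' D = c '' ((fun ε => hatVertex s (z + bz ε)) '' D) := by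
    rw [Set.image_image]
    exact Set.image_congr fun ε _ => tile_hatLabel c s hz ε
  rw [e]
  exact (Set.ncard_image_le (Set.toFinite _)).trans (by omega)

theorem cubeCls_tile_hatLabel_zero (hp : GenericPt p) (c : LCube (Fin (k + 3) → ℤ) (k + 3))
    {z : Fin (k + 2) → ℤ} (hz : ∀ i, 1 ≤ z i ∧ z i ≤ 3) {i : Fin (k + 2)} (hi : z i = 1) :
    cubeCls hp (tile (hatLabel c 0) z) = 0 := by
  refine cubeCls_eq_zero_of_indep hp i fun ε ε' h => ?_
  rw [tile_hatLabel c 0 hz, tile_hatLabel c 0 hz]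
  have key : ∀ b : ℤ, 3 ≤ b → ∀ j, b ≤ (z + bz ε) j ↔ b ≤ (z + bz ε') j := by
    intro b hb j
    by_cases hj : j = i
    · subst hj
      have := bz_le_one ε j
      have := bz_le_one ε' j
      simp only [Pi.add_apply]
      omega
    · simp [bz, h j hj]
  congr 1
  simp [hatVertex, hatKey, key 3 le_rfl, key 4 (by norm_num), -Pi.add_apply]

theorem cubeCls_tile_hatLabel_one (hp : GenericPt p) (c : LCube (Fin (k + 3) → ℤ) (k + 3))
    {z : Fin (k + 2) → ℤ} {i : Fin (k + 2)} (hi : z i = 3) (hz' : ∀ j, j ≠ i → z j = 2) :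
    cubeCls hp (tile (hatLabel c 1) z) = 0 := by
  have hz : ∀ j, 2 ≤ z j ∧ z j ≤ 3 := by
    intro j
    by_cases hj : j = i
    · subst hj
      omega
    · have := hz' j hj
      omega
  refine cubeCls_eq_zero_of_indep hp i fun ε ε' h => ?_
  rw [tile_hatLabel c 1 fun j => ⟨by linarith [(hz j).1], (hz j).2⟩,
    tile_hatLabel c 1 fun j => ⟨by linarith [(hz j).1], (hz j).2⟩]
  have key : ∀ j, 3 ≤ (z + bz ε) j ↔ 3 ≤ (z + bz ε') j := by
    intro j
    by_cases hj : j = i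
    · subst hj
      have := bz_nonneg ε j
      have := bz_nonneg ε' j
      simp only [Pi.add_apply]
      omega
    · simp [bz, h j hj]
  have key2 : ∀ (ε : Fin (k + 2) → Bool) j, 2 ≤ (z + bz ε) j := by
    intro ε j
    have := hz j
    have := bz_nonneg ε j
    simp only [Pi.add_apply]
    omega
  congr 1
  simp [hatVertex, hatKey, key, key2, -Pi.add_apply]

theorem finsum_eq_add_sum_update {A : Type*} [AddCommGroup A] {d : ℕ} {b : ℤ} (hb : b ≠ 2)
    {f : (Fin d → ℤ) → A}
    (hf : ∀ z, z ≠ (fun _ => 2) → (∀ i, z ≠ Function.update (fun _ => 2) i b) → f z = 0) :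
    ∑ᶠ z, f z = f (fun _ => 2) + ∑ i, f (Function.update (fun _ => 2) i b) := by
  set e : Option (Fin d) → (Fin d → ℤ) := fun o =>
    o.elim (fun _ => 2) fun i => Function.update (fun _ => 2) i b with he
  have hinj : Function.Injective e := by
    have h1 : ∀ i, e none ≠ e (some i) := by
      intro i h
      have := congrFun h i
      simp only [he, Option.elim, Function.update_self] at this
      exact hb this.symm
    rintro (_ | i) (_ | j) h
    · rfl
    · exact absurd h (h1 j)
    · exact absurd h.symm (h1 i)
    · by_contra hij
      have hij' : i ≠ j := fun h => hij (by rw [h])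
      have := congrFun h i
      simp only [he, Option.elim, Function.update_self, Function.update_of_ne hij'] at this
      exact hb this
  have h := finsum_mem_range (f := f) hinj
  rw [finsum_eq_sum_of_fintype (fun o => f (e o)), Fintype.sum_option] at h
  refine Eq.trans (finsum_congr fun z => ?_) h
  by_cases hz : z ∈ Set.range e
  · simp [hz]
  · simp only [hz, finsum_false]
    exact hf z (fun h => hz ⟨none, h.symm⟩) fun i h => hz ⟨some i, h.symm⟩

/-- The degenerate face of a labelled cube obtained by doubling a coordinate. -/
def LCube.side {V : Type*} {d : ℕ} (c : LCube V (d + 1)) (i : Fin d) (b : Bool) : LCube V d :=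
  fun t => c (Fin.cons (t i) (Function.update t i b))

theorem kcls_hatLabel_zero (hp : GenericPt p) (c : LCube (Fin (k + 3) → ℤ) (k + 3)) :
    kcls hp 5 (hatLabel c 0) = cubeCls hp (fun t => c (Fin.cons false t)) +
      ∑ i, cubeCls hp (side c i true) := by
  rw [kcls_eq_finsum hp (by norm_num) (zeroOut_hatLabel c 0),
    finsum_eq_add_sum_update (b := 3) (by norm_num)]
  · congr 2
    · funext ε
      rw [tile_hatLabel c 0 fun _ => by norm_num]
      congr 1
      funext j
      refine Fin.cases ?_ (fun j => ?_) j
      · simp only [hatVertex, Fin.cons_zero, hatKey, decide_eq_false_iff_not]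
        rintro (⟨i, hi⟩ | ⟨h, -⟩)
        · have := bz_le_one ε i
          simp only [Pi.add_apply] at hi
          omega
        · omega
      · simp only [hatVertex, Fin.cons_succ, bz, Pi.add_apply]
        by_cases hε : ε j = true <;> simp [hε]
    · funext i
      congr 1
      funext ε
      rw [tile_hatLabel c 0 fun j => by by_cases hj : j = i <;> simp [hj]]
      unfold side
      congr 1
      funext j
      refine Fin.cases ?_ (fun j => ?_) j
      · simp only [hatVertex, Fin.cons_zero, hatKey]
        rw [Bool.eq_iff_iff, decide_eq_true_eq]
        constructor
        · rintro (⟨j, hj⟩ | ⟨h, -⟩)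
          · by_cases hji : j = i
            · subst hji
              by_contra hcon
              simp [bz, hcon] at hj
            · have := bz_le_one ε j
              simp only [Pi.add_apply, Function.update_of_ne hji] at hj
              omega
          · omega
        · intro h
          exact Or.inl ⟨i, by simp [bz, h]⟩
      · simp only [hatVertex, Fin.cons_succ, bz, Pi.add_apply]
        by_cases hji : j = i
        · subst hji
          simp only [Function.update_self]
          split_ifs <;> simp
        · simp only [Function.update_of_ne hji]
          by_cases hε : ε j = true <;> simp [hε]
  · intro z h1 h2
    by_cases hz : ∀ i, 1 ≤ z i ∧ z i ≤ 3
    · by_cases h3 : ∃ i, z i = 1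
      · obtain ⟨i, hi⟩ := h3
        exact cubeCls_tile_hatLabel_zero hp c hz hi
      · push Not at h3
        obtain ⟨i, hi⟩ := Function.ne_iff.mp h1
        obtain ⟨j, hj⟩ := Function.ne_iff.mp (h2 i)
        have hji : j ≠ i := by
          rintro rfl
          rw [Function.update_self] at hj
          have := hz j
          have := h3 j
          omega
        rw [Function.update_of_ne hji] at hj
        exact cubeCls_tile_hatLabel_of_two hp c 0 hz hji hj hi
    · push Not at hz
      obtain ⟨i, hi⟩ := hz
      exact cubeCls_tile_hatLabel_of_out hp c 0 (i := i) fun h => by have := hi h.1; omega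

theorem kcls_hatLabel_one (hp : GenericPt p) (c : LCube (Fin (k + 3) → ℤ) (k + 3)) :
    kcls hp 5 (hatLabel c 1) = cubeCls hp (fun t => c (Fin.cons true t)) +
      ∑ i, cubeCls hp (side c i false) := by
  rw [kcls_eq_finsum hp (by norm_num) (zeroOut_hatLabel c 1),
    finsum_eq_add_sum_update (b := 1) (by norm_num)]
  · congr 2
    · funext ε
      rw [tile_hatLabel c 1 fun _ => by norm_num]
      congr 1
      funext j
      refine Fin.cases ?_ (fun j => ?_) j
      · simp only [hatVertex, Fin.cons_zero, hatKey, decide_eq_true_eq]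
        refine Or.inr ⟨le_rfl, fun i => ?_⟩
        have := bz_nonneg ε i
        simp only [Pi.add_apply]
        omega
      · simp only [hatVertex, Fin.cons_succ, bz, Pi.add_apply]
        by_cases hε : ε j = true <;> simp [hε]
    · funext i
      congr 1
      funext ε
      rw [tile_hatLabel c 1 fun j => by by_cases hj : j = i <;> simp [hj]]
      unfold side
      congr 1
      funext j
      refine Fin.cases ?_ (fun j => ?_) j
      · simp only [hatVertex, Fin.cons_zero, hatKey]
        rw [Bool.eq_iff_iff, decide_eq_true_eq]
        constructor
        · rintro (⟨j, hj⟩ | ⟨-, h⟩)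
          · have := bz_le_one ε j
            simp only [Pi.add_apply, Function.update_apply] at hj
            split_ifs at hj <;> omega
          · have := h i
            by_contra hcon
            simp [bz, hcon] at this
        · intro h
          refine Or.inr ⟨le_rfl, fun j => ?_⟩
          by_cases hji : j = i
          · subst hji
            simp [bz, h]
          · have := bz_nonneg ε j
            simp only [Pi.add_apply, Function.update_of_ne hji]
            omega
      · simp only [hatVertex, Fin.cons_succ, bz, Pi.add_apply]
        by_cases hji : j = i
        · subst hji
          simp only [Function.update_self]
          split_ifs <;> simp
        · simp only [Function.update_of_ne hji]
          by_cases hε : ε j = true <;> simp [hε]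
  · intro z h1 h2
    by_cases hz : ∀ i, 1 ≤ z i ∧ z i ≤ 3
    · obtain ⟨i, hi⟩ := Function.ne_iff.mp h1
      by_cases h3 : ∃ j, j ≠ i ∧ z j ≠ 2
      · obtain ⟨j, hji, hj⟩ := h3
        exact cubeCls_tile_hatLabel_of_two hp c 1 hz hji hj hi
      · push Not at h3
        refine cubeCls_tile_hatLabel_one hp c (i := i) ?_ h3
        have h4 := hz i
        by_contra h5
        refine h2 i (funext fun j => ?_)
        by_cases hji : j = i
        · subst hji
          rw [Function.update_self]
          omega
        · rw [Function.update_of_ne hji, h3 j hji]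
    · push Not at hz
      obtain ⟨i, hi⟩ := hz
      exact cubeCls_tile_hatLabel_of_out hp c 1 (i := i) fun h => by have := hi h.1; omega

/-- The alternating sum of the faces of a labelled cube whose chains avoid the removed points. -/
theorem sum_faces_eq_zero (hp : GenericPt p) {c : LCube (Fin (k + 3) → ℤ) (k + 3)}
    (hc : ∀ D : Set (Fin (k + 3) → Bool), IsChain (· ≤ ·) D → Avoids p (c '' D)) :
    cubeCls hp (fun t => c (Fin.cons true t)) + ∑ i, cubeCls hp (side c i false) =
      cubeCls hp (fun t => c (Fin.cons false t)) + ∑ i, cubeCls hp (side c i true) := by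
  rw [← kcls_hatLabel_one, ← kcls_hatLabel_zero, kcls_hatLabel hp hc]

end Hat

/-! ### The cubical coboundary of the class of a labelled cube -/

section Antisymmetry

open LCube

variable {k : ℕ} {p : Fin (k + 3) → ℝ}

theorem cubeCls_comp_eq_zero (hp : GenericPt p) (a : LCube (Fin (k + 3) → ℤ) (k + 2))
    {ψ : (Fin (k + 2) → Bool) → (Fin (k + 2) → Bool)} (hψ : Monotone ψ) (l : Fin (k + 2))
    (b : Bool) (hl : ∀ t, ψ t l = b) : cubeCls hp (fun t => a (ψ t)) = 0 := by
  refine cubeCls_eq_zero_of_ncard hp fun D hD => ?_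
  have h := LCube.ncard_chain_add_le (LCube.IsChain.image_mono hD hψ) {l} (by
    rintro i hi _ ⟨ε, -, rfl⟩ _ ⟨ε', -, rfl⟩
    rw [Finset.mem_singleton.mp hi, hl, hl])
  rw [Finset.card_singleton] at h
  have e : (fun t => a (ψ t)) '' D = a '' (ψ '' D) := by rw [Set.image_image]
  rw [e]
  exact (Set.ncard_image_le (Set.toFinite _)).trans (by omega)

theorem sum_faces_comp (hp : GenericPt p) (a : LCube (Fin (k + 3) → ℤ) (k + 2))
    {φ : (Fin (k + 3) → Bool) → (Fin (k + 2) → Bool)} (hφ : Monotone φ) :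
    cubeCls hp (fun t => a (φ (Fin.cons true t))) +
        ∑ i, cubeCls hp (side (fun t => a (φ t)) i false) =
      cubeCls hp (fun t => a (φ (Fin.cons false t))) +
        ∑ i, cubeCls hp (side (fun t => a (φ t)) i true) := by
  refine sum_faces_eq_zero hp (c := fun t => a (φ t)) fun D hD => ?_
  refine hp.avoids_of_ncard_le (Set.toFinite _) ?_
  have e : (fun t => a (φ t)) '' D = a '' (φ '' D) := by rw [Set.image_image]
  rw [e]
  exact ncard_image_chain_le (LCube.IsChain.image_mono hD hφ) a

/-- Replacing the coordinate `j` by its maximum with the coordinate `i`. -/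
def LCube.joinAt {d : ℕ} (i j : Fin d) (t : Fin d → Bool) : Fin d → Bool :=
  Function.update t j (t j || t i)

theorem monotone_side_vertex {d : ℕ} (i : Fin d) (b : Bool) :
    Monotone fun t : Fin d → Bool =>
      (Fin.cons (t i) (Function.update t i b) : Fin (d + 1) → Bool) := by
  intro t t' h l
  refine Fin.cases ?_ (fun l => ?_) l
  · exact h i
  · simp only [Fin.cons_succ, Function.update_apply]
    split_ifs
    · exact le_rfl
    · exact h l

theorem monotone_cons_vertex {d : ℕ} (b : Bool) :
    Monotone fun t : Fin d → Bool => (Fin.cons b t : Fin (d + 1) → Bool) := by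
  intro t t' h l
  refine Fin.cases ?_ (fun l => ?_) l
  · exact le_rfl
  · exact h l

theorem or_mono {a a' b b' : Bool} (h : a ≤ a') (h' : b ≤ b') : (a || b) ≤ (a' || b') := by
  revert h h'
  cases a <;> cases a' <;> cases b <;> cases b' <;> simp

theorem cubeCls_eq_add_joinAt (hp : GenericPt p) (a : LCube (Fin (k + 3) → ℤ) (k + 2))
    {i j : Fin (k + 2)} (hij : i ≠ j) :
    cubeCls hp a = cubeCls hp (fun t => a (joinAt i j t)) +
      cubeCls hp (fun t => a (joinAt j i t)) := by
  set φ : (Fin (k + 3) → Bool) → (Fin (k + 2) → Bool) := fun u l =>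
    if l = i ∨ l = j then (u l.succ || u 0) else u l.succ with hφ
  have hm : Monotone φ := by
    intro u u' h l
    simp only [hφ]
    split_ifs
    · exact or_mono (h _) (h _)
    · exact h _
  have h := sum_faces_comp hp a hm
  have h1 : cubeCls hp (fun t => a (φ (Fin.cons true t))) = 0 :=
    cubeCls_comp_eq_zero hp a (hm.comp (monotone_cons_vertex true)) i true fun t => by simp [hφ]
  have h2 : ∀ l, cubeCls hp (side (fun t => a (φ t)) l true) = 0 := fun l =>
    cubeCls_comp_eq_zero hp a (hm.comp (monotone_side_vertex l true)) l true fun t => by simp [hφ]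
  have h3 : ∀ l, l ≠ i → l ≠ j → cubeCls hp (side (fun t => a (φ t)) l false) = 0 := fun l hi hj =>
    cubeCls_comp_eq_zero hp a (hm.comp (monotone_side_vertex l false)) l false fun t => by
      simp [hφ, hi, hj]
  rw [h1, zero_add, Finset.sum_eq_zero (s := Finset.univ)
    (f := fun i => cubeCls hp (side (fun t => a (φ t)) i true)) fun l _ => h2 l, add_zero,
    Fintype.sum_eq_add i j hij fun l hl => h3 l hl.1 hl.2] at h
  convert h.symm using 1
  · congr 1
    funext t
    congr 1
    funext l
    simp [hφ]
  · congr 1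
    · congr 1
      funext t
      unfold side joinAt
      congr 1
      funext l
      simp only [hφ, Fin.cons_succ, Fin.cons_zero, Function.update_apply]
      by_cases hli : l = i
      · subst hli
        simp [hij]
      · by_cases hlj : l = j
        · subst hlj
          simp [hli]
        · simp [hli, hlj]
    · congr 1
      funext t
      unfold side joinAt
      congr 1
      funext l
      simp only [hφ, Fin.cons_succ, Fin.cons_zero, Function.update_apply]
      by_cases hli : l = i
      · subst hli
        simp [hij]
      · by_cases hlj : l = j
        · subst hlj
          simp [hli]
        · simp [hli, hlj]

theorem cubeCls_joinAt_add (hp : GenericPt p) (a : LCube (Fin (k + 3) → ℤ) (k + 2))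
    {i j : Fin (k + 2)} (hij : i ≠ j) :
    cubeCls hp (fun t => a (joinAt i j t)) +
      cubeCls hp (fun t => a (joinAt i j (t ∘ Equiv.swap i j))) = 0 := by
  set φ : (Fin (k + 3) → Bool) → (Fin (k + 2) → Bool) := fun u l =>
    if l = i then u 0 else if l = j then (u j.succ || (u i.succ || u 0)) else u l.succ with hφ
  have hm : Monotone φ := by
    intro u u' h l
    simp only [hφ]
    split_ifs
    · exact h _
    · exact or_mono (h _) (or_mono (h _) (h _))
    · exact h _
  have h := sum_faces_comp hp a hm
  have h1 : ∀ b, cubeCls hp (fun t => a (φ (Fin.cons b t))) = 0 := fun b =>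
    cubeCls_comp_eq_zero hp a (hm.comp (monotone_cons_vertex b)) i b fun t => by simp [hφ]
  have h3 : ∀ l b, l ≠ i → l ≠ j → cubeCls hp (side (fun t => a (φ t)) l b) = 0 :=
    fun l b hi hj =>
    cubeCls_comp_eq_zero hp a (hm.comp (monotone_side_vertex l b)) l b fun t => by
      simp [hφ, hi, hj]
  have h4 : cubeCls hp (side (fun t => a (φ t)) i true) = 0 :=
    cubeCls_comp_eq_zero hp a (hm.comp (monotone_side_vertex i true)) j true fun t => by
      simp [hφ, hij.symm]
  have h5 : cubeCls hp (side (fun t => a (φ t)) j true) = 0 :=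
    cubeCls_comp_eq_zero hp a (hm.comp (monotone_side_vertex j true)) j true fun t => by
      simp [hφ, hij.symm]
  rw [h1, h1, zero_add, zero_add, Fintype.sum_eq_add i j hij fun l hl => h3 l _ hl.1 hl.2,
    Fintype.sum_eq_add i j hij fun l hl => h3 l _ hl.1 hl.2, h4, h5, add_zero] at h
  convert h using 2
  · congr 1
    funext t
    unfold side joinAt
    congr 1
    funext l
    simp only [hφ, Fin.cons_succ, Fin.cons_zero, Function.update_apply]
    by_cases hli : l = i
    · subst hli
      simp [hij]
    · by_cases hlj : l = j
      · subst hlj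
        simp [hli]
      · simp [hli, hlj]
  · congr 1
    funext t
    unfold side joinAt
    congr 1
    funext l
    simp only [hφ, Fin.cons_succ, Fin.cons_zero, Function.update_apply, Function.comp_apply]
    by_cases hli : l = i
    · subst hli
      simp [hij]
    · by_cases hlj : l = j
      · subst hlj
        simp [hli, Ne.symm hli]
      · simp [hli, hlj, Equiv.swap_apply_of_ne_of_ne hli hlj]

theorem cubeCls_comp_swap (hp : GenericPt p) (a : LCube (Fin (k + 3) → ℤ) (k + 2))
    {i j : Fin (k + 2)} (hij : i ≠ j) :
    cubeCls hp (fun t => a (t ∘ Equiv.swap i j)) = - cubeCls hp a := by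
  have key : ∀ {i j : Fin (k + 2)}, i ≠ j → ∀ t : Fin (k + 2) → Bool,
      joinAt i j t ∘ Equiv.swap i j = joinAt j i (t ∘ Equiv.swap i j) := by
    intro i j hij t
    funext l
    simp only [joinAt, Function.comp_apply, Function.update_apply]
    by_cases hli : l = i
    · subst hli
      simp
    · by_cases hlj : l = j
      · subst hlj
        simp [hli, hij]
      · simp [hli, hlj, Equiv.swap_apply_of_ne_of_ne hli hlj]
  have h1 := cubeCls_eq_add_joinAt hp (fun t => a (t ∘ Equiv.swap i j)) hij
  have h2 := cubeCls_eq_add_joinAt hp a hij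
  have h3 := cubeCls_joinAt_add hp a hij
  have h4 := cubeCls_joinAt_add hp a hij.symm
  have k1 := fun t => key hij t
  have k2 := fun t => key hij.symm t
  simp only [Equiv.swap_comm j i] at k2 h4
  simp only [k1, k2] at h1
  rw [h1, h2, eq_neg_of_add_eq_zero_right h3, eq_neg_of_add_eq_zero_right h4]
  abel

theorem cubeCls_comp_perm (hp : GenericPt p) (π : Equiv.Perm (Fin (k + 2))) :
    ∀ a : LCube (Fin (k + 3) → ℤ) (k + 2), cubeCls hp (fun t => a (t ∘ π)) =
      (Equiv.Perm.sign π : ℤ) • cubeCls hp a := by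
  induction π using Equiv.Perm.swap_induction_on with
  | one =>
    intro a
    simp
  | swap_mul f x y hxy ih =>
    intro a
    have e : (fun t : Fin (k + 2) → Bool => a (t ∘ ⇑(Equiv.swap x y * f))) =
        fun t => (fun t => a (t ∘ f)) (t ∘ Equiv.swap x y) := rfl
    rw [e]
    refine (cubeCls_comp_swap hp (fun t => a (t ∘ f)) hxy).trans ?_
    rw [ih]
    simp [Equiv.Perm.sign_swap hxy]

theorem cubeCls_side (hp : GenericPt p) (c : LCube (Fin (k + 3) → ℤ) (k + 3)) (i : Fin (k + 2))
    (b : Bool) : cubeCls hp (side c i b) = (-1 : ℤ) ^ (i : ℕ) • cubeCls hp (face i.succ b c) := by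
  have e : side c i b = fun t => face i.succ b c (t ∘ i.cycleRange.symm) := by
    funext t
    unfold side face
    congr 1
    symm
    rw [Fin.insertNth_eq_iff]
    refine ⟨by simp, ?_⟩
    funext l
    simp only [Function.comp_apply, Fin.removeNth]
    refine Fin.cases ?_ (fun l => ?_) l
    · simp [Fin.cycleRange_symm_zero]
    · simp [Fin.cycleRange_symm_succ, Fin.succAbove_ne]
  rw [e, cubeCls_comp_perm]
  congr 1
  rw [Equiv.Perm.sign_symm, Fin.sign_cycleRange]
  simp

theorem LCube.face_zero {V : Type*} {d : ℕ} (b : Bool) (c : LCube V (d + 1)) :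
    face 0 b c = fun t => c (Fin.cons b t) := by
  funext t
  simp [face]

theorem cob_cubeCls_eq (hp : GenericPt p) (c : LCube (Fin (k + 3) → ℤ) (k + 3)) :
    cob (cubeCls hp) c = kcls hp 5 (hatLabel c 1) - kcls hp 5 (hatLabel c 0) := by
  rw [kcls_hatLabel_one, kcls_hatLabel_zero, cob, Fin.sum_univ_succ]
  simp only [cubeCls_side]
  rw [add_sub_add_comm, ← Finset.sum_sub_distrib]
  congr 1
  · simp only [face_zero, Fin.val_zero, pow_zero, one_smul]
  · refine Finset.sum_congr rfl fun i _ => ?_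
    rw [Fin.val_succ, pow_succ, ← smul_sub, mul_smul]
    simp

theorem cob_cubeCls_eq_zero (hp : GenericPt p) {c : LCube (Fin (k + 3) → ℤ) (k + 3)}
    (hc : ∀ D : Set (Fin (k + 3) → Bool), IsChain (· ≤ ·) D → Avoids p (c '' D)) :
    cob (cubeCls hp) c = 0 := by
  rw [cob_cubeCls_eq, kcls_hatLabel hp hc, sub_self]

end Antisymmetry

/-! ### Generators of the image of the homotopy group of the skeleton -/

section Generators

open LCube

variable {k : ℕ} {p : Fin (k + 3) → ℝ}

theorem LCube.cob_map {V W A B : Type*} [AddCommGroup A] [AddCommGroup B] {d : ℕ} (f : A →+ B)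
    (g : V → W) (U : LCube W d → A) (C : LCube V (d + 1)) :
    cob (fun c => f (U fun t => g (c t))) C = f (cob U fun t => g (C t)) := by
  simp only [cob, map_sum, map_zsmul, map_sub]
  rfl

/-- The class of the boundary of a simplex of the unit cube with lowest corner `z`. -/
noncomputable def bdryCls (hp : GenericPt p) (z : Fin (k + 3) → ℤ) : PiGrp k hp.zero_mem :=
  cob (cubeCls hp) fun t => z + bz (leadC (k + 3) LCube.stair t)

theorem cob_cubeCls_mem (hp : GenericPt p) (z : Fin (k + 3) → ℤ)
    (c : LCube (Fin (k + 3) → Bool) (k + 3)) :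
    cob (cubeCls hp) (fun t => z + bz (c t)) ∈
      AddSubgroup.closure (Set.range (bdryCls hp)) := by
  let H := AddSubgroup.closure (Set.range (bdryCls hp))
  let U : LCube (Fin (k + 3) → Bool) (k + 3) → PiGrp k hp.zero_mem ⧸ H := fun c =>
    QuotientAddGroup.mk' H (cob (cubeCls hp) fun t => z + bz (c t))
  refine (QuotientAddGroup.eq_zero_iff (N := H) _).mp ?_
  refine eq_zero_of_colour (U := U) ?_ ?_ LCube.top ?_ LCube.stair GenericPt.top_stair ?_ c
  · intro C
    refine (LCube.cob_map (QuotientAddGroup.mk' H) (fun ε => z + bz ε)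
      (cob (cubeCls hp)) C).trans ?_
    rw [cob_cob, map_zero]
  · intro c hc
    have h : cob (cubeCls hp) (fun t => z + bz (c t)) = 0 := by
      refine cob_cubeCls_eq_zero hp fun D hD => hp.avoids_of_ncard_le (Set.toFinite _) ?_
      have e : (fun t => z + bz (c t)) '' D = (fun ε => z + bz ε) '' (c '' D) := by
        rw [Set.image_image]
      rw [e]
      exact (Set.ncard_image_le (Set.toFinite _)).trans (hc D hD)
    simp only [U, h, map_zero]
  · intro c j hj
    have h : cob (cubeCls hp) (fun t => z + bz (c t)) = 0 := by
      refine cob_cubeCls_eq_zero hp fun D hD => ?_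
      have e : (fun t => z + bz (c t)) '' D = (fun ε => z + bz ε) '' (c '' D) := by
        rw [Set.image_image]
      rw [e]
      refine hp.avoids_of_missing z (j := j) ?_
      rintro _ ⟨t, -, rfl⟩
      exact hj t
    simp only [U, h, map_zero]
  · exact (QuotientAddGroup.eq_zero_iff (N := H) _).mpr
      (AddSubgroup.subset_closure (Set.mem_range_self z))

/-- The labels of a labelled cube lie in a unit cube of the lattice. -/
theorem cob_cubeCls_mem_of_box (hp : GenericPt p) (C : LCube (Fin (k + 3) → ℤ) (k + 3))
    (r : Fin (k + 3) → ℤ) (h : ∀ t j, C t j = r j ∨ C t j = r j + 1) :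
    cob (cubeCls hp) C ∈ AddSubgroup.closure (Set.range (bdryCls hp)) := by
  have e : C = fun t => r + bz ((fun t j => decide (C t j = r j + 1)) t) := by
    funext t j
    rcases h t j with h | h <;> simp [bz, h]
  rw [e]
  exact cob_cubeCls_mem hp r _

/-- Coordinatewise truncation of an integer vector. -/
def truncVec {n : ℕ} (K : ℕ) (v : Fin n → ℤ) : Fin n → ℤ := fun j => max (-K) (min K (v j))

theorem truncVec_zero_right {n : ℕ} (K : ℕ) : truncVec K (0 : Fin n → ℤ) = 0 := by
  funext j
  simp [truncVec]

theorem kcls_mem (hp : GenericPt p) {N : ℕ} (hN : 1 ≤ N)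
    {l : (Fin (k + 2) → ℤ) → (Fin (k + 3) → ℤ)} (hl : ZeroOut N l)
    (h : ∀ z, ∃ r : Fin (k + 3) → ℤ, ∀ ε j, tile l z ε j = r j ∨ tile l z ε j = r j + 1) :
    kcls hp N l ∈ AddSubgroup.closure (Set.range (bdryCls hp)) := by
  have hbox : {w | l w ≠ 0}.Finite := by
    refine (Set.finite_Icc (0 : Fin (k + 2) → ℤ) (fun _ => (N : ℤ))).subset fun w hw => ?_
    constructor <;> intro i <;> by_contra hcon <;> refine hw (hl w i ?_)
    · exact Or.inl (by simpa using (not_le.mp hcon).le)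
    · exact Or.inr (not_le.mp hcon).le
  have hE : cubeCls hp (fun _ => 0) = 0 := cubeCls_eq_zero_of_face hp 0 true fun _ _ => rfl
  have key : ∀ K : ℕ, ∑ᶠ z, cubeCls hp (tile (fun w => truncVec K (l w)) z) ∈
      AddSubgroup.closure (Set.range (bdryCls hp)) := by
    intro K
    induction K with
    | zero =>
      have e : ∀ z, tile (fun w => truncVec 0 (l w)) z = fun _ => 0 := by
        intro z
        funext ε j
        simp only [tile, truncVec, Pi.zero_apply]
        omega
      simp only [e, hE, finsum_zero]
      exact zero_mem _
    | succ K ih =>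
      have hst := finsum_tile_sub (cubeCls hp) 0 hE (fun w => truncVec K (l w))
        (fun w => truncVec (K + 1) (l w)) (hbox.subset fun w hw h0 => hw (by
          simp [h0, truncVec_zero_right]))
      rw [sub_eq_iff_eq_add] at hst
      rw [hst]
      refine add_mem (finsum_induction (· ∈ AddSubgroup.closure (Set.range (bdryCls hp)))
        (zero_mem _) (fun _ _ => add_mem) fun z => ?_) ih
      obtain ⟨r, hr⟩ := h z
      refine cob_cubeCls_mem_of_box hp _
        (fun j => max (-(K + 1)) (min K (r j))) fun t j => ?_
      have := hr (Fin.tail t) j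
      simp only [tile] at this
      simp only [prism]
      split_ifs <;> simp only [truncVec] <;> push_cast <;> omega
  obtain ⟨K, hK⟩ : ∃ K : ℕ, ∀ w, truncVec K (l w) = l w := by
    obtain ⟨K, hK⟩ : ∃ K : ℕ, ∀ w ∈ {w | l w ≠ 0}, ∀ j, (l w j).natAbs ≤ K := by
      refine ⟨∑ w ∈ hbox.toFinset, ∑ j, (l w j).natAbs, fun w hw j => ?_⟩
      refine (Finset.single_le_sum (f := fun j => (l w j).natAbs) (fun _ _ => Nat.zero_le _)
        (Finset.mem_univ j)).trans ?_
      exact Finset.single_le_sum (f := fun w => ∑ j, (l w j).natAbs) (fun _ _ => Nat.zero_le _)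
        (hbox.mem_toFinset.mpr hw)
    refine ⟨K, fun w => ?_⟩
    by_cases hw : l w = 0
    · rw [hw, truncVec_zero_right]
    · funext j
      have := hK w hw j
      simp only [truncVec]
      omega
  have := key K
  simp only [hK] at this
  rwa [kcls_eq_finsum hp hN hl]

/-- The nearest point of the unit cube. -/
noncomputable def clampI {m : ℕ} (y : Fin m → ℝ) : Fin m → ℝ := fun i => max 0 (min 1 (y i))

theorem clampI_mem {m : ℕ} (y : Fin m → ℝ) : clampI y ∈ Set.Icc (0 : Fin m → ℝ) 1 :=
  ⟨fun _ => le_max_left _ _, fun _ => max_le zero_le_one (min_le_left _ _)⟩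

theorem clampI_of_mem {m : ℕ} {y : Fin m → ℝ} (hy : y ∈ Set.Icc (0 : Fin m → ℝ) 1) :
    clampI y = y := by
  funext i
  have h1 := hy.1 i
  have h2 := hy.2 i
  simp only [Pi.zero_apply, Pi.one_apply] at h1 h2
  simp [clampI, h1, h2]

theorem abs_clampI_sub_le {m : ℕ} (y y' : Fin m → ℝ) (i : Fin m) :
    |clampI y i - clampI y' i| ≤ |y i - y' i| := by
  have h1 := abs_max_sub_max_le_max (0 : ℝ) (min 1 (y i)) 0 (min 1 (y' i))
  have h2 := abs_min_sub_min_le_max (1 : ℝ) (y i) 1 (y' i)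
  simp only [sub_self, abs_zero, abs_nonneg, sup_of_le_right] at h1 h2
  exact h1.trans h2

theorem onBdry_clampI {m : ℕ} {y : Fin m → ℝ} {i : Fin m} (h : y i ≤ 0 ∨ 1 ≤ y i) :
    OnBdry (clampI y) := by
  refine ⟨i, h.imp (fun h => ?_) (fun h => ?_)⟩
  · simp [clampI, h]
  · simp [clampI, h]

theorem exists_modulus {m n : ℕ} {f : (Fin m → ℝ) → (Fin n → ℝ)} (hf : Continuous f) {η : ℝ}
    (hη : 0 < η) : ∃ δ > 0, ∀ y y' : Fin m → ℝ, (∀ i, |y i - y' i| < δ) →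
      ∀ j, |f (clampI y) j - f (clampI y') j| < η := by
  have hu := (isCompact_Icc (a := (0 : Fin m → ℝ)) (b := 1)).uniformContinuousOn_of_continuous
    hf.continuousOn
  obtain ⟨δ, hδ, h⟩ := Metric.uniformContinuousOn_iff.mp hu η hη
  refine ⟨δ, hδ, fun y y' hy j => ?_⟩
  have h1 : dist (clampI y) (clampI y') < δ := by
    rw [dist_pi_lt_iff hδ]
    intro i
    rw [Real.dist_eq]
    exact (abs_clampI_sub_le y y' i).trans_lt (hy i)
  have h2 := (dist_pi_lt_iff hη).mp (h _ (clampI_mem y) _ (clampI_mem y') h1) j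
  rwa [Real.dist_eq] at h2

theorem GenericPt.subset_punct {n : ℕ} {p : Fin n → ℝ} (hp : GenericPt p) :
    {x : Fin n → ℝ | ∃ j, ∃ s : ℤ, x j = (s : ℝ)} ⊆ Punct p := by
  rintro x ⟨j, s, hs⟩ z rfl
  have h1 := hp.pos j
  have h2 := hp.lt_one j
  simp only [Pi.add_apply, toR] at hs
  have h3 : (z j : ℝ) < s := by linarith
  have h4 : (s : ℝ) < z j + 1 := by linarith
  norm_cast at h3 h4
  omega

theorem round_eq_of_abs_lt {a : ℝ} {s : ℤ} (h : |a - s| < 1 / 2) : round a = s := by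
  rw [abs_lt] at h
  rw [round_eq, Int.floor_eq_iff]
  constructor <;> linarith

theorem cls_mem_closure (hp : GenericPt p) {f : (Fin (k + 2) → ℝ) → (Fin (k + 3) → ℝ)}
    (hf : IsLoop {x | ∃ j, ∃ s : ℤ, x j = (s : ℝ)} f) :
    cls hp.zero_mem f ∈ AddSubgroup.closure (Set.range (bdryCls hp)) := by
  obtain ⟨δ, hδ, hmod⟩ := exists_modulus hf.cont (η := 1 / 4) (by norm_num)
  obtain ⟨N, hN⟩ := exists_nat_one_div_lt hδ
  have hNpos : (0 : ℝ) < (N + 1 : ℕ) := by positivity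
  let v : (Fin (k + 2) → ℤ) → (Fin (k + 2) → ℝ) := fun w i => (w i : ℝ) / (N + 1 : ℕ)
  let l : (Fin (k + 2) → ℤ) → (Fin (k + 3) → ℤ) := fun w j => round (f (clampI (v w)) j)
  have hl : ZeroOut (N + 1) l := by
    intro w i hi
    have : f (clampI (v w)) = 0 := by
      refine hf.bdry _ (clampI_mem _) (onBdry_clampI (i := i) (hi.imp (fun h => ?_) fun h => ?_))
      · exact div_nonpos_of_nonpos_of_nonneg (by exact_mod_cast h) hNpos.le
      · rw [one_le_div hNpos]
        exact_mod_cast h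
    funext j
    simp only [l, this, Pi.zero_apply, round_zero]
  have hclose : ∀ t : Fin (k + 2) → ℝ, ∀ ε : Fin (k + 2) → Bool, ∀ j,
      |f (clampI (v (flr (((N + 1 : ℕ) : ℝ) • t) + bz ε))) j - f (clampI t) j| < 1 / 4 ∨
        ε ∉ carrier (((N + 1 : ℕ) : ℝ) • t) := by
    intro t ε j
    by_cases hε : ε ∈ carrier (((N + 1 : ℕ) : ℝ) • t)
    · refine Or.inl (hmod _ _ (fun i => ?_) j)
      have h3 : |((flr (((N + 1 : ℕ) : ℝ) • t) + bz ε) i : ℝ) - ((N + 1 : ℕ) : ℝ) * t i| < 1 := by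
        obtain ⟨θ, hθ, rfl⟩ := hε
        rw [← ceil_sub_eq_flr hθ]
        simp only [Pi.smul_apply, smul_eq_mul]
        have h1 := Int.le_ceil (((N + 1 : ℕ) : ℝ) * t i - θ)
        have h2 := Int.ceil_lt_add_one (((N + 1 : ℕ) : ℝ) * t i - θ)
        rw [abs_lt]
        constructor <;> linarith [hθ.1, hθ.2]
      have e : v (flr (((N + 1 : ℕ) : ℝ) • t) + bz ε) i - t i =
          (((flr (((N + 1 : ℕ) : ℝ) • t) + bz ε) i : ℝ) - ((N + 1 : ℕ) : ℝ) * t i) /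
            (N + 1 : ℕ) := by
        simp only [v]
        field_simp
      rw [e, abs_div, abs_of_pos hNpos]
      refine lt_trans (div_lt_div_of_pos_right h3 hNpos) ?_
      exact_mod_cast hN
    · exact Or.inr hε
  have e : cls hp.zero_mem f = kcls hp (N + 1) l := by
    refine cls_segment hp.zero_mem hf.cont (continuous_kuhn_smul _ _) hf.bdry
      (fun t _ h => hl.kuhn_bdry h) fun t ht => ?_
    obtain ⟨j, s, hs⟩ := hf.mem t ht
    have hk : kuhn l (((N + 1 : ℕ) : ℝ) • t) j = s := by
      have h0 : kuhn l (((N + 1 : ℕ) : ℝ) • t) ∈ {x : Fin (k + 3) → ℝ | x j = (s : ℝ)} := by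
        refine convexHull_min ?_ ?_ (kuhn_mem l _)
        · rintro _ ⟨_, ⟨ε, hε, rfl⟩, rfl⟩
          have h1 := (hclose t ε j).resolve_right (not_not.mpr hε)
          rw [clampI_of_mem ht, hs] at h1
          simp only [Set.mem_ofPred_eq, toR, l]
          exact_mod_cast round_eq_of_abs_lt (h1.trans (by norm_num))
        · intro x hx y hy a b ha hb hab
          simp only [Set.mem_ofPred_eq, Pi.add_apply, Pi.smul_apply, smul_eq_mul] at hx hy ⊢
          rw [hx, hy, ← add_mul, hab, one_mul]
      exact h0
    rintro _ ⟨a, b, ha, hb, hab, rfl⟩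
    refine hp.subset_punct ⟨j, s, ?_⟩
    simp only [Pi.add_apply, Pi.smul_apply, smul_eq_mul, hs, hk]
    rw [← add_mul, hab, one_mul]
  rw [e]
  refine kcls_mem hp (Nat.succ_pos N) hl fun z => ?_
  refine ⟨fun j => ⌊f (clampI (v z)) j + 1 / 4⌋, fun ε j => ?_⟩
  have h1 := hmod (v (z + bz ε)) (v z) (fun i => by
    have e : v (z + bz ε) i - v z i = (bz ε i : ℝ) / (N + 1 : ℕ) := by
      simp only [v, Pi.add_apply]
      push_cast
      ring
    have h0 : (0 : ℝ) ≤ bz ε i := by exact_mod_cast bz_nonneg ε i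
    have h1 : (bz ε i : ℝ) ≤ 1 := by exact_mod_cast bz_le_one ε i
    rw [e, abs_of_nonneg (by positivity)]
    refine lt_of_le_of_lt (div_le_div_of_nonneg_right h1 hNpos.le) ?_
    exact_mod_cast hN) j
  rw [abs_lt] at h1
  simp only [tile, l, round_eq]
  have h2 : ⌊f (clampI (v z)) j + 1 / 4⌋ ≤ ⌊f (clampI (v (z + bz ε))) j + 1 / 2⌋ :=
    Int.floor_le_floor (by linarith)
  have h3 : ⌊f (clampI (v (z + bz ε))) j + 1 / 2⌋ ≤ ⌊f (clampI (v z)) j + 1 / 4 + 1⌋ :=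
    Int.floor_le_floor (by linarith)
  rw [Int.floor_add_one] at h3
  omega

end Generators

/-! ### A cubical degree -/

section Degree

open LCube

/-- The top cubical cocycle built from functions `s 0, …, s (d - 1)` on the labels. -/
def LCube.cocyc {V : Type*} : (d : ℕ) → (ℕ → V → ℤ) → LCube V d → ℤ
  | 0, _, _ => 1
  | d + 1, s, c => cob (fun c' => s 0 (c' fun _ => false) * cocyc d (fun i => s (i + 1)) c') c

/-- A cochain with coboundary `LCube.cocyc`. -/
def LCube.primit {V : Type*} (d : ℕ) (s : ℕ → V → ℤ) (c : LCube V d) : ℤ :=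
  s 0 (c fun _ => false) * cocyc d (fun i => s (i + 1)) c

namespace LCube

variable {V : Type*} {d : ℕ}

theorem cob_primit (s : ℕ → V → ℤ) (c : LCube V (d + 1)) :
    cob (primit d s) c = cocyc (d + 1) s c := rfl

theorem cob_cocyc : ∀ (d : ℕ) (s : ℕ → V → ℤ) (c : LCube V (d + 1)), cob (cocyc d s) c = 0
  | 0, s, c => by simp [cob, cocyc]
  | d + 1, s, c => cob_cob _ c

theorem face_false_bot (i : Fin (d + 1)) (c : LCube V (d + 1)) :
    face i false c (fun _ => false) = c fun _ => false := by
  unfold face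
  congr 1
  rw [Fin.insertNth_eq_iff]
  exact ⟨rfl, rfl⟩

theorem cocyc_succ (s : ℕ → V → ℤ) (c : LCube V (d + 1)) :
    cocyc (d + 1) s c = ∑ i : Fin (d + 1), (-1 : ℤ) ^ (i : ℕ) *
      ((s 0 (face i true c fun _ => false) - s 0 (c fun _ => false)) *
        cocyc d (fun i => s (i + 1)) (face i true c)) := by
  have h := cob_cocyc d (fun i => s (i + 1)) c
  rw [← sub_eq_zero, ← mul_zero (s 0 (c fun _ => false)), ← h, cocyc, cob, cob, Finset.mul_sum,
    ← Finset.sum_sub_distrib]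
  refine Finset.sum_congr rfl fun i _ => ?_
  rw [face_false_bot]
  simp only [smul_eq_mul]
  ring

theorem cocyc_eq_zero : ∀ {d : ℕ} {s : ℕ → V → ℤ} {c : LCube V d} {i : ℕ}, i < d →
    (∀ t t', s i (c t) = s i (c t')) → cocyc d s c = 0
  | 0, _, _, _, hi, _ => absurd hi (Nat.not_lt_zero _)
  | d + 1, s, c, 0, _, h => by
    rw [cocyc_succ]
    refine Finset.sum_eq_zero fun i _ => ?_
    simp only [face]
    rw [h _ (fun _ => false), sub_self, zero_mul, mul_zero]
  | d + 1, s, c, i + 1, hi, h => by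
    have h0 : ∀ (l : Fin (d + 1)) (b : Bool), cocyc d (fun i => s (i + 1)) (face l b c) = 0 :=
      fun l b => cocyc_eq_zero (i := i) (by omega) fun t t' => h _ _
    rw [cocyc, cob]
    exact Finset.sum_eq_zero fun l _ => by simp [h0]

theorem cocyc_eq_one : ∀ {d : ℕ} {s : ℕ → V → ℤ} {c : LCube V d},
    (∀ (i : Fin d) t, s i (c t) = if t i then 1 else 0) → cocyc d s c = 1
  | 0, _, _, _ => rfl
  | d + 1, s, c, h => by
    have h1 : cocyc d (fun i => s (i + 1)) (face 0 true c) = 1 := cocyc_eq_one fun i t => by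
      have := h i.succ (Fin.cons true t)
      simpa [face] using this
    have h2 : ∀ i : Fin (d + 1), s 0 (face i true c fun _ => false) =
        if (Fin.insertNth (α := fun _ => Bool) i true fun _ => false) 0 then 1 else 0 :=
      fun i => h 0 _
    rw [cocyc_succ, Fin.sum_univ_succ, h1, Finset.sum_eq_zero]
    · have h3 := h 0 fun _ => false
      simp only [Fin.val_zero] at h3
      rw [h2, h3]
      simp
    · intro i _
      have h3 := h 0 fun _ => false
      simp only [Fin.val_zero] at h3
      have e : (Fin.insertNth (α := fun _ => Bool) i.succ true fun _ => false) 0 = false := by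
        obtain ⟨d, rfl⟩ : ∃ e, d = e + 1 := ⟨d - 1, by have := i.pos; omega⟩
        have := Fin.insertNth_apply_succAbove (α := fun _ => Bool) i.succ true (fun _ => false) 0
        rwa [Fin.succ_succAbove_zero] at this
      rw [h2, h3, e]
      simp

end LCube

variable {m n : ℕ}

/-- The labels obtained by sampling a map on a subdivision of the unit cube. -/
noncomputable def sample (f : (Fin m → ℝ) → (Fin n → ℝ)) (N : Fin m → ℕ) (w : Fin m → ℤ) :
    Fin n → ℝ :=
  f (clampI fun i => (w i : ℝ) / N i)

theorem sample_eq_zero {f : (Fin m → ℝ) → (Fin n → ℝ)}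
    (hf : ∀ t ∈ Set.Icc (0 : Fin m → ℝ) 1, OnBdry t → f t = 0) {N : Fin m → ℕ} {w : Fin m → ℤ}
    {i : Fin m} (h : w i ≤ 0 ∨ (N i : ℤ) ≤ w i) : sample f N w = 0 := by
  refine hf _ (clampI_mem _) (onBdry_clampI (i := i) ?_)
  rcases h with h | h
  · exact Or.inl (div_nonpos_of_nonpos_of_nonneg (by exact_mod_cast h) (Nat.cast_nonneg _))
  · rcases Nat.eq_zero_or_pos (N i) with h0 | h0
    · left
      simp [h0]
    · right
      rw [one_le_div (by exact_mod_cast h0)]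
      exact_mod_cast h

theorem finite_sample_ne_zero {f : (Fin m → ℝ) → (Fin n → ℝ)}
    (hf : ∀ t ∈ Set.Icc (0 : Fin m → ℝ) 1, OnBdry t → f t = 0) (N : Fin m → ℕ) :
    {w | sample f N w ≠ 0}.Finite := by
  refine (Set.finite_Icc (0 : Fin m → ℤ) (fun i => (N i : ℤ))).subset fun w hw => ?_
  constructor <;> intro i <;> by_contra hcon <;>
    refine hw (sample_eq_zero hf (i := i) ?_)
  · exact Or.inl (by simpa using (not_le.mp hcon).le)
  · exact Or.inr (not_le.mp hcon).le

/-- The approximate degree of a map at the given scale. -/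
noncomputable def degAt (s : ℕ → (Fin n → ℝ) → ℤ) (f : (Fin m → ℝ) → (Fin n → ℝ))
    (N : Fin m → ℕ) : ℤ :=
  ∑ᶠ z, primit m s (tile (sample f N) z)

/-- The cubes obtained by sampling a map on a subdivision of the unit cube. -/
noncomputable def fineTile (F : (Fin (m + 1) → ℝ) → (Fin n → ℝ)) (M : ℕ) (N : Fin m → ℕ) (j : ℕ)
    (z : Fin m → ℤ) : LCube (Fin n → ℝ) (m + 1) := fun t =>
  F (clampI (Fin.cons (((j : ℝ) + if t 0 then 1 else 0) / M)
    fun i => ((z i : ℝ) + bz (Fin.tail t) i) / N i))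

theorem clampI_cons (σ : ℝ) (y : Fin m → ℝ) :
    clampI (Fin.cons σ y : Fin (m + 1) → ℝ) = Fin.cons (max 0 (min 1 σ)) (clampI y) := by
  funext i
  refine Fin.cases ?_ (fun i => ?_) i <;> simp [clampI]

theorem primit_const (hm : 0 < m) (s : ℕ → (Fin n → ℝ) → ℤ) (v : Fin n → ℝ) :
    primit m s (fun _ => v) = 0 := by
  rw [primit, cocyc_eq_zero hm fun _ _ => rfl, mul_zero]

theorem degAt_sub (hm : 0 < m) (s : ℕ → (Fin n → ℝ) → ℤ)
    {F : (Fin (m + 1) → ℝ) → (Fin n → ℝ)}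
    (hF : ∀ σ ∈ Set.Icc (0 : ℝ) 1, ∀ t ∈ Set.Icc (0 : Fin m → ℝ) 1, OnBdry t →
      F (Fin.cons σ t) = 0) {M : ℕ} (hM : 0 < M) (N : Fin m → ℕ) :
    degAt s (fun t => F (Fin.cons 1 t)) N - degAt s (fun t => F (Fin.cons 0 t)) N =
      ∑ j ∈ Finset.range M, ∑ᶠ z, cocyc (m + 1) s (fineTile F M N j z) := by
  have hM' : (0 : ℝ) < M := by exact_mod_cast hM
  have key : ∀ j ∈ Finset.range M, ∑ᶠ z, cocyc (m + 1) s (fineTile F M N j z) =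
      degAt s (fun t => F (Fin.cons (((j + 1 : ℕ) : ℝ) / M) t)) N -
        degAt s (fun t => F (Fin.cons ((j : ℝ) / M) t)) N := by
    intro j hj
    have hj' : ((j + 1 : ℕ) : ℝ) ≤ M := by exact_mod_cast Finset.mem_range.mp hj
    have m1 : ((j + 1 : ℕ) : ℝ) / M ∈ Set.Icc (0 : ℝ) 1 :=
      ⟨by positivity, (div_le_one hM').mpr hj'⟩
    have m0 : (j : ℝ) / M ∈ Set.Icc (0 : ℝ) 1 :=
      ⟨by positivity, (div_le_one hM').mpr (by push_cast at hj'; linarith)⟩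
    unfold degAt
    rw [finsum_tile_sub (primit m s) 0 (primit_const hm s 0)]
    · refine finsum_congr fun z => ?_
      rw [cob_primit]
      congr 1
      funext t
      simp only [fineTile, prism, sample, clampI_cons]
      push_cast at m1
      split_ifs
      · rw [min_eq_right m1.2, max_eq_right m1.1]
        simp only [Pi.add_apply, Nat.cast_add, Nat.cast_one, Int.cast_add]
      · rw [add_zero, min_eq_right m0.2, max_eq_right m0.1]
        simp only [Pi.add_apply, Int.cast_add]
    · refine ((finite_sample_ne_zero (hF _ m0) N).union (finite_sample_ne_zero (hF _ m1) N)).subset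
        fun w hw => ?_
      by_contra hcon
      simp only [Set.mem_union, Set.mem_ofPred_eq, not_or, not_not] at hcon
      exact hw hcon
  rw [Finset.sum_congr rfl key,
    Finset.sum_range_sub (fun j : ℕ => degAt s (fun t => F (Fin.cons ((j : ℝ) / M) t)) N)]
  rw [div_self hM'.ne']
  simp

/-- The functions `1` or `0` according to whether a coordinate exceeds that of `q`. -/
noncomputable def above (q : Fin n → ℝ) (i : ℕ) (x : Fin n → ℝ) : ℤ :=
  if h : i < n then (if q ⟨i, h⟩ < x ⟨i, h⟩ then 1 else 0) else 0

theorem above_val (q : Fin n → ℝ) (i : Fin n) (x : Fin n → ℝ) :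
    above q i x = if q i < x i then 1 else 0 := by
  simp [above]

theorem exists_of_cocyc_above {q : Fin n → ℝ} {c : LCube (Fin n → ℝ) n}
    (h : cocyc n (above q) c ≠ 0) (j : Fin n) : (∃ t, c t j ≤ q j) ∧ ∃ t, q j < c t j := by
  constructor
  · by_contra! hcon
    refine h (cocyc_eq_zero j.2 fun t t' => ?_)
    rw [above_val, above_val, if_pos (hcon t), if_pos (hcon t')]
  · by_contra! hcon
    refine h (cocyc_eq_zero j.2 fun t t' => ?_)
    rw [above_val, above_val, if_neg (hcon t).not_gt, if_neg (hcon t').not_gt]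

theorem near_of_cocyc_above {q : Fin n → ℝ} {c : LCube (Fin n → ℝ) n}
    (h : cocyc n (above q) c ≠ 0) {η : ℝ} (hosc : ∀ t t' j, |c t j - c t' j| < η)
    (t : Fin n → Bool) (j : Fin n) : |c t j - q j| < η := by
  obtain ⟨⟨t₀, h0⟩, t₁, h1⟩ := exists_of_cocyc_above h j
  have a0 := abs_lt.mp (hosc t t₀ j)
  have a1 := abs_lt.mp (hosc t t₁ j)
  rw [abs_lt]
  constructor <;> linarith

theorem fineTile_osc {F : (Fin (m + 1) → ℝ) → (Fin n → ℝ)} {η δ : ℝ}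
    (hmod : ∀ y y' : Fin (m + 1) → ℝ, (∀ i, |y i - y' i| < δ) →
      ∀ j, |F (clampI y) j - F (clampI y') j| < η) {M : ℕ} {N : Fin m → ℕ}
    (hM : 1 / (M : ℝ) < δ) (hN : ∀ i, 1 / (N i : ℝ) < δ) (j : ℕ) (z : Fin m → ℤ) (t t') (l) :
    |fineTile F M N j z t l - fineTile F M N j z t' l| < η := by
  refine hmod _ _ (fun i => ?_) l
  have key : ∀ (a x y : ℝ) (K : ℕ), 1 / (K : ℝ) < δ → 0 ≤ x → x ≤ 1 → 0 ≤ y → y ≤ 1 →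
      |(a + x) / K - (a + y) / K| < δ := by
    intro a x y K hK hx hx' hy hy'
    refine lt_of_le_of_lt ?_ hK
    rw [← sub_div, abs_div, Nat.abs_cast]
    refine div_le_div_of_nonneg_right ?_ (Nat.cast_nonneg _)
    rw [abs_le]
    constructor <;> linarith
  refine Fin.cases ?_ (fun i => ?_) i
  · simp only [Fin.cons_zero]
    apply key _ _ _ _ hM <;> split_ifs <;> norm_num
  · simp only [Fin.cons_succ]
    apply key _ _ _ _ (hN i)
    · exact_mod_cast bz_nonneg _ i
    · exact_mod_cast bz_le_one _ i
    · exact_mod_cast bz_nonneg _ i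
    · exact_mod_cast bz_le_one _ i

/-- A continuous map on a compact box stays away from a point it omits. -/
theorem exists_gap {F : (Fin m → ℝ) → (Fin n → ℝ)} (hF : Continuous F) (q : Fin n → ℝ)
    {K : Set (Fin m → ℝ)} (hK : IsCompact K) (h : ∀ x ∈ K, F x ≠ q) :
    ∃ η > 0, ∀ x ∈ K, ¬ ∀ j, |F x j - q j| < η := by
  rcases K.eq_empty_or_nonempty with rfl | hne
  · exact ⟨1, one_pos, fun _ h => h.elim⟩
  obtain ⟨x₀, hx₀, hmin⟩ := hK.exists_isMinOn hne
    (f := fun x => dist (F x) q) (by fun_prop)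
  refine ⟨dist (F x₀) q, dist_pos.mpr (h x₀ hx₀), fun x hx hcon => ?_⟩
  have h1 : dist (F x) q < dist (F x₀) q := by
    rw [dist_pi_lt_iff (dist_pos.mpr (h x₀ hx₀))]
    intro j
    rw [Real.dist_eq]
    exact hcon j
  exact absurd (hmin hx) (not_le.mpr h1)

theorem degAt_homotopy {m : ℕ} (hm : 0 < m) {F : (Fin (m + 1) → ℝ) → (Fin (m + 1) → ℝ)}
    (hc : Continuous F) (q : Fin (m + 1) → ℝ)
    (hF : ∀ σ ∈ Set.Icc (0 : ℝ) 1, ∀ t ∈ Set.Icc (0 : Fin m → ℝ) 1, OnBdry t →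
      F (Fin.cons σ t) = 0) (hq : ∀ x ∈ Set.Icc (0 : Fin (m + 1) → ℝ) 1, F x ≠ q) :
    ∃ δ > 0, ∀ N : Fin m → ℕ, (∀ i, 1 / (N i : ℝ) < δ) →
      degAt (above q) (fun t => F (Fin.cons 1 t)) N =
        degAt (above q) (fun t => F (Fin.cons 0 t)) N := by
  obtain ⟨η, hη, hgap⟩ := exists_gap hc q isCompact_Icc hq
  obtain ⟨δ, hδ, hmod⟩ := exists_modulus hc hη
  obtain ⟨M, hM⟩ := exists_nat_one_div_lt hδ
  refine ⟨δ, hδ, fun N hN => ?_⟩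
  rw [← sub_eq_zero, degAt_sub hm (above q) hF (Nat.succ_pos M) N]
  refine Finset.sum_eq_zero fun j _ => ?_
  rw [← finsum_zero (α := Fin m → ℤ)]
  refine finsum_congr fun z => ?_
  by_contra hne
  refine hgap _ (clampI_mem _) (near_of_cocyc_above hne
    (fun t t' l => fineTile_osc hmod (by exact_mod_cast hM) hN j z t t' l) fun _ => false)

end Degree

/-! ### The degree homomorphism -/

section DegreeHom

open LCube Filter

theorem exists_homotopy_of_cls_eq {k n : ℕ} {S : Set (Fin n → ℝ)} {h₀ : (0 : Fin n → ℝ) ∈ S}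
    {φ ψ : (Fin (k + 2) → ℝ) → (Fin n → ℝ)} (hφ : IsLoop S φ) (hψ : IsLoop S ψ)
    (h : cls h₀ φ = cls h₀ ψ) :
    ∃ F : (Fin (k + 3) → ℝ) → (Fin n → ℝ), Continuous F ∧ (∀ x, F x ∈ S) ∧
      (∀ σ : ℝ, ∀ t : Fin (k + 2) → ℝ, OnBdry t → F (Fin.cons σ t) = 0) ∧
      (∀ t ∈ Set.Icc (0 : Fin (k + 2) → ℝ) 1, F (Fin.cons 0 t) = φ t) ∧
      ∀ t ∈ Set.Icc (0 : Fin (k + 2) → ℝ) 1, F (Fin.cons 1 t) = ψ t := by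
  rw [cls_of_isLoop h₀ hφ, cls_of_isLoop h₀ hψ, genCls_eq_iff] at h
  obtain ⟨H⟩ := h
  have hpr : ∀ t ∈ Set.Icc (0 : Fin (k + 2) → ℝ) 1,
      cubeVal (fun i => Set.projIcc 0 1 zero_le_one (t i)) = t := by
    intro t ht
    funext i
    exact congrArg Subtype.val (Set.projIcc_of_mem zero_le_one ⟨ht.1 i, ht.2 i⟩)
  refine ⟨fun x => ((H (Set.projIcc 0 1 zero_le_one (x 0),
    fun i => Set.projIcc 0 1 zero_le_one (x i.succ)) : S) : Fin n → ℝ), ?_, ?_, ?_, ?_, ?_⟩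
  · refine continuous_subtype_val.comp ((map_continuous H).comp ?_)
    exact (continuous_projIcc.comp (continuous_apply 0)).prodMk
      (continuous_pi fun i => continuous_projIcc.comp (continuous_apply _))
  · exact fun x => Subtype.coe_prop _
  · intro σ t ht
    simp only [Fin.cons_zero, Fin.cons_succ]
    have hb : (fun i => Set.projIcc 0 1 zero_le_one (t i)) ∈ Cube.boundary (Fin (k + 2)) := by
      obtain ⟨i, hi⟩ := ht
      refine ⟨i, hi.imp (fun h => ?_) (fun h => ?_)⟩
      · change Set.projIcc 0 1 zero_le_one (t i) = 0
        rw [h]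
        exact Set.projIcc_left _
      · change Set.projIcc 0 1 zero_le_one (t i) = 1
        rw [h]
        exact Set.projIcc_right _
    rw [H.eq_fst _ hb]
    exact congrArg Subtype.val ((hφ.toGen h₀).2 _ hb)
  · intro t ht
    simp only [Fin.cons_zero, Fin.cons_succ]
    have e : Set.projIcc (0 : ℝ) 1 zero_le_one 0 = 0 := Set.projIcc_left _
    rw [e, H.apply_zero]
    change φ (cubeVal _) = φ t
    rw [hpr t ht]
  · intro t ht
    simp only [Fin.cons_zero, Fin.cons_succ]
    have e : Set.projIcc (0 : ℝ) 1 zero_le_one 1 = 1 := Set.projIcc_right _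
    rw [e, H.apply_one]
    change ψ (cubeVal _) = ψ t
    rw [hpr t ht]

theorem degAt_congr {m n : ℕ} {s : ℕ → (Fin n → ℝ) → ℤ} {f g : (Fin m → ℝ) → (Fin n → ℝ)}
    (h : ∀ t ∈ Set.Icc (0 : Fin m → ℝ) 1, f t = g t) (N : Fin m → ℕ) :
    degAt s f N = degAt s g N := by
  have : sample f N = sample g N := funext fun w => h _ (clampI_mem _)
  rw [degAt, degAt, this]

theorem eventually_fine {m : ℕ} {δ : ℝ} (hδ : 0 < δ) :
    ∀ᶠ N : Fin m → ℕ in atTop, ∀ i, 1 / (N i : ℝ) < δ := by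
  obtain ⟨K, hK⟩ := exists_nat_one_div_lt hδ
  filter_upwards [eventually_ge_atTop fun _ : Fin m => K + 1] with N hN i
  refine lt_of_le_of_lt ?_ hK
  have : ((K + 1 : ℕ) : ℝ) ≤ N i := by exact_mod_cast hN i
  push_cast at this
  exact one_div_le_one_div_of_le (by positivity) this

variable {k : ℕ} {p : Fin (k + 3) → ℝ}

theorem eventually_degAt_eq (hp : GenericPt p) {φ ψ : (Fin (k + 2) → ℝ) → (Fin (k + 3) → ℝ)}
    (hφ : IsLoop (Punct p) φ) (hψ : IsLoop (Punct p) ψ)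
    (h : cls hp.zero_mem φ = cls hp.zero_mem ψ) (z : Fin (k + 3) → ℤ) :
    degAt (above (p + toR z)) φ =ᶠ[atTop] degAt (above (p + toR z)) ψ := by
  obtain ⟨F, hF, hS, hb, h0, h1⟩ := exists_homotopy_of_cls_eq hφ hψ h
  obtain ⟨δ, hδ, hd⟩ := degAt_homotopy (Nat.succ_pos _) hF (p + toR z)
    (fun σ _ t _ ht => hb σ t ht) (fun x _ => hS x z)
  filter_upwards [eventually_fine hδ] with N hN
  rw [← degAt_congr h0, ← degAt_congr h1, hd N hN]

/-- The concatenation of two loops in the first coordinate. -/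
noncomputable def concat {n : ℕ} (φ ψ : (Fin (k + 2) → ℝ) → (Fin n → ℝ)) (t : Fin (k + 2) → ℝ) :
    Fin n → ℝ :=
  φ (clampI (Function.update t 0 (2 * t 0))) + ψ (clampI (Function.update t 0 (2 * t 0 - 1)))

theorem continuous_clampI {m : ℕ} : Continuous (clampI (m := m)) := by
  unfold clampI
  fun_prop

theorem concat_of_le {n : ℕ} {S : Set (Fin n → ℝ)} {φ ψ : (Fin (k + 2) → ℝ) → (Fin n → ℝ)}
    (hψ : IsLoop S ψ) {t : Fin (k + 2) → ℝ} (ht : t 0 ≤ 1 / 2) :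
    concat φ ψ t = φ (clampI (Function.update t 0 (2 * t 0))) := by
  rw [concat, hψ.bdry _ (clampI_mem _) (onBdry_clampI (i := 0) (Or.inl (by simp; linarith))),
    add_zero]

theorem concat_of_ge {n : ℕ} {S : Set (Fin n → ℝ)} {φ ψ : (Fin (k + 2) → ℝ) → (Fin n → ℝ)}
    (hφ : IsLoop S φ) {t : Fin (k + 2) → ℝ} (ht : 1 / 2 ≤ t 0) :
    concat φ ψ t = ψ (clampI (Function.update t 0 (2 * t 0 - 1))) := by
  rw [concat, hφ.bdry _ (clampI_mem _) (onBdry_clampI (i := 0) (Or.inr (by simp; linarith))),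
    zero_add]

theorem isLoop_concat {n : ℕ} {S : Set (Fin n → ℝ)} {φ ψ : (Fin (k + 2) → ℝ) → (Fin n → ℝ)}
    (hφ : IsLoop S φ) (hψ : IsLoop S ψ) : IsLoop S (concat φ ψ) := by
  refine ⟨?_, fun t _ => ?_, fun t _ hb => ?_⟩
  · unfold concat
    exact (hφ.cont.comp (continuous_clampI.comp (by fun_prop))).add
      (hψ.cont.comp (continuous_clampI.comp (by fun_prop)))
  · rcases le_total (t 0) (1 / 2) with h | h
    · rw [concat_of_le hψ h]
      exact hφ.mem _ (clampI_mem _)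
    · rw [concat_of_ge hφ h]
      exact hψ.mem _ (clampI_mem _)
  · obtain ⟨i, hi⟩ := hb
    have hle : t i ≤ 0 ∨ 1 ≤ t i := hi.imp le_of_eq (fun h => h.ge)
    rcases le_total (t 0) (1 / 2) with h | h
    · rw [concat_of_le hψ h]
      refine hφ.bdry _ (clampI_mem _) (onBdry_clampI (i := i) ?_)
      by_cases h0 : i = 0
      · subst h0
        rw [Function.update_self]
        exact hle.imp (fun _ => by linarith) (fun _ => by linarith)
      · rwa [Function.update_of_ne h0]
    · rw [concat_of_ge hφ h]
      refine hψ.bdry _ (clampI_mem _) (onBdry_clampI (i := i) ?_)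
      by_cases h0 : i = 0
      · subst h0
        rw [Function.update_self]
        exact hle.imp (fun _ => by linarith) (fun _ => by linarith)
      · rwa [Function.update_of_ne h0]

theorem cls_concat_eq {n : ℕ} {S : Set (Fin n → ℝ)} (h₀ : (0 : Fin n → ℝ) ∈ S)
    {φ ψ : (Fin (k + 2) → ℝ) → (Fin n → ℝ)} (hφ : IsLoop S φ) (hψ : IsLoop S ψ) :
    cls h₀ (concat φ ψ) = cls h₀ φ + cls h₀ ψ := by
  refine cls_concat h₀ 0 hφ hψ (isLoop_concat hφ hψ).cont (fun t ht h => ?_) (fun t ht h => ?_)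
  · have := ht.1 0
    rw [concat_of_le hψ h, clampI_of_mem (update_mem_Icc ht 0 ⟨by simpa using this, by linarith⟩)]
  · have := ht.2 0
    simp only [Pi.one_apply] at this
    rw [concat_of_ge hφ h.le,
      clampI_of_mem (update_mem_Icc ht 0 ⟨by linarith, by linarith⟩)]

theorem clampI_update_clampI {m : ℕ} (y : Fin (m + 1) → ℝ) (a : ℝ → ℝ)
    (ha : ∀ x, max 0 (min 1 (a (max 0 (min 1 x)))) = max 0 (min 1 (a x))) :
    clampI (Function.update (clampI y) 0 (a (clampI y 0))) =
      clampI (Function.update y 0 (a (y 0))) := by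
  funext i
  by_cases h : i = 0
  · subst h
    simp only [clampI, Function.update_self, ha]
  · simp only [clampI, Function.update_of_ne h]
    simp

theorem sample_concat {n : ℕ} (φ ψ : (Fin (k + 2) → ℝ) → (Fin n → ℝ)) {N : Fin (k + 2) → ℕ}
    (hN : 0 < N 0) (w : Fin (k + 2) → ℤ) :
    sample (concat φ ψ) (Function.update N 0 (2 * N 0)) w =
      sample φ N w + sample ψ N (w - Pi.single 0 (N 0 : ℤ)) := by
  have hN' : (0 : ℝ) < N 0 := by exact_mod_cast hN
  have key : ∀ x c : ℝ, 0 ≤ c → c ≤ 1 →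
      max 0 (min 1 (2 * max 0 (min 1 x) - c)) = max 0 (min 1 (2 * x - c)) := by
    intro x c hc hc'
    rcases le_total x 0 with h | h
    · rw [min_eq_right (h.trans zero_le_one), max_eq_left h, min_eq_right, min_eq_right] <;>
        first | linarith | skip
      rw [max_eq_left, max_eq_left] <;> linarith
    · rcases le_total x 1 with h1 | h1
      · rw [min_eq_right h1, max_eq_right h]
      · rw [min_eq_left h1, max_eq_right zero_le_one, min_eq_left, min_eq_left] <;> linarith
  unfold sample concat
  rw [clampI_update_clampI _ (fun x => 2 * x) (fun x => by simpa using key x 0 le_rfl zero_le_one),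
    clampI_update_clampI _ (fun x => 2 * x - 1) (fun x => key x 1 zero_le_one le_rfl)]
  congr 3
  · funext i
    by_cases h : i = 0
    · subst h
      simp only [Function.update_self]
      push_cast
      field_simp
    · simp only [Function.update_of_ne h]
  · funext i
    by_cases h : i = 0
    · subst h
      simp only [Function.update_self, Pi.sub_apply, Pi.single_eq_same]
      push_cast
      field_simp
    · simp only [Function.update_of_ne h, Pi.sub_apply, Pi.single_eq_of_ne h, sub_zero]

theorem degAt_concat {n : ℕ} {S : Set (Fin n → ℝ)} (s : ℕ → (Fin n → ℝ) → ℤ)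
    {φ ψ : (Fin (k + 2) → ℝ) → (Fin n → ℝ)} (hφ : IsLoop S φ) (hψ : IsLoop S ψ)
    {N : Fin (k + 2) → ℕ} (hN : 0 < N 0) :
    degAt s (concat φ ψ) (Function.update N 0 (2 * N 0)) = degAt s φ N + degAt s ψ N := by
  have hU := primit_const (n := n) (Nat.succ_pos (k + 1)) s 0
  have hfin : ∀ {φ : (Fin (k + 2) → ℝ) → (Fin n → ℝ)}, IsLoop S φ →
      (fun z => primit (k + 2) s (tile (sample φ N) z)).support.Finite := by
    intro φ hφ
    refine finite_support_of_tile (finite_sample_ne_zero hφ.bdry N) fun z hz => ?_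
    rw [← hU]
    congr 1
    funext ε
    simpa [tile] using hz ε
  have e : ∀ z, primit (k + 2) s
        (tile (sample (concat φ ψ) (Function.update N 0 (2 * N 0))) z) =
      primit (k + 2) s (tile (sample φ N) z) +
        primit (k + 2) s (tile (sample ψ N) (z - Pi.single 0 (N 0 : ℤ))) := by
    intro z
    rcases lt_or_ge (z 0) (N 0) with h | h
    · have h1 : tile (sample ψ N) (z - Pi.single 0 (N 0 : ℤ)) = fun _ => 0 := by
        funext ε
        refine sample_eq_zero hψ.bdry (i := 0) (Or.inl ?_)
        have := bz_le_one ε 0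
        simp only [Pi.add_apply, Pi.sub_apply, Pi.single_eq_same]
        omega
      rw [h1, hU, add_zero]
      congr 1
      funext ε
      have h2 := congrFun h1 ε
      simp only [tile] at h2 ⊢
      rw [sample_concat φ ψ hN, add_sub_right_comm, h2, add_zero]
    · have h1 : tile (sample φ N) z = fun _ => 0 := by
        funext ε
        refine sample_eq_zero hφ.bdry (i := 0) (Or.inr ?_)
        have := bz_nonneg ε 0
        simp only [Pi.add_apply]
        omega
      rw [h1, hU, zero_add]
      congr 1
      funext ε
      have h2 := congrFun h1 ε
      simp only [tile] at h2 ⊢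
      rw [sample_concat φ ψ hN, add_sub_right_comm, h2, zero_add]
  have hs := finsum_comp_equiv (Equiv.subRight (Pi.single 0 (N 0 : ℤ) : Fin (k + 2) → ℤ))
    (f := fun z => primit (k + 2) s (tile (sample ψ N) z))
  simp only [Equiv.subRight_apply] at hs
  unfold degAt
  simp only [e]
  rw [finsum_add_distrib (hfin hφ), hs]
  exact (hfin hψ).preimage
    ((Equiv.subRight (Pi.single 0 (N 0 : ℤ) : Fin (k + 2) → ℤ)).injective.injOn)

theorem tendsto_update_double :
    Tendsto (fun N : Fin (k + 2) → ℕ => Function.update N 0 (2 * N 0)) atTop atTop := by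
  refine tendsto_atTop_mono (fun N i => ?_) tendsto_id
  by_cases h : i = 0
  · subst h
    simp only [id, Function.update_self]
    omega
  · simp [Function.update_of_ne h]

theorem eventually_degAt_concat (hp : GenericPt p)
    {φ ψ : (Fin (k + 2) → ℝ) → (Fin (k + 3) → ℝ)}
    (hφ : IsLoop (Punct p) φ) (hψ : IsLoop (Punct p) ψ) (z : Fin (k + 3) → ℤ) :
    degAt (above (p + toR z)) (concat φ ψ) =ᶠ[atTop]
      degAt (above (p + toR z)) φ + degAt (above (p + toR z)) ψ := by
  have h0 := isLoop_zero (m := k + 2) hp.zero_mem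
  have hχ := isLoop_concat hφ hψ
  have key : ∀ {χ : (Fin (k + 2) → ℝ) → (Fin (k + 3) → ℝ)}, IsLoop (Punct p) χ →
      ∀ᶠ N : Fin (k + 2) → ℕ in atTop,
        degAt (above (p + toR z)) χ (Function.update N 0 (2 * N 0)) =
          degAt (above (p + toR z)) χ N := by
    intro χ hχ
    have h1 := eventually_degAt_eq hp hχ (isLoop_concat hχ h0)
      (by rw [cls_concat_eq hp.zero_mem hχ h0, cls_zero, add_zero]) z
    filter_upwards [tendsto_update_double.eventually h1,
      eventually_ge_atTop fun _ : Fin (k + 2) => 1] with N hN h1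
    rw [hN, degAt_concat _ hχ h0 (h1 0), add_eq_left]
    exact (finsum_congr fun z' => primit_const (Nat.succ_pos (k + 1)) _ 0).trans finsum_zero
  filter_upwards [key hχ, eventually_ge_atTop fun _ : Fin (k + 2) => 1] with N h1 h2
  rw [← h1, degAt_concat _ hφ hψ (h2 0), Pi.add_apply]

/-- The degree of a homotopy class around the point `p + z`, as a germ at infinity of the
approximate degrees. -/
noncomputable def degHom (hp : GenericPt p) (z : Fin (k + 3) → ℤ) :
    PiGrp k hp.zero_mem →+ Germ (atTop : Filter (Fin (k + 2) → ℕ)) ℤ :=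
  AddMonoidHom.mk'
    (fun x => (degAt (above (p + toR z)) (exists_cls_eq hp.zero_mem x).choose :
      Germ (atTop : Filter (Fin (k + 2) → ℕ)) ℤ)) fun x y => by
    obtain ⟨hx, ex⟩ := (exists_cls_eq hp.zero_mem x).choose_spec
    obtain ⟨hy, ey⟩ := (exists_cls_eq hp.zero_mem y).choose_spec
    obtain ⟨hxy, exy⟩ := (exists_cls_eq hp.zero_mem (x + y)).choose_spec
    refine Germ.coe_eq.mpr ((eventually_degAt_eq hp hxy (isLoop_concat hx hy) ?_ z).trans
      (eventually_degAt_concat hp hx hy z))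
    rw [exy, cls_concat_eq _ hx hy, ex, ey]

theorem degHom_cls (hp : GenericPt p) (z : Fin (k + 3) → ℤ)
    {φ : (Fin (k + 2) → ℝ) → (Fin (k + 3) → ℝ)} (hφ : IsLoop (Punct p) φ) :
    degHom hp z (cls hp.zero_mem φ) = degAt (above (p + toR z)) φ := by
  obtain ⟨hx, ex⟩ := (exists_cls_eq hp.zero_mem (cls hp.zero_mem φ)).choose_spec
  exact Germ.coe_eq.mpr (eventually_degAt_eq hp hx hφ ex z)

end DegreeHom

/-! ### The degrees of the generators -/

section GeneratorDegree

open LCube Filter MeasureTheory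

theorem LCube.leadC_stair : ∀ (d : ℕ) (t : Fin d → Bool) (j : Fin d),
    leadC d LCube.stair t j = true ↔ ∀ i ≤ j, t i = true
  | 0, _, j => j.elim0
  | d + 1, t, j => by
    have e : (Fin.tail LCube.stair : Fin (d + 1) → Fin (d + 1) → Bool) =
        (fun ε => (Fin.cons true ε : Fin (d + 1) → Bool)) ∘ LCube.stair := by
      funext l i
      refine Fin.cases ?_ (fun i => ?_) i
      · simp [Fin.tail, LCube.stair]
      · simp [Fin.tail, LCube.stair]
    have h : leadC (d + 1) LCube.stair t =
        if t 0 then (Fin.cons true (leadC d LCube.stair (Fin.tail t)) : Fin (d + 1) → Bool)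
          else LCube.stair 0 := by
      rw [leadC, cone, e, ← map_leadC]
      rfl
    rw [h]
    split_ifs with h0
    · refine Fin.cases ?_ (fun j => ?_) j
      · simpa using h0
      · rw [Fin.cons_succ, LCube.leadC_stair d]
        constructor
        · intro h i
          refine Fin.cases (fun _ => h0) (fun i hi => ?_) i
          exact h i (Fin.succ_le_succ_iff.mp hi)
        · exact fun h i hi => h i.succ (Fin.succ_le_succ_iff.mpr hi)
    · simp only [LCube.stair, Fin.not_lt_zero, decide_false, Bool.false_eq_true, false_iff]
      exact fun h => h0 (h 0 (Fin.zero_le _))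

theorem integral_add_ite_lt (c a : ℝ) :
    ∫ θ in Set.Ioo (0 : ℝ) 1, (c + if θ < a then (1 : ℝ) else 0) = c + max 0 (min 1 a) := by
  have hi : IntegrableOn (fun θ : ℝ => if θ < a then (1 : ℝ) else 0) (Set.Ioo 0 1) :=
    (integrable_const (1 : ℝ)).indicator (measurableSet_Iio (a := a))
  rw [integral_add (integrable_const c) hi]
  congr 1
  · simp
  · rw [← integral_ite_lt (a := max 0 (min 1 a))
      ⟨le_max_left _ _, max_le zero_le_one (min_le_left _ _)⟩]
    refine setIntegral_congr_fun measurableSet_Ioo fun θ hθ => ?_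
    simp only [lt_max_iff, lt_min_iff, hθ.2, hθ.1.not_gt, true_and, false_or]

variable {k : ℕ} {p : Fin (k + 3) → ℝ}

/-- The prism whose ends represent the boundary class. -/
noncomputable def simplexPrism (z : Fin (k + 3) → ℤ) (y : Fin (k + 3) → ℝ) : Fin (k + 3) → ℝ :=
  kuhn (hatPrism fun t => z + bz (leadC (k + 3) LCube.stair t)) y

theorem simplexPrism_apply (z : Fin (k + 3) → ℤ) {x y : Fin (k + 3) → ℝ}
    (hy : ∀ i : Fin (k + 2), 1 ≤ y i.succ ∧ y i.succ ≤ 4)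
    (hx : ∀ θ ∈ Set.Ioo (0 : ℝ) 1, ∀ l,
      hatVertex ⌈y 0 - θ⌉ (fun i : Fin (k + 2) => ⌈y i.succ - θ⌉) l = true ↔ θ < x l)
    (j : Fin (k + 3)) :
    simplexPrism z y j =
      z j + max 0 (min 1 ((Finset.Iic j).inf' Finset.nonempty_Iic x)) := by
  rw [simplexPrism, kuhn_apply, ← integral_add_ite_lt]
  refine setIntegral_congr_fun measurableSet_Ioo fun θ hθ => ?_
  simp only [hatPrism, hatLabel]
  rw [if_pos]
  · simp only [Pi.add_apply, bz]
    push_cast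
    congr 1
    have e : leadC (k + 3) LCube.stair
        (hatVertex ⌈y 0 - θ⌉ (Fin.tail fun i => ⌈y i - θ⌉)) j = true ↔
        θ < (Finset.Iic j).inf' Finset.nonempty_Iic x := by
      rw [LCube.leadC_stair, Finset.lt_inf'_iff]
      simp only [Finset.mem_Iic]
      exact forall₂_congr fun i _ => hx θ hθ i
    simp only [e]
  · intro i
    have h1 := hy i
    simp only [Fin.tail]
    rw [Int.le_ceil_iff, Int.ceil_le]
    push_cast
    constructor <;> linarith [hθ.1, hθ.2]

theorem simplexPrism_outer (hp : GenericPt p) (z z' : Fin (k + 3) → ℤ) {y : Fin (k + 3) → ℝ}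
    {i : Fin (k + 2)} (h : y i.succ ≤ 1 ∨ 4 ≤ y i.succ) : simplexPrism z y ≠ p + toR z' := by
  have e : simplexPrism z y =
      kuhn (hatLabel (fun t => z + bz (leadC (k + 3) LCube.stair t)) 0) (Fin.tail y) := by
    refine kuhn_congr fun θ hθ => ?_
    have h1 : Fin.tail (flr y + bz (thr y θ)) = flr (Fin.tail y) + bz (thr (Fin.tail y) θ) := rfl
    have hk : ∀ s s', hatKey s (flr (Fin.tail y) + bz (thr (Fin.tail y) θ)) =
        hatKey s' (flr (Fin.tail y) + bz (thr (Fin.tail y) θ)) := by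
      intro s s'
      have hmem : thr (Fin.tail y) θ ∈ carrier (Fin.tail y) := ⟨θ, hθ, rfl⟩
      unfold hatKey
      rcases h with h | h
      · have h2 := carrier_vertex_le hmem (i := i) (b := 1) (by exact_mod_cast h)
        have : ¬ ∀ i, 2 ≤ (flr (Fin.tail y) + bz (thr (Fin.tail y) θ)) i := by
          intro hcon
          have := hcon i
          omega
        simp only [this, and_false]
      · have h2 := le_carrier_vertex hmem (i := i) (b := 4) (by exact_mod_cast h)
        have : ∃ i, 4 ≤ (flr (Fin.tail y) + bz (thr (Fin.tail y) θ)) i := ⟨i, h2⟩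
        simp only [this, true_or]
    simp only [hatPrism, h1, hatLabel, hatVertex]
    rw [hk]
  rw [e]
  exact hp.kuhn_avoids _ _ _

/-- The centre of the affine part of `simplexPrism`. -/
def prismShift (l : Fin (k + 3)) : ℝ := if l = 0 then 0 else 2

theorem inf_eq_of_strictAnti {n : ℕ} {x : Fin n → ℝ} (h : StrictAnti x) (j : Fin n) :
    (Finset.Iic j).inf' Finset.nonempty_Iic x = x j := by
  refine le_antisymm (Finset.inf'_le _ (Finset.mem_Iic.mpr le_rfl)) ?_
  exact Finset.le_inf' _ _ fun i hi => h.antitone (Finset.mem_Iic.mp hi)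

theorem eq_of_inf_eq {n : ℕ} {x q : Fin n → ℝ} (hq : StrictAnti q)
    (h : ∀ j, (Finset.Iic j).inf' Finset.nonempty_Iic x = q j) (j : Fin n) :
    x j = q j := by
  have h1 : ∀ l, q l ≤ x l := fun l => by
    rw [← h l]
    exact Finset.inf'_le _ (Finset.mem_Iic.mpr le_rfl)
  obtain ⟨l, hl, e⟩ := Finset.exists_mem_eq_inf' (s := Finset.Iic j)
    Finset.nonempty_Iic x
  rw [h j] at e
  rcases (Finset.mem_Iic.mp hl).lt_or_eq with hlt | rfl
  · have := hq hlt
    have := h1 l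
    linarith
  · exact e.symm

theorem hatVertex_succ_iff (y : Fin (k + 3) → ℝ) (θ : ℝ) (i : Fin (k + 2)) :
    hatVertex ⌈y 0 - θ⌉ (fun i : Fin (k + 2) => ⌈y i.succ - θ⌉) i.succ = true ↔
      θ < y i.succ - 2 := by
  simp only [hatVertex, Fin.cons_succ, decide_eq_true_eq, Int.le_ceil_iff]
  push_cast
  constructor <;> intro h <;> linarith

theorem hatVertex_zero_iff (y : Fin (k + 3) → ℝ) (θ : ℝ) :
    hatVertex ⌈y 0 - θ⌉ (fun i : Fin (k + 2) => ⌈y i.succ - θ⌉) 0 = true ↔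
      (∃ i : Fin (k + 2), θ < y i.succ - 3) ∨ (θ < y 0 ∧ ∀ i : Fin (k + 2), θ < y i.succ - 1) := by
  simp only [hatVertex, Fin.cons_zero, hatKey, decide_eq_true_eq, Int.le_ceil_iff]
  push_cast
  refine or_congr (exists_congr fun i => ?_) (and_congr ?_ (forall_congr' fun i => ?_)) <;>
    constructor <;> intro h <;> linarith

theorem hatVertex_iff_of_mem {y : Fin (k + 3) → ℝ}
    (hy : ∀ i : Fin (k + 2), 2 ≤ y i.succ ∧ y i.succ ≤ 3) {θ : ℝ} (hθ : θ ∈ Set.Ioo (0 : ℝ) 1)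
    (l : Fin (k + 3)) :
    hatVertex ⌈y 0 - θ⌉ (fun i : Fin (k + 2) => ⌈y i.succ - θ⌉) l = true ↔
      θ < y l - prismShift l := by
  refine Fin.cases ?_ (fun i => ?_) l
  · rw [hatVertex_zero_iff]
    simp only [prismShift, if_true, sub_zero]
    constructor
    · rintro (⟨i, hi⟩ | h)
      · linarith [(hy i).2, hθ.1]
      · exact h.1
    · exact fun h => Or.inr ⟨h, fun i => by linarith [(hy i).1, hθ.2]⟩
  · rw [hatVertex_succ_iff]
    simp [prismShift, Fin.succ_ne_zero]

theorem simplexPrism_affine (z : Fin (k + 3) → ℤ) {y : Fin (k + 3) → ℝ}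
    (h : ∀ l, 0 < y l - prismShift l ∧ y l - prismShift l < 1)
    (hs : StrictAnti fun l => y l - prismShift l) (j : Fin (k + 3)) :
    simplexPrism z y j = z j + (y j - prismShift j) := by
  have hy : ∀ i : Fin (k + 2), 2 ≤ y i.succ ∧ y i.succ ≤ 3 := fun i => by
    have := h i.succ
    simp only [prismShift, Fin.succ_ne_zero, if_false] at this
    constructor <;> linarith
  rw [simplexPrism_apply z (x := fun l => y l - prismShift l)
    (fun i => ⟨by linarith [(hy i).1], by linarith [(hy i).2]⟩)
    (fun θ hθ l => hatVertex_iff_of_mem hy hθ l), inf_eq_of_strictAnti hs,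
    min_eq_right (h j).2.le, max_eq_right (h j).1.le]

theorem eq_of_simplexPrism_eq (hp : GenericPt p) {z z' : Fin (k + 3) → ℤ} {y : Fin (k + 3) → ℝ}
    (h : simplexPrism z y = p + toR z') : z' = z ∧ ∀ l, y l - prismShift l = p l := by
  have hy : ∀ i : Fin (k + 2), 1 ≤ y i.succ ∧ y i.succ ≤ 4 := by
    by_contra! hcon
    obtain ⟨i, hi⟩ := hcon
    refine simplexPrism_outer hp z z' (i := i) ?_ h
    rcases le_total (y i.succ) 1 with h1 | h1
    · exact Or.inl h1
    · exact Or.inr (hi h1).le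
  have key : ∀ x : Fin (k + 3) → ℝ, (∀ θ ∈ Set.Ioo (0 : ℝ) 1, ∀ l,
      hatVertex ⌈y 0 - θ⌉ (fun i : Fin (k + 2) => ⌈y i.succ - θ⌉) l = true ↔ θ < x l) →
      z' = z ∧ ∀ l, x l = p l := by
    intro x hx
    have h1 : ∀ j, z' j = z j ∧ (Finset.Iic j).inf' Finset.nonempty_Iic x = p j := by
      intro j
      have h2 := congrFun h j
      rw [simplexPrism_apply z hy hx j] at h2
      simp only [Pi.add_apply, toR] at h2
      have h3 := hp.pos j
      have h4 := hp.lt_one j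
      set a := (Finset.Iic j).inf' Finset.nonempty_Iic x
      have h5 : (0 : ℝ) ≤ max 0 (min 1 a) := le_max_left _ _
      have h6 : max 0 (min 1 a) ≤ 1 := max_le zero_le_one (min_le_left _ _)
      have h7 : (z' j : ℝ) < z j + 1 := by linarith
      have h8 : (z j : ℝ) < z' j + 1 := by linarith
      norm_cast at h7 h8
      have h9 : z' j = z j := by omega
      refine ⟨h9, ?_⟩
      rw [h9] at h2
      have h10 : max 0 (min 1 a) = p j := by linarith
      rcases le_total a 0 with h | h
      · rw [max_eq_left ((min_le_right _ _).trans h)] at h10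
        linarith
      · rw [max_eq_right (le_min zero_le_one h)] at h10
        rcases le_total a 1 with h' | h'
        · rwa [min_eq_right h'] at h10
        · rw [min_eq_left h'] at h10
          linarith
    exact ⟨funext fun j => (h1 j).1, eq_of_inf_eq hp.strictAnti fun j => (h1 j).2⟩
  have hne : (Finset.univ : Finset (Fin (k + 2))).Nonempty := Finset.univ_nonempty
  obtain ⟨-, h1⟩ := key (Fin.cons
    (max (Finset.univ.sup' hne fun i : Fin (k + 2) => y i.succ - 3)
      (min (y 0) (Finset.univ.inf' hne fun i : Fin (k + 2) => y i.succ - 1)))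
    fun i => y i.succ - 2) (fun θ hθ l => by
      refine Fin.cases ?_ (fun i => ?_) l
      · rw [hatVertex_zero_iff, Fin.cons_zero, lt_max_iff, lt_min_iff, Finset.lt_sup'_iff,
          Finset.lt_inf'_iff]
        simp
      · rw [hatVertex_succ_iff, Fin.cons_succ])
  have h2 : ∀ i : Fin (k + 2), 2 ≤ y i.succ ∧ y i.succ ≤ 3 := fun i => by
    have h3 := h1 i.succ
    rw [Fin.cons_succ] at h3
    have := hp.pos i.succ
    have := hp.lt_one i.succ
    constructor <;> linarith
  exact key _ fun θ hθ l => hatVertex_iff_of_mem h2 hθ l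

end GeneratorDegree

/-! ### The local degree at an affine point -/

section LocalDegree

open LCube Filter

theorem clampI_eq_self_of_mem_Ioo {m : ℕ} {u : Fin m → ℝ}
    (h : ∀ i, clampI u i ∈ Set.Ioo (0 : ℝ) 1) : clampI u = u := by
  refine clampI_of_mem ⟨fun i => ?_, fun i => ?_⟩
  · have := (h i).1
    simp only [clampI, lt_max_iff, lt_self_iff_false, false_or, lt_min_iff] at this
    exact this.2.le
  · have := (h i).2
    simp only [clampI, max_lt_iff, min_lt_iff, lt_self_iff_false, false_or] at this
    exact this.2.le

theorem fineTile_eq {m n : ℕ} (F : (Fin (m + 1) → ℝ) → (Fin n → ℝ)) (M : ℕ) (N : Fin m → ℕ)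
    (j : ℕ) (v : Fin m → ℤ) (t : Fin (m + 1) → Bool) :
    fineTile F M N j v t = F (clampI fun i =>
      (((Fin.cons (j : ℤ) v : Fin (m + 1) → ℤ) i : ℝ) + bz t i) /
        ((Fin.cons M N : Fin (m + 1) → ℕ) i : ℝ)) := by
  unfold fineTile
  congr 2
  funext i
  refine Fin.cases ?_ (fun i => ?_) i
  · simp [bz]
  · rfl

theorem degAt_sub_eq_one {m : ℕ} (hm : 0 < m) {F : (Fin (m + 1) → ℝ) → (Fin (m + 1) → ℝ)}
    (hc : Continuous F) {q P r : Fin (m + 1) → ℝ}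
    (hF : ∀ σ ∈ Set.Icc (0 : ℝ) 1, ∀ t ∈ Set.Icc (0 : Fin m → ℝ) 1, OnBdry t →
      F (Fin.cons σ t) = 0) (hP : ∀ l, P l ∈ Set.Ioo (0 : ℝ) 1) (hr : ∀ l, 0 < r l)
    (hloc : ∀ᶠ x in nhds P, ∀ l, F x l = q l + r l * (x l - P l))
    (hq : ∀ x ∈ Set.Icc (0 : Fin (m + 1) → ℝ) 1, F x = q → x = P) :
    ∃ δ > 0, ∀ N : Fin m → ℕ, (∀ i, 0 < N i) → (∀ i, 1 / (N i : ℝ) < δ) →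
      degAt (above q) (fun t => F (Fin.cons 1 t)) N -
        degAt (above q) (fun t => F (Fin.cons 0 t)) N = 1 := by
  have hopen : ∀ᶠ x in nhds P, ∀ l, x l ∈ Set.Ioo (0 : ℝ) 1 :=
    eventually_all.mpr fun l =>
      (continuous_apply l).continuousAt.eventually (Ioo_mem_nhds (hP l).1 (hP l).2)
  obtain ⟨ρ, hρ, hball⟩ := Metric.eventually_nhds_iff_ball.mp (hloc.and hopen)
  obtain ⟨η, hη, hgap⟩ := exists_gap hc q
    (K := Set.Icc 0 1 \ Metric.ball P ρ) (isCompact_Icc.diff Metric.isOpen_ball)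
    fun x hx e => hx.2 (by rw [hq x hx.1 e]; exact Metric.mem_ball_self hρ)
  obtain ⟨δ, hδ, hmod⟩ := exists_modulus hc hη
  obtain ⟨M, hM⟩ := exists_nat_one_div_lt (lt_min hδ hρ)
  refine ⟨min δ ρ, lt_min hδ hρ, fun N hN0 hN => ?_⟩
  rw [degAt_sub hm (above q) hF (Nat.succ_pos M) N]
  set K : Fin (m + 1) → ℕ := Fin.cons (M + 1) N with hK
  have hK0 : ∀ i, (0 : ℝ) < K i := fun i => by
    refine Fin.cases ?_ (fun i => ?_) i
    · simp only [hK, Fin.cons_zero]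
      positivity
    · simp only [hK, Fin.cons_succ]
      exact_mod_cast hN0 i
  have hKρ : ∀ i, 1 / (K i : ℝ) < ρ := fun i => by
    refine Fin.cases ?_ (fun i => ?_) i
    · simp only [hK, Fin.cons_zero]
      exact_mod_cast hM.trans_le (min_le_right _ _)
    · simp only [hK, Fin.cons_succ]
      exact (hN i).trans_le (min_le_right _ _)
  set w₀ : Fin (m + 1) → ℤ := fun i => ⌊K i * P i⌋ with hw₀
  have key : ∀ j v, cocyc (m + 1) (above q) (fineTile F (M + 1) N j v) =
      if (Fin.cons (j : ℤ) v : Fin (m + 1) → ℤ) = w₀ then 1 else 0 := by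
    intro j v
    split_ifs with hw
    · refine cocyc_eq_one fun l t => ?_
      rw [fineTile_eq, hw, above_val]
      set u : Fin (m + 1) → ℝ := fun i => ((w₀ i : ℝ) + bz t i) / K i with hu
      have h1 : ∀ i, (w₀ i : ℝ) / K i ≤ P i := fun i => by
        rw [div_le_iff₀ (hK0 i), mul_comm]
        exact Int.floor_le _
      have h2 : ∀ i, P i < ((w₀ i : ℝ) + 1) / K i := fun i => by
        rw [lt_div_iff₀ (hK0 i), mul_comm]
        exact Int.lt_floor_add_one _
      have hub : u ∈ Metric.ball P ρ := by
        rw [Metric.mem_ball, dist_pi_lt_iff hρ]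
        intro i
        have a1 := h1 i
        have a2 := h2 i
        have a3 := hKρ i
        rw [add_div] at a2
        rw [Real.dist_eq, abs_lt]
        have a4 : 0 < 1 / (K i : ℝ) := one_div_pos.mpr (hK0 i)
        simp only [hu, bz, add_div]
        split_ifs <;> simp only [Int.cast_one, Int.cast_zero, zero_div] <;> constructor <;> linarith
      have hcl : clampI u = u := clampI_of_mem
        ⟨fun i => ((hball u hub).2 i).1.le, fun i => ((hball u hub).2 i).2.le⟩
      change (if q l < F (clampI u) l then (1 : ℤ) else 0) = _
      rw [hcl, (hball u hub).1 l]
      have h3 : q l < q l + r l * (u l - P l) ↔ P l < u l := by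
        rw [lt_add_iff_pos_right, mul_pos_iff_of_pos_left (hr l), sub_pos]
      simp only [h3]
      cases ht : t l
      · have : u l = (w₀ l : ℝ) / K l := by simp [hu, bz, ht]
        rw [if_neg (by rw [this]; exact not_lt.mpr (h1 l))]
        simp
      · have : u l = ((w₀ l : ℝ) + 1) / K l := by simp [hu, bz, ht]
        rw [if_pos (by rw [this]; exact h2 l)]
        simp
    · by_contra hne
      refine hw (funext fun l => ?_)
      set w : Fin (m + 1) → ℤ := Fin.cons (j : ℤ) v with hwdef
      set u : (Fin (m + 1) → Bool) → Fin (m + 1) → ℝ :=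
        fun t i => ((w i : ℝ) + bz t i) / K i with hu
      have hF' : ∀ t, fineTile F (M + 1) N j v t = F (clampI (u t)) := fun t =>
        fineTile_eq F (M + 1) N j v t
      have hval : ∀ t l, F (clampI (u t)) l = q l + r l * (u t l - P l) := by
        intro t
        have hb : clampI (u t) ∈ Metric.ball P ρ := by
          by_contra hb
          refine hgap _ ⟨clampI_mem _, hb⟩ fun l => ?_
          rw [← hF']
          exact near_of_cocyc_above hne (fun t t' l => fineTile_osc hmod
            (by exact_mod_cast hM.trans_le (min_le_left _ _))
            (fun i => (hN i).trans_le (min_le_left _ _)) j v t t' l) t l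
        have hcl := clampI_eq_self_of_mem_Ioo (hball _ hb).2
        rw [hcl] at hb ⊢
        exact (hball _ hb).1
      obtain ⟨⟨t, ht⟩, t', ht'⟩ := exists_of_cocyc_above hne l
      rw [hF', hval, add_le_iff_nonpos_right, mul_nonpos_iff_pos_imp_nonpos] at ht
      rw [hF', hval, lt_add_iff_pos_right, mul_pos_iff_of_pos_left (hr l), sub_pos] at ht'
      have h1 := sub_nonpos.mp (ht.1 (hr l))
      simp only [hu] at h1 ht'
      rw [div_le_iff₀ (hK0 l)] at h1
      rw [lt_div_iff₀ (hK0 l)] at ht'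
      have h2 : (0 : ℝ) ≤ bz t l := by exact_mod_cast bz_nonneg t l
      have h3 : (bz t' l : ℝ) ≤ 1 := by exact_mod_cast bz_le_one t' l
      symm
      rw [hw₀]
      refine Int.floor_eq_iff.mpr ⟨?_, ?_⟩ <;> linarith [mul_comm (P l) (K l : ℝ)]
  simp only [key]
  have hj0 : 0 ≤ w₀ 0 := Int.floor_nonneg.mpr (mul_nonneg (hK0 0).le (hP 0).1.le)
  have hj1 : w₀ 0 < (M + 1 : ℕ) := by
    rw [hw₀, Int.floor_lt]
    have h0 := hK0 0
    have := mul_lt_mul_of_pos_left (hP 0).2 h0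
    have e : K 0 = M + 1 := rfl
    rw [e] at this ⊢
    simpa using this
  rw [Finset.sum_eq_single (w₀ 0).toNat]
  · rw [finsum_eq_single _ (Fin.tail w₀), if_pos]
    · rw [Int.toNat_of_nonneg hj0]
      exact Fin.cons_self_tail w₀
    · intro v hv
      rw [if_neg]
      rintro h
      exact hv (by rw [← h, Fin.tail_cons])
  · intro j _ hj
    refine (finsum_congr fun v => if_neg fun h => hj ?_).trans finsum_zero
    have := congrFun h 0
    rw [Fin.cons_zero] at this
    omega
  · intro h
    exact absurd (Finset.mem_range.mpr (by omega)) h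

end LocalDegree

section GeneratorDegree

open LCube Filter

variable {k : ℕ} {p : Fin (k + 3) → ℝ}

/-- The sides of the box on which `simplexPrism` is used. -/
def prismScale (l : Fin (k + 3)) : ℝ := if l = 0 then 1 else 5

theorem prismScale_pos (l : Fin (k + 3)) : 0 < prismScale l := by
  unfold prismScale
  split_ifs <;> norm_num

theorem prismScale_cons (σ : ℝ) (t : Fin (k + 2) → ℝ) :
    (fun l => prismScale l * (Fin.cons σ t : Fin (k + 3) → ℝ) l) =
      Fin.cons σ (((5 : ℕ) : ℝ) • t) := by
  funext l
  refine Fin.cases ?_ (fun i => ?_) l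
  · simp [prismScale]
  · simp [prismScale, Fin.succ_ne_zero]

theorem simplexPrism_end (z : Fin (k + 3) → ℤ) (s : ℤ) (t : Fin (k + 2) → ℝ) :
    simplexPrism z (fun l => prismScale l * (Fin.cons (s : ℝ) t : Fin (k + 3) → ℝ) l) =
      kuhn (hatLabel (fun t => z + bz (leadC (k + 3) LCube.stair t)) s) (((5 : ℕ) : ℝ) • t) := by
  rw [prismScale_cons, simplexPrism, kuhn_cons]
  rfl

theorem simplexPrism_bdry (z : Fin (k + 3) → ℤ) (σ : ℝ) {t : Fin (k + 2) → ℝ} (ht : OnBdry t) :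
    simplexPrism z (fun l => prismScale l * (Fin.cons σ t : Fin (k + 3) → ℝ) l) = 0 := by
  obtain ⟨i, hi⟩ := ht
  rw [prismScale_cons, simplexPrism, ← toR_zero]
  refine kuhn_eq_const fun ε hε => zeroOut_hatLabel _ _ _ i (hi.imp (fun h => ?_) fun h => ?_)
  · exact carrier_vertex_le (i := i.succ) hε (by simp [h])
  · exact le_carrier_vertex (i := i.succ) hε (by simp [h])

theorem degHom_bdryCls (hp : GenericPt p) (z z' : Fin (k + 3) → ℤ) :
    degHom hp z' (bdryCls hp z) = if z' = z then 1 else 0 := by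
  set F : (Fin (k + 3) → ℝ) → (Fin (k + 3) → ℝ) :=
    fun x => simplexPrism z fun l => prismScale l * x l with hFdef
  have hc : Continuous F := (continuous_kuhn _).comp (by fun_prop)
  have hF : ∀ σ ∈ Set.Icc (0 : ℝ) 1, ∀ t ∈ Set.Icc (0 : Fin (k + 2) → ℝ) 1, OnBdry t →
      F (Fin.cons σ t) = 0 := fun σ _ t _ ht => simplexPrism_bdry z σ ht
  have hend : ∀ (s : ℤ), (fun t : Fin (k + 2) → ℝ => F (Fin.cons (s : ℝ) t)) = fun t =>
      kuhn (hatLabel (fun t => z + bz (leadC (k + 3) LCube.stair t)) s) (((5 : ℕ) : ℝ) • t) :=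
    fun s => funext fun t => simplexPrism_end z s t
  have h1 := hend 1
  have h0 := hend 0
  rw [Int.cast_one] at h1
  rw [Int.cast_zero] at h0
  rw [bdryCls, cob_cubeCls_eq, map_sub, kcls, kcls,
    degHom_cls hp z' ((zeroOut_hatLabel _ _).isLoop hp),

    degHom_cls hp z' ((zeroOut_hatLabel _ _).isLoop hp), ← h1, ← h0, ← Germ.coe_sub]
  split_ifs with hz
  · refine (Germ.coe_eq (g := fun _ => (1 : ℤ))).mpr ?_
    subst hz
    set P : Fin (k + 3) → ℝ := fun l => (p l + prismShift l) / prismScale l with hPdef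
    have hsc : ∀ x : Fin (k + 3) → ℝ, ∀ l, prismScale l * x l - prismShift l =
        p l + prismScale l * (x l - P l) := by
      intro x l
      have := prismScale_pos l
      simp only [hPdef]
      field_simp
      ring
    have hP : ∀ l, P l ∈ Set.Ioo (0 : ℝ) 1 := by
      intro l
      have := hp.pos l
      have := hp.lt_one l
      simp only [hPdef, prismShift, prismScale]
      split_ifs <;> constructor <;> linarith
    have hcont : ∀ l, Continuous fun x : Fin (k + 3) → ℝ => prismScale l * x l - prismShift l :=
      fun l => by fun_prop
    have hPval : ∀ l, prismScale l * P l - prismShift l = p l := fun l => by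
      rw [hsc, sub_self, mul_zero, add_zero]
    have hloc : ∀ᶠ x in nhds P, ∀ l, F x l = (p + toR z') l + prismScale l * (x l - P l) := by
      have e1 : ∀ᶠ x in nhds P, ∀ l, 0 < prismScale l * x l - prismShift l ∧
          prismScale l * x l - prismShift l < 1 :=
        eventually_all.mpr fun l => (hcont l).continuousAt.eventually
          (Ioo_mem_nhds ((hp.pos l).trans_eq (hPval l).symm) ((hPval l).trans_lt (hp.lt_one l)))
      have e2 : ∀ᶠ x in nhds P, ∀ l l', l < l' →
          prismScale l' * x l' - prismShift l' < prismScale l * x l - prismShift l :=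
        eventually_all.mpr fun l => eventually_all.mpr fun l' => eventually_imp_distrib_left.mpr
          fun hll => (hcont l').continuousAt.eventually_lt (hcont l).continuousAt
            (by rw [hPval, hPval]; exact hp.strictAnti hll)
      filter_upwards [e1, e2] with x hx1 hx2 l
      simp only [hFdef]
      rw [simplexPrism_affine z' hx1 fun l l' h => hx2 l l' h, hsc]
      simp only [Pi.add_apply, toR]
      ring
    obtain ⟨δ, hδ, hd⟩ := degAt_sub_eq_one (Nat.succ_pos _) hc hF hP prismScale_pos hloc
      fun x _ hx => by
        have := (eq_of_simplexPrism_eq hp hx).2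
        funext l
        have h2 := this l
        rw [hsc] at h2
        have h3 : prismScale l * (x l - P l) = 0 := by linarith
        rcases mul_eq_zero.mp h3 with h | h
        · exact absurd h (prismScale_pos l).ne'
        · linarith
    filter_upwards [eventually_fine hδ, eventually_ge_atTop fun _ : Fin (k + 2) => 1] with N hN hN1
    exact hd N (fun i => hN1 i) hN
  · refine (Germ.coe_eq (g := fun _ => (0 : ℤ))).mpr ?_
    obtain ⟨δ, hδ, hd⟩ := degAt_homotopy (Nat.succ_pos _) hc (p + toR z') hF
      fun x _ hx => hz (eq_of_simplexPrism_eq hp hx).1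
    filter_upwards [eventually_fine hδ] with N hN
    rw [Pi.sub_apply, hd N hN, sub_self]

end GeneratorDegree

/-! ### Radial retraction onto the skeleton -/

section Retraction

open Set

theorem locallyFinite_unitCube {n : ℕ} :
    LocallyFinite fun z : Fin n → ℤ => Icc (toR z) (toR z + 1) := by
  intro x
  refine ⟨Metric.ball x 1, Metric.ball_mem_nhds x one_pos, ?_⟩
  refine (finite_Icc (fun i => ⌊x i⌋ - 2) (fun i => ⌊x i⌋ + 2)).subset ?_
  rintro z ⟨y, hy, hyx⟩
  have h1 : ∀ i, |y i - x i| < 1 := fun i => by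
    have := (dist_pi_lt_iff one_pos).mp hyx i
    rwa [Real.dist_eq] at this
  constructor <;> intro i
  · have a1 := hy.2 i
    have a2 := (abs_lt.mp (h1 i)).1
    have a3 := Int.floor_le (x i)
    simp only [Pi.add_apply, toR, Pi.one_apply] at a1
    have : (⌊x i⌋ : ℝ) < z i + 2 := by linarith
    norm_cast at this
    simp only
    omega
  · have a1 := hy.1 i
    have a2 := (abs_lt.mp (h1 i)).2
    have a3 := Int.lt_floor_add_one (x i)
    simp only [toR] at a1
    have : (z i : ℝ) < ⌊x i⌋ + 2 := by linarith
    norm_cast at this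
    simp only
    omega

variable {m : ℕ} {p : Fin (m + 1) → ℝ}

/-- The gauge of the unit cube with centre `p`. -/
noncomputable def cubeGauge (p u : Fin (m + 1) → ℝ) : ℝ :=
  Finset.univ.sup' Finset.univ_nonempty fun i => max (u i / (1 - p i)) (-u i / p i)

/-- The radial projection of a unit cube from an interior point to its boundary. -/
noncomputable def radial (p : Fin (m + 1) → ℝ) (z : Fin (m + 1) → ℤ) (x : Fin (m + 1) → ℝ) :
    Fin (m + 1) → ℝ :=
  toR z + p + (cubeGauge p (x - toR z - p))⁻¹ • (x - toR z - p)

theorem le_cubeGauge (p u : Fin (m + 1) → ℝ) (i : Fin (m + 1)) :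
    max (u i / (1 - p i)) (-u i / p i) ≤ cubeGauge p u :=
  Finset.le_sup' (fun i => max (u i / (1 - p i)) (-u i / p i)) (Finset.mem_univ i)

theorem continuous_cubeGauge (p : Fin (m + 1) → ℝ) : Continuous (cubeGauge p) := by
  unfold cubeGauge
  refine Continuous.finset_sup'_apply _ fun i _ => ?_
  exact ((continuous_apply i).div_const _).max ((continuous_apply i).neg.div_const _)

theorem sub_center_ne_zero {z : Fin (m + 1) → ℤ} {x : Fin (m + 1) → ℝ} (hx : x ≠ p + toR z) :
    x - toR z - p ≠ 0 := by
  rwa [sub_sub, sub_ne_zero, add_comm (toR z) p]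

theorem cubeGauge_pos (hp : ∀ i, p i ∈ Ioo (0 : ℝ) 1) {u : Fin (m + 1) → ℝ}
    (hu : u ≠ 0) : 0 < cubeGauge p u := by
  obtain ⟨i, hi⟩ := Function.ne_iff.mp hu
  refine lt_of_lt_of_le ?_ (le_cubeGauge p u i)
  rcases lt_or_gt_of_ne hi with h | h
  · exact lt_max_of_lt_right (div_pos (neg_pos.mpr h) (hp i).1)
  · exact lt_max_of_lt_left (div_pos h (sub_pos.mpr (hp i).2))

theorem radial_mem_cube (hp : ∀ i, p i ∈ Ioo (0 : ℝ) 1) {z : Fin (m + 1) → ℤ}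
    {x : Fin (m + 1) → ℝ} (hx : x ≠ p + toR z) :
    radial p z x ∈ Icc (toR z) (toR z + 1) := by
  have hu : x - toR z - p ≠ 0 := sub_center_ne_zero hx
  unfold radial
  set u := x - toR z - p
  have hγ := cubeGauge_pos hp hu
  have key : ∀ i, u i ≤ cubeGauge p u * (1 - p i) ∧ -u i ≤ cubeGauge p u * p i := fun i => by
    have := max_le_iff.mp (le_cubeGauge p u i)
    rwa [div_le_iff₀ (sub_pos.mpr (hp i).2), div_le_iff₀ (hp i).1] at this
  constructor <;> intro i <;>
    simp only [Pi.add_apply, Pi.smul_apply, smul_eq_mul, Pi.one_apply, inv_mul_eq_div]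
  · have := (key i).2
    have : -(u i / cubeGauge p u) ≤ p i := by
      rw [← neg_div, div_le_iff₀ hγ]
      linarith
    linarith
  · have := (key i).1
    have : u i / cubeGauge p u ≤ 1 - p i := by
      rw [div_le_iff₀ hγ]
      linarith
    linarith

theorem radial_mem_skeleton (hp : ∀ i, p i ∈ Ioo (0 : ℝ) 1) {z : Fin (m + 1) → ℤ}
    {x : Fin (m + 1) → ℝ} (hx : x ≠ p + toR z) :
    ∃ j, ∃ s : ℤ, radial p z x j = (s : ℝ) := by
  have hu : x - toR z - p ≠ 0 := sub_center_ne_zero hx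
  unfold radial
  set u := x - toR z - p
  have hγ := cubeGauge_pos hp hu
  obtain ⟨i, -, hi⟩ := Finset.exists_mem_eq_sup' (Finset.univ_nonempty (α := Fin (m + 1)))
    fun i => max (u i / (1 - p i)) (-u i / p i)
  change cubeGauge p u = _ at hi
  refine ⟨i, ?_⟩
  have h0 := (hp i).1.ne'
  have h1 := (sub_pos.mpr (hp i).2).ne'
  simp only [Pi.add_apply, Pi.smul_apply, smul_eq_mul, inv_mul_eq_div, toR]
  rcases max_choice (u i / (1 - p i)) (-u i / p i) with h | h
  · rw [h, eq_div_iff h1] at hi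
    refine ⟨z i + 1, ?_⟩
    rw [← hi, mul_div_cancel_left₀ _ hγ.ne']
    push_cast
    ring
  · rw [h, eq_div_iff h0] at hi
    refine ⟨z i, ?_⟩
    have hi' : u i = -(cubeGauge p u * p i) := by linarith
    rw [hi', neg_div, mul_div_cancel_left₀ _ hγ.ne']
    ring

theorem radial_eq_self (hp : ∀ i, p i ∈ Ioo (0 : ℝ) 1) {z : Fin (m + 1) → ℤ}
    {x : Fin (m + 1) → ℝ}
    (hx : x ∈ Icc (toR z) (toR z + 1)) (hs : ∃ j, ∃ s : ℤ, x j = (s : ℝ)) :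
    radial p z x = x := by
  have h1 : cubeGauge p (x - toR z - p) = 1 := by
    refine le_antisymm (Finset.sup'_le _ _ fun i _ => ?_) ?_
    · have a1 := hx.1 i
      have a2 := hx.2 i
      simp only [Pi.add_apply, Pi.one_apply] at a2
      rw [max_le_iff, div_le_one (sub_pos.mpr (hp i).2), div_le_one (hp i).1]
      simp only [Pi.sub_apply]
      constructor <;> linarith
    · obtain ⟨j, s, hj⟩ := hs
      refine le_trans ?_ (le_cubeGauge _ _ j)
      have a1 := hx.1 j
      have a2 := hx.2 j
      simp only [Pi.add_apply, Pi.one_apply, toR, hj] at a1 a2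
      norm_cast at a1 a2
      rw [le_max_iff, one_le_div (sub_pos.mpr (hp j).2), one_le_div (hp j).1]
      simp only [Pi.sub_apply, toR, hj]
      rcases (by omega : s = z j ∨ s = z j + 1) with rfl | rfl
      · right
        linarith
      · left
        push_cast
        linarith
  rw [radial, h1, inv_one, one_smul]
  abel

theorem segment_radial_subset (hp : ∀ i, p i ∈ Ioo (0 : ℝ) 1) {z : Fin (m + 1) → ℤ}
    {x : Fin (m + 1) → ℝ}
    (hx : x ∈ Icc (toR z) (toR z + 1)) (hne : x ≠ p + toR z) :
    segment ℝ x (radial p z x) ⊆ Punct p := by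
  intro y hy z' hz
  have hcube := (convex_Icc (toR z) (toR z + 1)).segment_subset hx (radial_mem_cube hp hne) hy
  have hz' : z' = z := by
    funext i
    have a1 := hcube.1 i
    have a2 := hcube.2 i
    simp only [hz, Pi.add_apply, Pi.one_apply, toR] at a1 a2
    have a3 := (hp i).1
    have a4 := (hp i).2
    have b1 : (z i : ℝ) < z' i + 1 := by linarith
    have b2 : (z' i : ℝ) < z i + 1 := by linarith
    norm_cast at b1 b2
    omega
  subst hz'
  have hu : x - toR z' - p ≠ 0 := sub_center_ne_zero hne
  have hγ := cubeGauge_pos hp hu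
  obtain ⟨a, b, ha, hb, hab, rfl⟩ := hy
  have e : a • x + b • radial p z' x - (p + toR z') =
      (a + b * (cubeGauge p (x - toR z' - p))⁻¹) • (x - toR z' - p) := by
    funext i
    have : a = 1 - b := by linarith
    subst this
    simp only [radial, Pi.sub_apply, Pi.add_apply, Pi.smul_apply, smul_eq_mul]
    ring
  rw [hz, sub_self, eq_comm, smul_eq_zero] at e
  rcases e with e | e
  · have h1 : 0 ≤ b * (cubeGauge p (x - toR z' - p))⁻¹ := mul_nonneg hb (inv_pos.mpr hγ).le
    have ha0 : a = 0 := by linarith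
    have hb1 : b = 1 := by linarith
    rw [ha0, hb1, zero_add, one_mul] at e
    exact (inv_pos.mpr hγ).ne' e
  · exact hu e

theorem exists_retraction (hp : ∀ i, p i ∈ Ioo (0 : ℝ) 1) :
    ∃ r : (Fin (m + 1) → ℝ) → (Fin (m + 1) → ℝ),
    ContinuousOn r (Punct p) ∧ (∀ x ∈ Punct p, ∃ j, ∃ s : ℤ, r x j = (s : ℝ)) ∧
    (∀ x : Fin (m + 1) → ℝ, (∃ j, ∃ s : ℤ, x j = (s : ℝ)) → r x = x) ∧
    ∀ x ∈ Punct p, segment ℝ x (r x) ⊆ Punct p := by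
  have hfl : ∀ x : Fin (m + 1) → ℝ, x ∈ Icc (toR fun i => ⌊x i⌋) ((toR fun i => ⌊x i⌋) + 1) :=
    fun x => ⟨fun i => Int.floor_le _, fun i => (Int.lt_floor_add_one _).le⟩
  refine ⟨fun x => radial p (fun i => ⌊x i⌋) x, ?_, fun x hx => radial_mem_skeleton hp (hx _),
    fun x hx => radial_eq_self hp (hfl x) hx, fun x hx => segment_radial_subset hp (hfl x) (hx _)⟩
  rw [continuousOn_iff_continuous_domRestrict]
  refine (locallyFinite_unitCube.preimage_continuous
    (continuous_subtype_val (p := (· ∈ Punct p)))).continuous ?_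
    (fun z => isClosed_Icc.preimage continuous_subtype_val) fun z => ?_
  · exact eq_univ_of_forall fun x => mem_iUnion.mpr ⟨_, hfl x⟩
  · have hcont : Continuous fun x : Punct p => radial p z x := by
      unfold radial
      have hu : Continuous fun x : Punct p => (x : Fin (m + 1) → ℝ) - toR z - p :=
        (continuous_subtype_val.sub continuous_const).sub continuous_const
      refine continuous_const.add (Continuous.fun_smul ?_ hu)
      refine ((continuous_cubeGauge p).comp hu).inv₀ fun x => (cubeGauge_pos hp ?_).ne'
      exact sub_center_ne_zero (x.2 z)
    refine hcont.continuousOn.congr fun x hx => ?_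
    change radial p (fun i => ⌊(x : Fin (m + 1) → ℝ) i⌋) x = radial p z x
    by_cases h : (fun i => ⌊(x : Fin (m + 1) → ℝ) i⌋) = z
    · rw [h]
    · obtain ⟨j, hj⟩ := Function.ne_iff.mp h
      have hs : ∃ j, ∃ s : ℤ, (x : Fin (m + 1) → ℝ) j = (s : ℝ) := by
        refine ⟨j, z j + 1, le_antisymm (by simpa [toR] using hx.2 j) ?_⟩
        have h1 : z j ≤ ⌊(x : Fin (m + 1) → ℝ) j⌋ := Int.le_floor.mpr (hx.1 j)
        have h2 : z j + 1 ≤ ⌊(x : Fin (m + 1) → ℝ) j⌋ := by omega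
        exact Int.le_floor.mp h2
      rw [radial_eq_self hp (hfl x) hs, radial_eq_self hp hx hs]

end Retraction

/-! ### Functoriality of homotopy groups and the conclusion -/

section Pushforward

variable {N X Y : Type*} [TopologicalSpace X] [TopologicalSpace Y]

/-- Composition of a generalised loop with a continuous map. -/
def GenLoop.map {x : X} {y : Y} (f : C(X, Y)) (h : f x = y) (γ : GenLoop N X x) : GenLoop N Y y :=
  ⟨f.comp γ.1, fun t ht => (congrArg f (γ.2 t ht)).trans h⟩

theorem GenLoop.Homotopic.map {x : X} {y : Y} (f : C(X, Y)) (h : f x = y)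
    {γ γ' : GenLoop N X x} (H : GenLoop.Homotopic γ γ') :
    GenLoop.Homotopic (GenLoop.map f h γ) (GenLoop.map f h γ') :=
  ContinuousMap.HomotopicRel.comp_continuousMap H f

theorem GenLoop.map_transAt [DecidableEq N] {x : X} {y : Y} (f : C(X, Y)) (h : f x = y) (i : N)
    (γ γ' : GenLoop N X x) :
    GenLoop.map f h (GenLoop.transAt i γ γ') =
      GenLoop.transAt i (GenLoop.map f h γ) (GenLoop.map f h γ') := by
  ext t
  exact apply_ite f _ _ _

/-- A homeomorphism induces isomorphisms of homotopy groups. -/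
def HomotopyGroup.mulEquivOfHomeomorph [DecidableEq N] [Nonempty N] {x : X} {y : Y} (e : X ≃ₜ Y)
    (h : e x = y) : HomotopyGroup N X x ≃* HomotopyGroup N Y y where
  toFun := Quotient.map (GenLoop.map (e : C(X, Y)) h) fun _ _ H => H.map _ _
  invFun := Quotient.map (GenLoop.map (e.symm : C(Y, X)) (e.symm_apply_eq.mpr h.symm))
    fun _ _ H => H.map _ _
  left_inv q := by
    induction q using Quotient.inductionOn with
    | h γ => exact congrArg (Quotient.mk _) (GenLoop.ext _ _ fun t => e.symm_apply_apply _)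
  right_inv q := by
    induction q using Quotient.inductionOn with
    | h γ => exact congrArg (Quotient.mk _) (GenLoop.ext _ _ fun t => e.apply_symm_apply _)
  map_mul' q q' := by
    induction q, q' using Quotient.inductionOn₂ with
    | h γ γ' =>
      let i : N := Classical.arbitrary N
      refine (congrArg _ (HomotopyGroup.mul_spec (i := i))).trans ?_
      refine Eq.trans ?_ (HomotopyGroup.mul_spec (i := i)).symm
      exact congrArg (Quotient.mk _) (GenLoop.map_transAt _ h i γ' γ)

end Pushforward

section Conclusion

open LCube Filter

variable {k n : ℕ} {S T : Set (Fin n → ℝ)}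

theorem IsLoop.comp_clampI {g : (Fin n → ℝ) → (Fin n → ℝ)} (hg : ContinuousOn g S)
    (hm : Set.MapsTo g S T) (h0 : g 0 = 0) {φ : (Fin k → ℝ) → (Fin n → ℝ)} (hφ : IsLoop S φ) :
    IsLoop T fun t => g (φ (clampI t)) :=
  ⟨hg.comp_continuous (hφ.cont.comp continuous_clampI) fun t => hφ.mem _ (clampI_mem t),
    fun t _ => hm (hφ.mem _ (clampI_mem t)),
    fun t ht hb => by rw [clampI_of_mem ht, hφ.bdry t ht hb, h0]⟩

theorem cls_comp_clampI_eq (hS : (0 : Fin n → ℝ) ∈ S) (hT : (0 : Fin n → ℝ) ∈ T)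
    {g : (Fin n → ℝ) → (Fin n → ℝ)} (hg : ContinuousOn g S) (hm : Set.MapsTo g S T) (h0 : g 0 = 0)
    {φ ψ : (Fin (k + 2) → ℝ) → (Fin n → ℝ)} (hφ : IsLoop S φ) (hψ : IsLoop S ψ)
    (h : cls hS φ = cls hS ψ) :
    cls hT (fun t => g (φ (clampI t))) = cls hT fun t => g (ψ (clampI t)) := by
  obtain ⟨F, hF, hFS, hb, hF0, hF1⟩ := exists_homotopy_of_cls_eq hφ hψ h
  have hcons : Continuous (Function.uncurry fun (s : ℝ) (t : Fin (k + 2) → ℝ) =>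
      (Fin.cons s t : Fin (k + 3) → ℝ)) := continuous_pi fun i => by
    refine Fin.cases ?_ (fun i => ?_) i
    · exact continuous_fst
    · exact (continuous_apply i).comp continuous_snd
  refine cls_homotopy hT (fun s t => g (F (Fin.cons s t)))
    (hg.comp_continuous (hF.comp hcons) fun _ => hFS _) (fun s _ t _ => hm (hFS _))
    (fun s _ t _ ht => by rw [hb s t ht, h0])
    (hφ.comp_clampI hg hm h0).cont (hψ.comp_clampI hg hm h0).cont
    (fun t ht => ?_) fun t ht => ?_
  · rw [hF0 t ht, clampI_of_mem ht]
  · rw [hF1 t ht, clampI_of_mem ht]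

theorem IsLoop.mono {φ : (Fin k → ℝ) → (Fin n → ℝ)} (hφ : IsLoop S φ) (h : S ⊆ T) : IsLoop T φ :=
  ⟨hφ.cont, fun t ht => h (hφ.mem t ht), hφ.bdry⟩

theorem cls_eq_of_subset (hS : (0 : Fin n → ℝ) ∈ S) (h : S ⊆ T)
    {φ ψ : (Fin (k + 2) → ℝ) → (Fin n → ℝ)} (hφ : IsLoop S φ) (hψ : IsLoop S ψ)
    (he : cls hS φ = cls hS ψ) : cls (h hS) φ = cls (h hS) ψ := by
  have key : ∀ {χ : (Fin (k + 2) → ℝ) → (Fin n → ℝ)}, IsLoop S χ →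
      cls (h hS) χ = cls (h hS) fun t => χ (clampI t) := fun hχ =>
    cls_congr _ (hχ.mono h) (hχ.cont.comp continuous_clampI) fun t ht => by rw [clampI_of_mem ht]
  rw [key hφ, key hψ]
  exact cls_comp_clampI_eq hS (h hS) continuousOn_id h rfl hφ hψ he

/-- The homomorphism of homotopy groups induced by an inclusion. -/
noncomputable def inclHom (k : ℕ) (hS : (0 : Fin n → ℝ) ∈ S) (h : S ⊆ T) :
    PiGrp k hS →+ PiGrp k (h hS) :=
  AddMonoidHom.mk' (fun x => cls (h hS) (exists_cls_eq hS x).choose) fun x y => by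
    obtain ⟨hx, ex⟩ := (exists_cls_eq hS x).choose_spec
    obtain ⟨hy, ey⟩ := (exists_cls_eq hS y).choose_spec
    obtain ⟨hxy, exy⟩ := (exists_cls_eq hS (x + y)).choose_spec
    rw [← cls_concat_eq (h hS) (hx.mono h) (hy.mono h)]
    exact cls_eq_of_subset hS h hxy (isLoop_concat hx hy)
      (by rw [exy, cls_concat_eq hS hx hy, ex, ey])

theorem inclHom_cls (hS : (0 : Fin n → ℝ) ∈ S) (h : S ⊆ T)
    {φ : (Fin (k + 2) → ℝ) → (Fin n → ℝ)} (hφ : IsLoop S φ) :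
    inclHom k hS h (cls hS φ) = cls (h hS) φ := by
  obtain ⟨hx, ex⟩ := (exists_cls_eq hS (cls hS φ)).choose_spec
  exact cls_eq_of_subset hS h hx hφ ex

theorem exists_retract_loop {p : Fin (k + 3) → ℝ} (hp : GenericPt p)
    {φ : (Fin (k + 2) → ℝ) → (Fin (k + 3) → ℝ)} (hφ : IsLoop (Punct p) φ) :
    ∃ ψ, IsLoop {x : Fin (k + 3) → ℝ | ∃ j, ∃ s : ℤ, x j = (s : ℝ)} ψ ∧
      cls hp.zero_mem ψ = cls hp.zero_mem φ := by
  obtain ⟨r, hr, hm, hid, hseg⟩ := exists_retraction fun i => ⟨hp.pos i, hp.lt_one i⟩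
  have h0 : r 0 = 0 := hid 0 ⟨0, 0, by simp⟩
  have hψ := hφ.comp_clampI (T := {x : Fin (k + 3) → ℝ | ∃ j, ∃ s : ℤ, x j = (s : ℝ)}) hr hm h0
  refine ⟨_, hψ, (cls_segment hp.zero_mem hφ.cont hψ.cont hφ.bdry hψ.bdry fun t ht => ?_).symm⟩
  rw [clampI_of_mem ht]
  exact hseg _ (hφ.mem t ht)

theorem zero_mem_skeleton (k : ℕ) :
    (0 : Fin (k + 3) → ℝ) ∈ {x : Fin (k + 3) → ℝ | ∃ j, ∃ s : ℤ, x j = (s : ℝ)} :=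
  ⟨0, 0, by simp⟩

theorem inclHom_bijective {p : Fin (k + 3) → ℝ} (hp : GenericPt p) :
    Function.Bijective (inclHom k (zero_mem_skeleton k) hp.subset_punct) := by
  constructor
  · intro x y h
    obtain ⟨φ, hφ, rfl⟩ := exists_cls_eq _ x
    obtain ⟨ψ, hψ, rfl⟩ := exists_cls_eq _ y
    rw [inclHom_cls _ _ hφ, inclHom_cls _ _ hψ] at h
    obtain ⟨r, hr, hm, hid, -⟩ := exists_retraction fun i => ⟨hp.pos i, hp.lt_one i⟩
    have h0 : r 0 = 0 := hid 0 (zero_mem_skeleton k)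
    have key : ∀ {χ : (Fin (k + 2) → ℝ) → (Fin (k + 3) → ℝ)},
        IsLoop {x : Fin (k + 3) → ℝ | ∃ j, ∃ s : ℤ, x j = (s : ℝ)} χ →
        cls (zero_mem_skeleton k) χ = cls (zero_mem_skeleton k) fun t => r (χ (clampI t)) :=
      fun hχ => cls_congr _ hχ ((hχ.mono hp.subset_punct).comp_clampI
        (T := {x : Fin (k + 3) → ℝ | ∃ j, ∃ s : ℤ, x j = (s : ℝ)}) hr hm h0).cont fun t ht => by
        rw [clampI_of_mem ht, hid _ (hχ.mem t ht)]
    rw [key hφ, key hψ]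
    exact cls_comp_clampI_eq hp.zero_mem (zero_mem_skeleton k) hr hm h0
      (hφ.mono hp.subset_punct) (hψ.mono hp.subset_punct) h
  · intro x
    obtain ⟨φ, hφ, rfl⟩ := exists_cls_eq _ x
    obtain ⟨ψ, hψ, e⟩ := exists_retract_loop hp hφ
    exact ⟨cls _ ψ, (inclHom_cls _ _ hψ).trans e⟩

theorem lift_bdryCls_bijective {p : Fin (k + 3) → ℝ} (hp : GenericPt p) :
    Function.Bijective (FreeAbelianGroup.lift (bdryCls hp)) := by
  constructor
  · rw [injective_iff_map_eq_zero]
    intro x hx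
    have key : ∀ z, (degHom hp z).comp (FreeAbelianGroup.lift (bdryCls hp)) =
        (Int.castAddHom (Germ (atTop : Filter (Fin (k + 2) → ℕ)) ℤ)).comp
          (FreeAbelianGroup.coeff z) := by
      intro z
      refine FreeAbelianGroup.lift_ext _ _ fun z' => ?_
      simp only [AddMonoidHom.comp_apply, FreeAbelianGroup.lift_apply_of, degHom_bdryCls,
        FreeAbelianGroup.coeff, FreeAbelianGroup.toFinsupp_of, Finsupp.applyAddHom_apply,
        Finsupp.single_apply, eq_comm (a := z'), Int.coe_castAddHom]
      split_ifs <;> simp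
    have hz : ∀ z, FreeAbelianGroup.coeff z x = 0 := by
      intro z
      have h := DFunLike.congr_fun (key z) x
      rw [AddMonoidHom.comp_apply, hx, map_zero, AddMonoidHom.comp_apply] at h
      obtain ⟨N, hN⟩ := (Germ.coe_eq (f := fun _ => (0 : ℤ))
        (g := fun _ => FreeAbelianGroup.coeff z x)).mp h |>.exists
      exact hN.symm
    rw [← Finsupp.toFreeAbelianGroup_toFinsupp x,
      show FreeAbelianGroup.toFinsupp x = 0 from Finsupp.ext hz, map_zero]
  · intro x
    obtain ⟨φ, hφ, rfl⟩ := exists_cls_eq _ x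
    obtain ⟨ψ, hψ, e⟩ := exists_retract_loop hp hφ
    rw [← e, ← AddMonoidHom.mem_range]
    refine (AddSubgroup.closure_le _).mpr ?_ (cls_mem_closure hp hψ)
    rintro _ ⟨z, rfl⟩
    exact ⟨FreeAbelianGroup.of z, FreeAbelianGroup.lift_apply_of _ _⟩

theorem nonempty_addEquiv_skeleton (k : ℕ) :
    Nonempty (PiGrp k (zero_mem_skeleton k) ≃+ FreeAbelianGroup (Fin (k + 3) → ℤ)) := by
  obtain ⟨p, hp⟩ := exists_genericPt (k + 3)
  exact ⟨(AddEquiv.ofBijective _ (inclHom_bijective hp)).trans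
    (AddEquiv.ofBijective _ (lift_bdryCls_bijective hp)).symm⟩

end Conclusion

/-- For `n ≥ 3`, the homotopy group `π_{n−1}(Ñ₀, 0)` of the `(n−1)`-skeleton `Ñ₀` of the
unit cubical decomposition of `ℝⁿ` is isomorphic, as a group, to the free abelian group
on the set `ℤⁿ` (the direct sum of copies of `ℤ` indexed by `ℤⁿ`). Here `n − 1` is written
as `n − 2 + 1`, which is equal to it since `n ≥ 3`. -/
theorem stmt_14 (n : ℕ) (hn : 3 ≤ n) :
    Nonempty ((HomotopyGroup.Pi (n - 2 + 1)
        {x : EuclideanSpace ℝ (Fin n) // ∃ j, ∃ k : ℤ, x j = (k : ℝ)}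
        ⟨0, ⟨⟨0, by omega⟩, 0, by simp⟩⟩)
      ≃* Multiplicative (FreeAbelianGroup (Fin n → ℤ))) := by
  obtain ⟨k, rfl⟩ := Nat.exists_eq_add_of_le' hn
  obtain ⟨e⟩ := nonempty_addEquiv_skeleton k
  let h : {x : EuclideanSpace ℝ (Fin (k + 3)) // ∃ j, ∃ k : ℤ, x j = (k : ℝ)} ≃ₜ
      {x : Fin (k + 3) → ℝ | ∃ j, ∃ s : ℤ, x j = (s : ℝ)} :=
    (EuclideanSpace.equiv (Fin (k + 3)) ℝ).toHomeomorph.subtype fun x => Iff.rfl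
  exact ⟨(HomotopyGroup.mulEquivOfHomeomorph (N := Fin (k + 2)) h (Subtype.ext rfl)).trans
    (AddEquiv.toMultiplicativeRight e)⟩
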